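/- Let k be an algebraically closed field with char(k) ≠ 3. If G is a subgroup of the Cremona group Cr_k = Aut_k(k(x,y)) which is isomorphic to (ℤ/3)^r for some natural number r, then r ≤ 3. -/

import Mathlib

/-- The field `k(x,y)` of rational functions in two variables over `k`. -/
noncomputable abbrev Kxy (k : Type*) [Field k] : Type _ :=
  FractionRing (MvPolynomial (Fin 2) k)

open Polynomial
open scoped ENNReal

set_option linter.unusedSectionVars false

section IntersectionNumber

variable (k : Type*) {B : Type*} [Field k] [CommRing B] [Algebra k B]

/-- The intersection number of `f` and `g`: the length over `k` of `B ⧸ (f, g)`. -/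
noncomputable def inum (f g : B) : ℝ≥0∞ :=
  ((Module.length k (B ⧸ Ideal.span {f, g}) : ℕ∞) : ℝ≥0∞)

variable {k}

theorem inum_eq_of_span_eq {f g f' g' : B} (h : Ideal.span {f, g} = Ideal.span {f', g'}) :
    inum k f g = inum k f' g' := by
  unfold inum; rw [h]

theorem inum_comm (f g : B) : inum k f g = inum k g f :=
  inum_eq_of_span_eq (by rw [Set.pair_comm])

theorem inum_add_mul_right (f g h : B) : inum k f (g + h * f) = inum k f g :=
  inum_eq_of_span_eq (by
    ext z
    rw [Ideal.mem_span_pair, Ideal.mem_span_pair]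
    constructor
    · rintro ⟨a, b, rfl⟩
      exact ⟨a + b * h, b, by ring⟩
    · rintro ⟨a, b, rfl⟩
      exact ⟨a - b * h, b, by ring⟩)

theorem inum_mono {f g f' g' : B} (h : Ideal.span {f, g} ≤ Ideal.span {f', g'}) :
    inum k f' g' ≤ inum k f g := by
  unfold inum
  have := Module.length_le_of_surjective (Ideal.Quotient.factorₐ k h).toLinearMap
    (Ideal.Quotient.factor_surjective h)
  exact_mod_cast this

theorem inum_eq_zero_iff {f g : B} : inum k f g = 0 ↔ Ideal.span {f, g} = ⊤ := by
  unfold inum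
  rw [ENat.toENNReal_eq_zero, Module.length_eq_zero_iff]
  exact Ideal.Quotient.subsingleton_iff

theorem inum_of_isUnit_left {f : B} (g : B) (hf : IsUnit f) : inum k f g = 0 :=
  inum_eq_zero_iff.2 (Ideal.eq_top_of_isUnit_mem _ (Ideal.subset_span (by simp)) hf)

theorem inum_of_isUnit_right (f : B) {g : B} (hg : IsUnit g) : inum k f g = 0 := by
  rw [inum_comm, inum_of_isUnit_left _ hg]

theorem inum_mul_unit_right (f g : B) {u : B} (hu : IsUnit u) :
    inum k f (g * u) = inum k f g :=
  inum_eq_of_span_eq (by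
    rw [Ideal.span_insert, Ideal.span_insert, Ideal.span_singleton_mul_right_unit hu])

theorem inum_of_associated {f g f' g' : B} (h : Associated f f') (h' : Associated g g') :
    inum k f g = inum k f' g' := by
  obtain ⟨u, rfl⟩ := h
  obtain ⟨v, rfl⟩ := h'
  rw [inum_mul_unit_right _ _ v.isUnit, inum_comm, inum_comm (f * u),
    inum_mul_unit_right _ _ u.isUnit]

theorem inum_mul_of_isRelPrime [IsDomain B] [DecompositionMonoid B] {f g : B} (h : B)
    (hfg : IsRelPrime f g) :
    inum k f (g * h) = inum k f g + inum k f h := by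
  have hm : Ideal.span {f, h} ≤
      Submodule.comap (LinearMap.mulLeft B g) (Ideal.span {f, g * h}) := by
    rw [Ideal.span_le]
    rintro z (rfl | rfl)
    · exact Ideal.mul_mem_left _ _ (Ideal.subset_span (by simp))
    · exact Ideal.subset_span (by simp)
  let α : (B ⧸ Ideal.span {f, h}) →ₗ[B] (B ⧸ Ideal.span {f, g * h}) :=
    Submodule.mapQ _ _ (LinearMap.mulLeft B g) hm
  have hle : Ideal.span {f, g * h} ≤ Ideal.span {f, g} := by
    rw [Ideal.span_le]
    rintro z (rfl | rfl)
    · exact Ideal.subset_span (by simp)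
    · exact Ideal.mul_mem_right _ _ (Ideal.subset_span (by simp))
  let β : (B ⧸ Ideal.span {f, g * h}) →ₗ[B] (B ⧸ Ideal.span {f, g}) :=
    Submodule.factor hle
  have hα : Function.Injective α := by
    rw [injective_iff_map_eq_zero]
    intro z
    obtain ⟨a, rfl⟩ := Submodule.Quotient.mk_surjective _ z
    intro hz
    change Submodule.Quotient.mk (g * a) = 0 at hz
    rw [Submodule.Quotient.mk_eq_zero, Ideal.mem_span_pair] at hz
    obtain ⟨u, v, huv⟩ := hz
    rw [Submodule.Quotient.mk_eq_zero, Ideal.mem_span_pair]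
    have h1 : g * (a - v * h) = f * u := by linear_combination - huv
    have h2 : f ∣ a - v * h := hfg.dvd_of_dvd_mul_left ⟨u, h1⟩
    obtain ⟨w, hw⟩ := h2
    exact ⟨w, v, by linear_combination -hw⟩
  have hβ : Function.Surjective β := Submodule.factor_surjective hle
  have hex : Function.Exact α β := by
    intro z
    obtain ⟨a, rfl⟩ := Submodule.Quotient.mk_surjective _ z
    constructor
    · intro hz
      change Submodule.Quotient.mk a = 0 at hz
      rw [Submodule.Quotient.mk_eq_zero, Ideal.mem_span_pair] at hz
      obtain ⟨u, v, huv⟩ := hz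
      refine ⟨Submodule.Quotient.mk v, ?_⟩
      change Submodule.Quotient.mk (g * v) = _
      rw [Submodule.Quotient.eq, Ideal.mem_span_pair]
      exact ⟨-u, 0, by linear_combination - huv⟩
    · rintro ⟨w, hw⟩
      obtain ⟨b, rfl⟩ := Submodule.Quotient.mk_surjective _ w
      rw [← hw]
      change Submodule.Quotient.mk (g * b) = 0
      rw [Submodule.Quotient.mk_eq_zero, Ideal.mem_span_pair]
      exact ⟨0, b, by ring⟩
  have := Module.length_eq_add_of_exact (α.restrictScalars k) (β.restrictScalars k) hα hβ hex
  unfold inum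
  rw [this, add_comm, ENat.toENNReal_add]

theorem inum_algEquiv {B' : Type*} [CommRing B'] [Algebra k B'] (e : B ≃ₐ[k] B') (f g : B) :
    inum k (e f) (e g) = inum k f g := by
  unfold inum
  congr 1
  refine (LinearEquiv.length_eq (Ideal.quotientEquivAlg _ _ e ?_).toLinearEquiv).symm
  rw [Ideal.map_span, Set.image_pair]; rfl

end IntersectionNumber

/-- Polynomials in two variables, `x` the outer and `y` the inner one. -/
abbrev BiPoly (k : Type*) [CommRing k] : Type _ := k[X][X]

namespace BiPoly

variable {k : Type*} [Field k]

/-- The first coordinate. -/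
noncomputable def x : BiPoly k := X
/-- The second coordinate. -/
noncomputable def y : BiPoly k := C X

/-- Evaluation at the origin. -/
noncomputable def ev0 : BiPoly k →+* k := (evalRingHom 0).comp (evalRingHom 0)

variable (k) in
/-- The ideal of the origin. -/
noncomputable def origin : Ideal (BiPoly k) := RingHom.ker (ev0 (k := k))

instance : (origin k).IsPrime := RingHom.ker_isPrime _

theorem algebraMap_eq (c : k) : algebraMap k (BiPoly k) c = C (C c) := rfl

@[simp] theorem ev0_x : ev0 (x : BiPoly k) = 0 := by simp [ev0, x]
@[simp] theorem ev0_y : ev0 (y : BiPoly k) = 0 := by simp [ev0, y]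
@[simp] theorem ev0_algebraMap (c : k) : ev0 (algebraMap k (BiPoly k) c) = c := by
  simp [ev0]
@[simp] theorem ev0_C_C (c : k) : ev0 (C (C c) : BiPoly k) = c := by
  simp [ev0]

theorem prime_x : Prime (x : BiPoly k) := prime_X
theorem prime_y : Prime (y : BiPoly k) := prime_C_iff.2 prime_X

theorem exists_eq_of_ev0_eq_zero {f : BiPoly k} (h : ev0 f = 0) :
    ∃ a b, f = a * x + b * y := by
  have h1 : (f - C (f.eval 0)).eval 0 = 0 := by simp
  obtain ⟨a, ha⟩ := dvd_iff_isRoot.2 (show IsRoot _ _ from h1)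
  have h2 : (f.eval 0).eval 0 = 0 := h
  obtain ⟨b, hb⟩ := dvd_iff_isRoot.2 (show IsRoot _ _ from h2)
  refine ⟨a, C b, ?_⟩
  have h3 : C (f.eval 0) = (C X * C b : BiPoly k) := by
    rw [hb]; simp
  simp only [map_zero, sub_zero] at ha hb
  rw [x, y]
  linear_combination ha + h3

theorem isRelPrime_x_y : IsRelPrime (x : BiPoly k) y := by
  intro d h1 h2
  by_contra hd
  have h3 : Associated d x := (prime_x.irreducible.dvd_iff.1 h1).resolve_left hd |>.symm
  have h4 := h3.symm.dvd.trans h2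
  obtain ⟨c, hc⟩ := h4
  have := congrArg (eval (0 : k[X])) hc
  simp [x, y] at this

end BiPoly

open BiPoly

section Loc

variable (k : Type*) [Field k]

/-- The local ring of the affine plane at the origin. -/
def Loc : Type _ := Localization.AtPrime (origin k)

noncomputable instance : CommRing (Loc k) :=
  inferInstanceAs (CommRing (Localization.AtPrime (origin k)))

noncomputable instance : Algebra (BiPoly k) (Loc k) :=
  inferInstanceAs (Algebra (BiPoly k) (Localization.AtPrime (origin k)))

noncomputable instance : Algebra k (Loc k) :=
  inferInstanceAs (Algebra k (Localization.AtPrime (origin k)))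

instance : IsScalarTower k (BiPoly k) (Loc k) :=
  inferInstanceAs (IsScalarTower k (BiPoly k) (Localization.AtPrime (origin k)))

instance : IsLocalization.AtPrime (Loc k) (origin k) :=
  inferInstanceAs (IsLocalization.AtPrime (Localization.AtPrime (origin k)) (origin k))

instance : IsLocalRing (Loc k) :=
  inferInstanceAs (IsLocalRing (Localization.AtPrime (origin k)))

instance : IsDomain (Loc k) :=
  IsLocalization.isDomain_of_local_atPrime (P := origin k) inferInstance

instance : IsNoetherianRing (Loc k) :=
  IsLocalization.isNoetherianRing (origin k).primeCompl _ inferInstance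

instance : UniqueFactorizationMonoid (Loc k) :=
  UniqueFactorizationMonoid.of_isLocalization (origin k).primeCompl _

/-- The inclusion of polynomials in the local ring at the origin. -/
noncomputable abbrev toLoc : BiPoly k →+* Loc k := algebraMap (BiPoly k) (Loc k)

variable {k}

theorem toLoc_injective : Function.Injective (toLoc k) :=
  IsLocalization.injective _ (origin k).primeCompl_le_nonZeroDivisors

theorem isUnit_toLoc {f : BiPoly k} : IsUnit (toLoc k f) ↔ ev0 f ≠ 0 :=
  IsLocalization.AtPrime.isUnit_to_map_iff _ (origin k) f

theorem loc_exists (z : Loc k) : ∃ p q : BiPoly k, ev0 q ≠ 0 ∧ z * toLoc k q = toLoc k p := by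
  obtain ⟨⟨p, q⟩, h⟩ := IsLocalization.surj (origin k).primeCompl z
  exact ⟨p, q, q.2, h⟩

theorem loc_associated (z : Loc k) : ∃ p : BiPoly k, Associated z (toLoc k p) := by
  obtain ⟨p, q, hq, h⟩ := loc_exists z
  exact ⟨p, (isUnit_toLoc.2 hq).unit, h⟩

theorem toLoc_dvd_iff {f g : BiPoly k} :
    toLoc k f ∣ toLoc k g ↔ ∃ s, ev0 s ≠ 0 ∧ f ∣ g * s := by
  constructor
  · rintro ⟨c, hc⟩
    obtain ⟨p, q, hq, h⟩ := loc_exists c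
    refine ⟨q, hq, p, toLoc_injective  ?_⟩
    rw [map_mul, map_mul, ← h, hc]; ring
  · rintro ⟨s, hs, c, hc⟩
    obtain ⟨u, hu⟩ := isUnit_toLoc.2 hs
    refine ⟨toLoc k c * ↑u⁻¹, ?_⟩
    have := congrArg (toLoc k) hc
    rw [map_mul, map_mul, ← hu] at this
    rw [← mul_assoc, ← this, mul_assoc, Units.mul_inv, mul_one]

theorem prime_toLoc {p : BiPoly k} (hp : Prime p) (h : ev0 p = 0) : Prime (toLoc k p) := by
  have h0 : toLoc k p ≠ 0 := by
    rw [Ne, map_eq_zero_iff _ toLoc_injective]; exact hp.ne_zero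
  exact (IsLocalization.toLocalizationMap (origin k).primeCompl (Loc k)).map_prime hp h0
    (by intro hu; exact isUnit_toLoc.1 hu h)

theorem isRelPrime_toLoc {f g : BiPoly k} (h : IsRelPrime f g) :
    IsRelPrime (toLoc k f) (toLoc k g) := by
  intro d h1 h2
  by_contra hd
  obtain ⟨p, hp⟩ := loc_associated d
  have hpu : ev0 p = 0 := by
    by_contra h3
    exact hd (hp.isUnit_iff.2 (isUnit_toLoc.2 h3))
  obtain ⟨s, hs, hs'⟩ := toLoc_dvd_iff.1 (hp.symm.dvd.trans h1)
  obtain ⟨t, ht, ht'⟩ := toLoc_dvd_iff.1 (hp.symm.dvd.trans h2)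
  -- a prime factor of `p` through the origin
  have hp0 : p ≠ 0 := by
    rintro rfl
    rw [zero_dvd_iff] at hs' ht'
    have hs0 : s ≠ 0 := by rintro rfl; simp at hs
    have ht0 : t ≠ 0 := by rintro rfl; simp at ht
    have hf : f = 0 := by simpa [hs0] using hs'
    have hg : g = 0 := by simpa [ht0] using ht'
    subst hf hg
    exact prime_x.not_isUnit (h (dvd_zero (x : BiPoly k)) (dvd_zero _))
  obtain ⟨π, hπ, hπp, hπ0⟩ : ∃ π, Prime π ∧ π ∣ p ∧ ev0 π = 0 := by
    clear hs' ht' hp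
    induction p using UniqueFactorizationMonoid.induction_on_prime with
    | h₁ => exact absurd rfl hp0
    | h₂ u hu => exact absurd hpu (hu.map ev0).ne_zero
    | h₃ a p ha hp ih =>
      rw [map_mul, mul_eq_zero] at hpu
      rcases hpu with h | h
      · exact ⟨p, hp, dvd_mul_right _ _, h⟩
      · obtain ⟨π, h1, h2, h3⟩ := ih h ha
        exact ⟨π, h1, h2.mul_left _, h3⟩
  have key : ∀ {f s : BiPoly k}, ev0 s ≠ 0 → p ∣ f * s → π ∣ f := by
    intro f s hs hd
    refine ((hπ.dvd_or_dvd (hπp.trans hd)).resolve_right ?_)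
    rintro ⟨c, rfl⟩
    simp [hπ0] at hs
  exact hπ.not_isUnit (h (key hs hs') (key ht ht'))

theorem mem_maximalIdeal_loc {z : Loc k} (h : ¬ IsUnit z) :
    ∃ a b, z = a * toLoc k x + b * toLoc k y := by
  obtain ⟨p, u, hu⟩ := loc_associated z
  have : ev0 p = 0 := by
    by_contra h3
    rw [← Ne, ← isUnit_toLoc, ← hu] at h3
    exact h (isUnit_of_mul_isUnit_left h3)
  obtain ⟨a, b, rfl⟩ := exists_eq_of_ev0_eq_zero this
  refine ⟨toLoc k a * ↑u⁻¹, toLoc k b * ↑u⁻¹, ?_⟩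
  have h2 : z = toLoc k (a * x + b * y) * ↑u⁻¹ := by rw [← hu, mul_assoc]; simp
  rw [h2]
  simp only [map_add, map_mul]; ring

theorem loc_residue (z : Loc k) : ∃ c : k, ¬ IsUnit (z - algebraMap k (Loc k) c) := by
  obtain ⟨p, q, hq, h⟩ := loc_exists z
  refine ⟨ev0 p / ev0 q, fun hu => ?_⟩
  have h1 : (z - algebraMap k (Loc k) (ev0 p / ev0 q)) * toLoc k q
      = toLoc k (p - algebraMap k _ (ev0 p / ev0 q) * q) := by
    rw [sub_mul, h, map_sub, map_mul, ← IsScalarTower.algebraMap_apply]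
  have h2 := hu.mul (isUnit_toLoc.2 hq)
  rw [h1, isUnit_toLoc] at h2
  simp [hq] at h2

/-- The local intersection number at the origin. -/
noncomputable def ip (f g : BiPoly k) : ℝ≥0∞ :=
  inum k (toLoc k f) (toLoc k g)

theorem inum_loc_x_y : inum k (toLoc k x) (toLoc k y) = 1 := by
  unfold inum
  rw [show (1 : ℝ≥0∞) = ((1 : ℕ∞) : ℝ≥0∞) by simp]
  congr 1
  rw [← Module.length_eq_one k k]
  refine LinearEquiv.length_eq (LinearEquiv.ofBijective
    (Algebra.linearMap k (Loc k ⧸ Ideal.span {toLoc k x, toLoc k y})) ⟨?_, ?_⟩).symm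
  · have : Nontrivial (Loc k ⧸ Ideal.span {toLoc k x, toLoc k y}) := by
      rw [Ideal.Quotient.nontrivial_iff]
      intro h
      have h1 : Ideal.span {toLoc k x, toLoc k y} ≤ IsLocalRing.maximalIdeal (Loc k) := by
        rw [Ideal.span_le]
        rintro z (rfl | rfl)
        · simp [isUnit_toLoc]
        · simp [isUnit_toLoc]
      exact (IsLocalRing.maximalIdeal.isMaximal (Loc k)).ne_top (top_le_iff.1 (h ▸ h1))
    exact (algebraMap k (Loc k ⧸ Ideal.span {toLoc k x, toLoc k y})).injective
  · intro z
    obtain ⟨a, rfl⟩ := Ideal.Quotient.mk_surjective z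
    obtain ⟨c, hc⟩ := loc_residue a
    refine ⟨c, ?_⟩
    rw [Algebra.linearMap_apply, IsScalarTower.algebraMap_apply k (Loc k)]
    symm
    rw [Ideal.Quotient.algebraMap_eq, Ideal.Quotient.eq, Ideal.mem_span_pair]
    obtain ⟨u, v, h⟩ := mem_maximalIdeal_loc hc
    exact ⟨u, v, h.symm⟩

theorem inum_loc_eq_top {f g : Loc k} (h : ¬ IsRelPrime f g) : inum k f g = ⊤ := by
  obtain ⟨d, hd, hdf, hdg⟩ : ∃ d : Loc k, Prime d ∧ d ∣ f ∧ d ∣ g := by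
    by_cases h0 : f = 0 ∧ g = 0
    · exact ⟨toLoc k x, prime_toLoc prime_x (by simp), by simp [h0.1], by simp [h0.2]⟩
    · by_contra! h1
      refine h (WfDvdMonoid.isRelPrime_of_no_irreducible_factors h0 ?_)
      intro z hz hzf hzg
      exact h1 z hz.prime hzf hzg
  have hle : Ideal.span {f, g} ≤ Ideal.span {d, d} := by
    rw [Ideal.span_le]
    rintro z (rfl | rfl)
    · simpa [Ideal.mem_span_singleton] using hdf
    · simpa [Ideal.mem_span_singleton] using hdg
  refine top_le_iff.1 (le_trans ?_ (inum_mono (k := k) hle))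
  rw [top_le_iff]
  unfold inum
  rw [ENat.toENNReal_eq_top]
  by_contra hfin
  rw [Set.pair_eq_singleton, ← Ne, Module.length_ne_top_iff] at hfin
  have : (Ideal.span {d}).IsPrime := (Ideal.span_singleton_prime hd.ne_zero).2 hd
  have hfd : FiniteDimensional k (Loc k ⧸ Ideal.span {d}) := by
    have := (isFiniteLength_iff_isNoetherian_isArtinian.1 hfin).1
    infer_instance
  have hf : IsField (Loc k ⧸ Ideal.span {d}) :=
    isField_of_isIntegral_of_isField' (R := k) (Field.toIsField k)
  have hmax := Ideal.Quotient.maximal_of_isField _ hf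
  have hm := IsLocalRing.eq_maximalIdeal hmax
  have h1 : d ∣ toLoc k x := by
    rw [← Ideal.mem_span_singleton, hm]; simp [isUnit_toLoc]
  have h2 : d ∣ toLoc k y := by
    rw [← Ideal.mem_span_singleton, hm]; simp [isUnit_toLoc]
  exact hd.not_isUnit (isRelPrime_toLoc isRelPrime_x_y h1 h2)

theorem inum_loc_mul (f g h : Loc k) : inum k f (g * h) = inum k f g + inum k f h := by
  by_cases hg : IsRelPrime f g
  · exact inum_mul_of_isRelPrime h hg
  · rw [inum_loc_eq_top hg, inum_loc_eq_top fun h' => hg (IsRelPrime.of_mul_right_left h')]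
    simp

theorem isRelPrime_of_inum_ne_top {f g : Loc k} (h : inum k f g ≠ ⊤) : IsRelPrime f g := by
  by_contra h'
  exact h (inum_loc_eq_top h')

end Loc

section

variable {k : Type*} [Field k]

theorem ip_comm (f g : BiPoly k) : ip f g = ip g f := inum_comm _ _

theorem ip_mul_right (f g h : BiPoly k) : ip f (g * h) = ip f g + ip f h := by
  rw [ip, map_mul, inum_loc_mul]; rfl

theorem ip_mul_left (f g h : BiPoly k) : ip (g * h) f = ip g f + ip h f := by
  rw [ip_comm, ip_mul_right, ip_comm f, ip_comm f]

theorem ip_add_mul_right (f g h : BiPoly k) : ip f (g + h * f) = ip f g := by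
  rw [ip, map_add, map_mul, inum_add_mul_right]; rfl

theorem ip_of_ev0_left {f : BiPoly k} (g : BiPoly k) (h : ev0 f ≠ 0) : ip f g = 0 :=
  inum_of_isUnit_left _ (isUnit_toLoc.2 h)

theorem ip_of_ev0_right (f : BiPoly k) {g : BiPoly k} (h : ev0 g ≠ 0) : ip f g = 0 :=
  inum_of_isUnit_right _ (isUnit_toLoc.2 h)

theorem ip_x_y : ip (x : BiPoly k) y = 1 := inum_loc_x_y

theorem ip_pow_right (f g : BiPoly k) (n : ℕ) : ip f (g ^ n) = n * ip f g := by
  induction n with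
  | zero => simpa using ip_of_ev0_right f (g := 1) (by simp)
  | succ n ih => rw [pow_succ, ip_mul_right, ih]; push_cast; ring

theorem inum_eq_zero_iff_isUnit {f g : Loc k} : inum k f g = 0 ↔ IsUnit f ∨ IsUnit g := by
  rw [inum_eq_zero_iff]
  constructor
  · intro h
    by_contra! hn
    have : Ideal.span {f, g} ≤ IsLocalRing.maximalIdeal (Loc k) := by
      rw [Ideal.span_le]
      rintro z (rfl | rfl)
      · exact hn.1
      · exact hn.2
    exact (IsLocalRing.maximalIdeal.isMaximal (Loc k)).ne_top (top_le_iff.1 (h ▸ this))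
  · rintro (h | h)
    · exact Ideal.eq_top_of_isUnit_mem _ (Ideal.subset_span (by simp)) h
    · exact Ideal.eq_top_of_isUnit_mem _ (Ideal.subset_span (by simp)) h

theorem exists_pow_mem_span {f g t : Loc k} (h : inum k f g ≠ ⊤) (ht : ¬ IsUnit t) :
    ∃ n, t ^ n ∈ Ideal.span {f, g} := by
  unfold inum at h
  rw [Ne, ENat.toENNReal_eq_top, ← Ne, Module.length_ne_top_iff,
    isFiniteLength_iff_isNoetherian_isArtinian] at h
  have : IsArtinian (Loc k ⧸ Ideal.span {f, g}) (Loc k ⧸ Ideal.span {f, g}) :=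
    isArtinian_of_tower k h.2
  obtain ⟨n, z, hz⟩ := IsArtinian.exists_pow_succ_smul_dvd (R := Loc k ⧸ Ideal.span {f, g})
    (M := Loc k ⧸ Ideal.span {f, g}) (Ideal.Quotient.mk _ t) 1
  obtain ⟨a, rfl⟩ := Ideal.Quotient.mk_surjective z
  refine ⟨n, ?_⟩
  have h1 : t ^ n * (1 - t * a) ∈ Ideal.span {f, g} := by
    rw [← Ideal.Quotient.eq_zero_iff_mem]
    simp only [smul_eq_mul, mul_one, Nat.succ_eq_add_one] at hz
    simp only [map_mul, map_sub, map_pow, map_one]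
    linear_combination -hz
  have h2 : IsUnit (1 - t * a) := by
    by_contra h3
    have h4 : t * a ∈ IsLocalRing.maximalIdeal (Loc k) := Ideal.mul_mem_right _ _ ht
    have h5 : (1 - t * a) + t * a ∈ IsLocalRing.maximalIdeal (Loc k) :=
      Ideal.add_mem _ h3 h4
    rw [sub_add_cancel] at h5
    exact h5 isUnit_one
  obtain ⟨u, hu⟩ := h2
  have := Ideal.mul_mem_right (↑u⁻¹ : Loc k) _ h1
  rwa [← hu, mul_assoc, Units.mul_inv, mul_one] at this

theorem ip_eq_natCast {f g : BiPoly k} (h : ip f g ≠ ⊤) : ∃ n : ℕ, ip f g = n := by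
  unfold ip inum at *
  rw [Ne, ENat.toENNReal_eq_top] at h
  obtain ⟨n, hn⟩ := ENat.ne_top_iff_exists.1 h
  exact ⟨n, by rw [← hn]; simp⟩

end

/-- Induction for pairs of coprime polynomials in two variables, following Euclid's algorithm. -/
theorem BiPoly.euclid_induction {k : Type*} [Field k] [IsAlgClosed k]
    (Q : BiPoly k → BiPoly k → Prop)
    (symm : ∀ f g, Q f g → Q g f)
    (const : ∀ (c : k) g, c ≠ 0 → g ≠ 0 → Q (C (C c)) g)
    (lin : ∀ (β : k) g, g ≠ 0 → ¬ C (X - C β) ∣ g → Q (C (X - C β)) g)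
    (mul : ∀ f g h, f ≠ 0 → g ≠ 0 → h ≠ 0 → Q f g → Q f h → Q f (g * h))
    (cancel : ∀ f g h, f ≠ 0 → g ≠ 0 → h ≠ 0 → Q f h → Q f (g * h) → Q f g)
    (shift : ∀ f g h, f ≠ 0 → g ≠ 0 → g + h * f ≠ 0 → Q f g → Q f (g + h * f))
    (f g : BiPoly k) (hf : f ≠ 0) (hg : g ≠ 0) (hfg : IsRelPrime f g) : Q f g := by
  have const' : ∀ (n : ℕ) (a : k[X]) (g : BiPoly k), a.natDegree = n → a ≠ 0 → g ≠ 0 →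
      IsRelPrime (C a) g → Q (C a) g := by
    intro n
    induction n with
    | zero =>
      intro a g ha ha0 hg _
      rw [natDegree_eq_zero] at ha
      obtain ⟨c, rfl⟩ := ha
      exact const c g (by rintro rfl; simp at ha0) hg
    | succ n ih =>
      intro a g ha ha0 hg hr
      obtain ⟨β, hβ⟩ := IsAlgClosed.exists_root a (by
        rw [degree_eq_natDegree ha0, ha]; exact_mod_cast Nat.succ_ne_zero n)
      obtain ⟨b, rfl⟩ := dvd_iff_isRoot.2 hβ
      have hb0 : b ≠ 0 := right_ne_zero_of_mul ha0
      have hX : (X - C β : k[X]) ≠ 0 := X_sub_C_ne_zero β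
      rw [natDegree_mul hX hb0, natDegree_X_sub_C] at ha
      rw [C_mul] at hr ⊢
      refine symm _ _ (mul _ _ _ hg (C_ne_zero.2 hX) (C_ne_zero.2 hb0) (symm _ _ ?_)
        (symm _ _ ?_))
      · refine lin β g hg fun hd => ?_
        have := (hr.of_mul_left_left) dvd_rfl hd
        rw [isUnit_C] at this
        exact not_isUnit_X_sub_C β this
      · exact ih b g (by omega) hb0 hg hr.of_mul_left_right
  suffices H : ∀ (n : ℕ) (f g : BiPoly k), f.natDegree + g.natDegree = n → f ≠ 0 → g ≠ 0 →
      IsRelPrime f g → Q f g from H _ f g rfl hf hg hfg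
  intro n
  induction n using Nat.strong_induction_on with
  | _ n ih =>
  -- the case of a primitive polynomial of smaller degree
  have prim : ∀ f g : BiPoly k, f.natDegree + g.natDegree ≤ n → f ≠ 0 → g ≠ 0 →
      IsRelPrime f g → f.IsPrimitive → f.natDegree ≤ g.natDegree → Q f g := by
    intro f g hn hf hg hr hp hd
    by_cases hf0 : f.natDegree = 0
    · rw [natDegree_eq_zero] at hf0
      obtain ⟨a, rfl⟩ := hf0
      exact const' _ a g rfl (by rintro rfl; simp at hf) hg hr
    set l := f.leadingCoeff with hl
    have hl0 : l ≠ 0 := leadingCoeff_ne_zero.2 hf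
    have hCl : (C l : BiPoly k) ≠ 0 := by simpa using hl0
    have hrl : IsRelPrime f (C l) := by
      intro d hd1 hd2
      have hd0 : d.natDegree = 0 := by
        have := natDegree_le_of_dvd hd2 hCl
        simpa using this
      obtain ⟨e, rfl⟩ := natDegree_eq_zero.1 hd0
      exact isUnit_C.2 (hp e hd1)
    set h : BiPoly k := C g.leadingCoeff * X ^ (g.natDegree - f.natDegree) with hh
    set g' := C l * g - h * f with hg'
    have e1 : g * C l = g' + h * f := by rw [hg']; ring
    have hg'0 : g' ≠ 0 := by
      intro h0
      rw [h0, zero_add] at e1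
      have h1 : f ∣ g * C l := ⟨h, by rw [e1, mul_comm]⟩
      have h2 : f ∣ C l := hr.dvd_of_dvd_mul_left h1
      exact hf0 (by simpa using natDegree_le_of_dvd h2 hCl)
    have hdeg : g'.natDegree < g.natDegree := by
      have hgd : g.natDegree ≠ 0 := by omega
      refine natDegree_lt_natDegree hg'0 ?_
      have hgdeg : (C l * g).degree = g.degree := by rw [degree_C_mul hl0]
      rw [← hgdeg]
      refine degree_sub_lt_left ?_ (mul_ne_zero hCl hg) ?_
      · rw [hgdeg, hh, degree_mul, degree_C_mul_X_pow _ (leadingCoeff_ne_zero.2 hg),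
          degree_eq_natDegree hf, degree_eq_natDegree hg, ← Nat.cast_add]
        congr 1; omega
      · rw [hh, leadingCoeff_mul, leadingCoeff_mul, leadingCoeff_mul]
        simp [mul_comm, hl]
    have hr' : IsRelPrime f g' := by
      intro d hd1 hd2
      have h1 : IsRelPrime f (g * C l) := hr.mul_right hrl
      exact h1 hd1 (by rw [e1]; exact dvd_add hd2 (hd1.mul_left _))
    have hQ : Q f g' := ih _ (by omega) f g' rfl hf hg'0 hr'
    refine cancel f g (C l) hf hg hCl (symm _ _ (const' _ l f rfl hl0 hf hrl.symm)) ?_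
    rw [e1]
    exact shift f g' h hf hg'0 (e1 ▸ mul_ne_zero hg hCl) hQ
  have half : ∀ f g : BiPoly k, f.natDegree + g.natDegree ≤ n → f ≠ 0 → g ≠ 0 →
      IsRelPrime f g → f.natDegree ≤ g.natDegree → Q f g := by
    intro f g hn hf hg hr hd
    let _ : StrongNormalizationMonoid k[X] :=
      UniqueFactorizationMonoid.strongNormalizationMonoid
    let _ : NormalizedGCDMonoid k[X] := UniqueFactorizationMonoid.toNormalizedGCDMonoid _
    have e := f.eq_C_content_mul_primPart
    have hc : f.content ≠ 0 := by rwa [Ne, content_eq_zero_iff]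
    have hp : f.primPart ≠ 0 := primPart_ne_zero f
    rw [e] at hr ⊢
    refine symm _ _ (mul _ _ _ hg (by simpa using hc) hp (symm _ _ ?_) (symm _ _ ?_))
    · exact const' _ _ g rfl hc hg hr.of_mul_left_left
    · exact prim _ g (by rwa [natDegree_primPart]) hp hg hr.of_mul_left_right
        f.isPrimitive_primPart (by rwa [natDegree_primPart])
  intro f g hn hf hg hr
  rcases le_total f.natDegree g.natDegree with h | h
  · exact half f g hn.le hf hg hr h
  · exact symm _ _ (half g f (by omega) hg hf hr.symm h)

section Uniqueness

variable {k K : Type*} [Field k] [Field K] [Algebra (BiPoly k) K] [IsFractionRing (BiPoly k) K]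

theorem algebraMap_bipoly_injective : Function.Injective (algebraMap (BiPoly k) K) :=
  IsFractionRing.injective _ _

@[simp] theorem algebraMap_bipoly_eq_zero {f : BiPoly k} :
    algebraMap (BiPoly k) K f = 0 ↔ f = 0 :=
  map_eq_zero_iff _ algebraMap_bipoly_injective

theorem x_ne_zero : (x : BiPoly k) ≠ 0 := prime_x.ne_zero
theorem y_ne_zero : (y : BiPoly k) ≠ 0 := prime_y.ne_zero

theorem algebraMap_x_ne_zero : algebraMap (BiPoly k) K x ≠ 0 := by
  simpa using x_ne_zero

theorem x_zpow_mul_unique {a b : ℤ} {f g : BiPoly k} (hf : ¬ x ∣ f) (hg : ¬ x ∣ g)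
    (h : algebraMap (BiPoly k) K x ^ a * algebraMap _ K f
      = algebraMap (BiPoly k) K x ^ b * algebraMap _ K g) : a = b ∧ f = g := by
  have key : ∀ {a b : ℤ} {f g : BiPoly k}, ¬ x ∣ g →
      algebraMap (BiPoly k) K x ^ a * algebraMap _ K f
      = algebraMap (BiPoly k) K x ^ b * algebraMap _ K g → a ≤ b := by
    intro a b f g hg h
    by_contra! hlt
    obtain ⟨n, hn⟩ := Int.eq_ofNat_of_zero_le (show 0 ≤ a - b by omega)
    have : algebraMap (BiPoly k) K (x ^ n * f) = algebraMap _ K g := by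
      have h0 := algebraMap_x_ne_zero (k := k) (K := K)
      rw [map_mul, map_pow, ← zpow_natCast, ← hn, zpow_sub₀ h0]
      field_simp
      linear_combination h
    have := algebraMap_bipoly_injective this
    refine hg ⟨x ^ (n - 1) * f, ?_⟩
    rw [← mul_assoc, ← pow_succ', ← this]
    congr 2; omega
  have hab : a = b := le_antisymm (key hg h) (key hf h.symm)
  subst hab
  refine ⟨rfl, ?_⟩
  exact algebraMap_bipoly_injective
    (mul_left_cancel₀ (zpow_ne_zero _ algebraMap_x_ne_zero) h)

end Uniqueness

/-- A family of charts: coordinate systems `φ j` in which the curve `x = 0` is a fixed divisor,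
with the strict transforms `σ j` and the order `v` along that divisor. -/
structure ChartFamily (k K J : Type*) [Field k] [Field K] [Algebra k K]
    [Algebra (BiPoly k) K] where
  /-- The self-intersection of the divisor, up to sign. -/
  ε : ℤ
  /-- The coordinate systems. -/
  φ : J → K ≃ₐ[k] K
  /-- The order along the divisor. -/
  v : BiPoly k → ℤ
  /-- The strict transforms. -/
  σ : J → BiPoly k → BiPoly k
  v_add : ∀ f g, f ≠ 0 → g ≠ 0 → f + g ≠ 0 → min (v f) (v g) ≤ v (f + g)
  eq : ∀ j f, f ≠ 0 → (φ j).symm (algebraMap (BiPoly k) K f) =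
    algebraMap (BiPoly k) K x ^ v f * algebraMap _ K (σ j f)
  not_dvd : ∀ j f, f ≠ 0 → ¬ x ∣ σ j f
  nonneg : ∀ f, f ≠ 0 → 0 ≤ ε * v f
  sum_x : ∀ f, f ≠ 0 → ∑' j, ip (σ j f) x = ((ε * v f).toNat : ℝ≥0∞)

namespace ChartFamily

variable {k K J : Type*} [Field k] [Field K] [Algebra k K]
  [Algebra (BiPoly k) K] [IsFractionRing (BiPoly k) K]
  (F : ChartFamily k K J) [Nonempty J]

include F in
omit [IsFractionRing (BiPoly k) K] [Nonempty J] in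
theorem σ_ne_zero (j : J) {f : BiPoly k} (hf : f ≠ 0) : F.σ j f ≠ 0 := by
  intro h
  exact F.not_dvd j f hf (h ▸ dvd_zero _)

omit [Nonempty J] in
theorem vσ_mul (j : J) {f g : BiPoly k} (hf : f ≠ 0) (hg : g ≠ 0) :
    F.v (f * g) = F.v f + F.v g ∧ F.σ j (f * g) = F.σ j f * F.σ j g := by
  refine x_zpow_mul_unique (K := K) (F.not_dvd j _ (mul_ne_zero hf hg)) ?_ ?_
  · intro h
    rcases prime_x.dvd_or_dvd h with h | h
    exacts [F.not_dvd j f hf h, F.not_dvd j g hg h]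
  · rw [← F.eq j _ (mul_ne_zero hf hg), map_mul, map_mul, F.eq j f hf, F.eq j g hg,
      zpow_add₀ algebraMap_x_ne_zero, map_mul]
    ring

theorem v_mul {f g : BiPoly k} (hf : f ≠ 0) (hg : g ≠ 0) :
    F.v (f * g) = F.v f + F.v g := (F.vσ_mul (Classical.arbitrary J) hf hg).1

omit [Nonempty J] in
theorem σ_mul (j : J) {f g : BiPoly k} (hf : f ≠ 0) (hg : g ≠ 0) :
    F.σ j (f * g) = F.σ j f * F.σ j g := (F.vσ_mul j hf hg).2

/-- The transform of `f` divided by `x ^ N` in place of `x ^ v f`. -/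
noncomputable def vt (N : ℤ) (f : BiPoly k) (j : J) : BiPoly k :=
  x ^ (F.v f - N).toNat * F.σ j f

omit [Nonempty J] in
theorem vt_eq (j : J) {N : ℤ} {f : BiPoly k} (hf : f ≠ 0) (hN : N ≤ F.v f) :
    algebraMap (BiPoly k) K (F.vt N f j) =
      algebraMap (BiPoly k) K x ^ (-N) * (F.φ j).symm (algebraMap _ K f) := by
  rw [F.eq j f hf, ← mul_assoc, ← zpow_add₀ algebraMap_x_ne_zero, vt, map_mul, map_pow,
    ← zpow_natCast, Int.toNat_of_nonneg (by omega)]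
  congr 2; omega

/-- The total intersection number of the strict transforms. -/
noncomputable def T (f g : BiPoly k) : ℝ≥0∞ := ∑' j, ip (F.σ j f) (F.σ j g)

omit [IsFractionRing (BiPoly k) K] [Nonempty J] in
theorem T_comm (f g : BiPoly k) : F.T f g = F.T g f := by
  simp only [T, ip_comm]

omit [Nonempty J] in
theorem T_mul {g h : BiPoly k} (f : BiPoly k) (hg : g ≠ 0) (hh : h ≠ 0) :
    F.T f (g * h) = F.T f g + F.T f h := by
  simp only [T, F.σ_mul _ hg hh, ip_mul_right]
  exact ENNReal.tsum_add

omit [IsFractionRing (BiPoly k) K] [Nonempty J] in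
theorem sum_vt {f g : BiPoly k} (hf : f ≠ 0) (N : ℤ) :
    ∑' j, ip (F.σ j f) (F.vt N g j) =
      F.T f g + (F.v g - N).toNat * (F.ε * F.v f).toNat := by
  simp only [vt, ip_mul_right, ip_pow_right]
  rw [ENNReal.tsum_add, ENNReal.tsum_mul_left, F.sum_x f hf, add_comm]
  rfl

theorem T_shift {f g h : BiPoly k} (hf : f ≠ 0) (hg : g ≠ 0) (hgh : g + h * f ≠ 0) :
    ∃ N, N ≤ F.v g ∧ N ≤ F.v (g + h * f) ∧
      F.T f (g + h * f) + (F.v (g + h * f) - N).toNat * (F.ε * F.v f).toNat =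
      F.T f g + (F.v g - N).toNat * (F.ε * F.v f).toNat := by
  by_cases hh : h = 0
  · subst hh
    exact ⟨F.v g, le_rfl, by simp, by simp⟩
  have hhf := mul_ne_zero hh hf
  set N := min (F.v g) (F.v (h * f)) with hN
  have h1 : N ≤ F.v g := min_le_left _ _
  have h2 : N ≤ F.v (h * f) := min_le_right _ _
  have h3 : N ≤ F.v (g + h * f) := F.v_add g (h * f) hg hhf hgh
  refine ⟨N, h1, h3, ?_⟩
  rw [← F.sum_vt hf, ← F.sum_vt hf]
  refine tsum_congr fun j => ?_
  have : F.vt N (g + h * f) j =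
      F.vt N g j + (x ^ (F.v (h * f) - N).toNat * F.σ j h) * F.σ j f := by
    rw [mul_assoc, ← F.σ_mul j hh hf]
    change _ = _ + F.vt N (h * f) j
    refine algebraMap_bipoly_injective (K := K) ?_
    rw [map_add, F.vt_eq j hgh h3, F.vt_eq j hg h1, F.vt_eq j hhf h2, map_add, map_add]
    ring
  rw [this, ip_add_mul_right]

end ChartFamily

section Substitution

variable {k : Type*} [Field k]

/-- The substitution `x ↦ X`, `y ↦ Y`. -/
noncomputable def bsub {R : Type*} [CommRing R] [Algebra k R] (X Y : R) : BiPoly k →ₐ[k] R :=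
  aevalAeval Y X

variable {R : Type*} [CommRing R] [Algebra k R]

@[simp] theorem bsub_x (X Y : R) : bsub (k := k) X Y x = X := by simp [bsub, x]

@[simp] theorem bsub_y (X Y : R) : bsub (k := k) X Y y = Y := by simp [bsub, y]

@[simp] theorem bsub_C_C (X Y : R) (c : k) : bsub X Y (C (C c)) = algebraMap k R c :=
  (bsub (k := k) X Y).commutes c

theorem bhom_ext {f g : BiPoly k →ₐ[k] R} (hx : f x = g x) (hy : f y = g y) : f = g :=
  (aevalAevalEquiv k R).symm.injective (Prod.ext hy hx)

theorem monomial_monomial_eq (n m : ℕ) (r : k) :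
    (monomial n (monomial m r) : BiPoly k) = algebraMap k _ r * y ^ m * x ^ n := by
  rw [BiPoly.algebraMap_eq, x, y, ← C_pow, ← C_mul, C_mul_X_pow_eq_monomial, C_mul_X_pow_eq_monomial]

theorem bipoly_induction {Q : BiPoly k → Prop} (f : BiPoly k)
    (add : ∀ f g, Q f → Q g → Q (f + g))
    (mon : ∀ n m r, Q (monomial n (monomial m r))) : Q f := by
  induction f using Polynomial.induction_on' with
  | add p q hp hq => exact add p q hp hq
  | monomial n a =>
    induction a using Polynomial.induction_on' with
    | add p q hp hq => rw [map_add]; exact add _ _ hp hq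
    | monomial m r => exact mon n m r

/-- The substitution `y ↦ x * y`. -/
noncomputable def blowSub : BiPoly k →ₐ[k] BiPoly k := bsub x (x * y)

theorem blowSub_monomial (n m : ℕ) (r : k) :
    blowSub (monomial n (monomial m r)) = monomial (n + m) (monomial m r) := by
  rw [monomial_monomial_eq, monomial_monomial_eq, blowSub, map_mul, map_mul, map_pow, map_pow,
    AlgHom.commutes, bsub_x, bsub_y]
  ring

theorem coeff_blowSub (f : BiPoly k) (n m : ℕ) :
    ((blowSub f).coeff n).coeff m = if m ≤ n then (f.coeff (n - m)).coeff m else 0 := by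
  induction f using bipoly_induction with
  | add f g hf hg => rw [map_add, coeff_add, coeff_add, hf, hg]; split_ifs <;> simp
  | mon a b r =>
    rw [blowSub_monomial]
    simp only [coeff_monomial]
    by_cases hb : b = m
    · subst hb
      split_ifs <;> first | omega | simp
    · split_ifs <;> simp [coeff_monomial, hb]

theorem blowSub_injective : Function.Injective (blowSub (k := k)) := by
  refine (injective_iff_map_eq_zero _).2 fun f hf => ?_
  ext n m
  have := coeff_blowSub f (n + m) m
  rw [hf] at this
  simpa using this.symm

/-- The exchange of the two variables. -/
noncomputable def sw : BiPoly k ≃ₐ[k] BiPoly k :=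
  AlgEquiv.ofAlgHom (bsub y x) (bsub y x) (bhom_ext (by simp) (by simp))
    (bhom_ext (by simp) (by simp))

@[simp] theorem sw_x : sw (x : BiPoly k) = y := bsub_x _ _
@[simp] theorem sw_y : sw (y : BiPoly k) = x := bsub_y _ _

theorem coeff_sw (f : BiPoly k) (n m : ℕ) : ((sw f).coeff n).coeff m = (f.coeff m).coeff n := by
  induction f using bipoly_induction with
  | add f g hf hg => simp [hf, hg]
  | mon a b r =>
    have : sw (monomial a (monomial b r) : BiPoly k) = monomial b (monomial a r) := by
      rw [monomial_monomial_eq, monomial_monomial_eq, map_mul, map_mul, map_pow, map_pow,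
        AlgEquiv.commutes, sw_x, sw_y]
      ring
    rw [this]
    simp only [coeff_monomial]
    split_ifs <;> simp [coeff_monomial, *]

/-- The translation `x ↦ x + a`, `y ↦ y + b`. -/
noncomputable def tr (a b : k) : BiPoly k ≃ₐ[k] BiPoly k :=
  AlgEquiv.ofAlgHom (bsub (x + algebraMap k _ a) (y + algebraMap k _ b))
    (bsub (x - algebraMap k _ a) (y - algebraMap k _ b))
    (bhom_ext (by simp) (by simp)) (bhom_ext (by simp) (by simp))

@[simp] theorem tr_x (a b : k) : tr a b x = x + algebraMap k _ a := bsub_x _ _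
@[simp] theorem tr_y (a b : k) : tr a b y = y + algebraMap k _ b := bsub_y _ _

theorem tr_zero_apply (b : k) (f : BiPoly k) :
    tr 0 b f = f.map (algEquivAevalXAddC b : k[X] →+* k[X]) := by
  have : (tr 0 b : BiPoly k →ₐ[k] BiPoly k) =
      mapAlgHom (algEquivAevalXAddC b : k[X] →ₐ[k] k[X]) := by
    refine bhom_ext ?_ ?_
    · refine (tr_x _ _).trans ?_
      simp [x]
    · refine (tr_y _ _).trans ?_
      simp [y]
  exact DFunLike.congr_fun this f

theorem x_dvd_iff {f : BiPoly k} : x ∣ f ↔ f.coeff 0 = 0 := X_dvd_iff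

theorem coeff_zero_tr (b : k) (f : BiPoly k) :
    (tr 0 b f).coeff 0 = (f.coeff 0).comp (X + C b) := by
  rw [tr_zero_apply, coeff_map]
  simp [algEquivAevalXAddC_apply, comp, aeval_def]

end Substitution

section Automorphisms

variable {k K : Type*} [Field k] [Field K] [Algebra k K] [Algebra (BiPoly k) K]
  [IsScalarTower k (BiPoly k) K] [IsFractionRing (BiPoly k) K]

local notation "ι" => algebraMap (BiPoly k) K

theorem khom_ext {L : Type*} [Field L] [Algebra k L] {f g : K →ₐ[k] L}
    (hx : f (ι x) = g (ι x)) (hy : f (ι y) = g (ι y)) : f = g := by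
  have h : f.comp (IsScalarTower.toAlgHom k (BiPoly k) K) =
      g.comp (IsScalarTower.toAlgHom k (BiPoly k) K) := bhom_ext hx hy
  refine IsLocalization.algHom_ext (nonZeroDivisors (BiPoly k)) ?_
  exact h

/-- The automorphism of the function field extending an automorphism of the plane. -/
noncomputable def planeAut (e : BiPoly k ≃ₐ[k] BiPoly k) : K ≃ₐ[k] K :=
  IsFractionRing.algEquivOfAlgEquiv e

@[simp] theorem planeAut_algebraMap (e : BiPoly k ≃ₐ[k] BiPoly k) (f : BiPoly k) :
    planeAut (K := K) e (ι f) = ι (e f) :=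
  IsFractionRing.algEquivOfAlgEquiv_algebraMap _ _

theorem exists_lift {g : BiPoly k →ₐ[k] K} (hg : Function.Injective g) :
    ∃ h : K →ₐ[k] K, ∀ f, h (ι f) = g f :=
  ⟨IsFractionRing.liftAlgHom hg, fun f => by
    rw [IsFractionRing.liftAlgHom_apply]; exact IsFractionRing.lift_algebraMap hg f⟩

theorem exists_blowAut : ∃ e : K ≃ₐ[k] K,
    e (ι x) = ι x ∧ e (ι y) = ι y / ι x ∧ ∀ f, e.symm (ι f) = ι (blowSub f) := by
  obtain ⟨p, hp⟩ := exists_lift (K := K)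
    (g := (IsScalarTower.toAlgHom k (BiPoly k) K).comp blowSub)
    (algebraMap_bipoly_injective.comp blowSub_injective)
  replace hp : ∀ f, p (ι f) = ι (blowSub f) := hp
  have hpx : p (ι x) = ι x := by rw [hp, blowSub, bsub_x]
  have hpy : p (ι y) = ι x * ι y := by rw [hp, blowSub, bsub_y, map_mul]
  have hx := algebraMap_x_ne_zero (k := k) (K := K)
  set g : BiPoly k →ₐ[k] K := bsub (ι x) (ι y / ι x) with hg
  have hpg : p.comp g = IsScalarTower.toAlgHom k (BiPoly k) K := by
    refine bhom_ext ?_ ?_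
    · simp [hg, hpx]
    · simp [hg, hpx, hpy, hx]
  have hinj : Function.Injective g := by
    refine .of_comp (f := p) ?_
    have : ⇑p ∘ ⇑g = ι := funext fun f => DFunLike.congr_fun hpg f
    rw [this]
    exact algebraMap_bipoly_injective
  obtain ⟨m, hm⟩ := exists_lift hinj
  have hmx : m (ι x) = ι x := by rw [hm, hg, bsub_x]
  have hmy : m (ι y) = ι y / ι x := by rw [hm, hg, bsub_y]
  refine ⟨AlgEquiv.ofAlgHom m p (khom_ext ?_ ?_) (khom_ext ?_ ?_), hmx, hmy, hp⟩
  · simp [hpx, hmx]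
  · simp [hpy, hmx, hmy]; field_simp
  · simp [hpx, hmx]
  · simp [hmy, hpx, hpy]; field_simp

/-- The automorphism `x ↦ x`, `y ↦ y / x`. -/
noncomputable def blowAut : K ≃ₐ[k] K := (exists_blowAut (k := k) (K := K)).choose

theorem blowAut_symm (f : BiPoly k) : (blowAut (k := k) (K := K)).symm (ι f) = ι (blowSub f) :=
  (exists_blowAut (K := K)).choose_spec.2.2 f

theorem bsub_inv_eq (f : BiPoly k) :
    bsub (ι x)⁻¹ (ι y) f = ι x ^ (-(f.natDegree : ℤ)) * ι f.reverse := by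
  have hx := algebraMap_x_ne_zero (k := k) (K := K)
  have h1 : bsub (ι x)⁻¹ (ι y) f = eval₂ (algebraMap (BiPoly k) K |>.comp C) (ι x)⁻¹ f := by
    have : (bsub (ι x)⁻¹ (ι y) : BiPoly k →ₐ[k] K).toRingHom =
        eval₂RingHom (algebraMap (BiPoly k) K |>.comp C) (ι x)⁻¹ := by
      refine Polynomial.ringHom_ext (fun a => ?_) ?_
      · have h2 : (bsub (ι x)⁻¹ (ι y) : BiPoly k →ₐ[k] K).toRingHom.comp C =
            (algebraMap (BiPoly k) K |>.comp C) := by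
          refine Polynomial.ringHom_ext (fun a => ?_) ?_
          · simp only [RingHom.comp_apply]
            rw [← BiPoly.algebraMap_eq, ← IsScalarTower.algebraMap_apply]
            exact AlgHom.commutes _ _
          · exact bsub_y _ _
        simpa using DFunLike.congr_fun h2 a
      · refine (bsub_x _ _).trans ?_
        simp
    exact DFunLike.congr_fun this f
  have h2 : ι f.reverse = eval₂ (algebraMap (BiPoly k) K |>.comp C) (ι x) f.reverse := by
    have : algebraMap (BiPoly k) K =
        eval₂RingHom (algebraMap (BiPoly k) K |>.comp C) (ι x) :=
      Polynomial.ringHom_ext (fun a => by simp) (by simp; rfl)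
    exact DFunLike.congr_fun this f.reverse
  let _ : Invertible (ι x : K)⁻¹ := ⟨ι x, mul_inv_cancel₀ hx, inv_mul_cancel₀ hx⟩
  have := eval₂_reverse_mul_pow (algebraMap (BiPoly k) K |>.comp C) (ι x)⁻¹ f
  rw [h1, ← this, h2]
  change eval₂ _ (ι x) _ * _ = _
  rw [zpow_neg, zpow_natCast, inv_pow, mul_comm]

theorem exists_invAut : ∃ e : K ≃ₐ[k] K,
    e (ι x) = (ι x)⁻¹ ∧ e (ι y) = ι y ∧
      ∀ f, e.symm (ι f) = ι x ^ (-(f.natDegree : ℤ)) * ι f.reverse := by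
  have hx := algebraMap_x_ne_zero (k := k) (K := K)
  have hinj : Function.Injective (bsub (ι x)⁻¹ (ι y) : BiPoly k →ₐ[k] K) := by
    refine (injective_iff_map_eq_zero _).2 fun f hf => ?_
    rw [bsub_inv_eq, mul_eq_zero] at hf
    rcases hf with hf | hf
    · exact absurd hf (zpow_ne_zero _ hx)
    · simpa using hf
  obtain ⟨m, hm⟩ := exists_lift hinj
  have hmx : m (ι x) = (ι x)⁻¹ := by rw [hm, bsub_x]
  have hmy : m (ι y) = ι y := by rw [hm, bsub_y]
  have h : m.comp m = AlgHom.id k K := khom_ext (by simp [hmx]) (by simp [hmy])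
  exact ⟨AlgEquiv.ofAlgHom m m h h, hmx, hmy, fun f => (hm f).trans (bsub_inv_eq f)⟩

/-- The automorphism `x ↦ 1 / x`, `y ↦ y`. -/
noncomputable def invAut : K ≃ₐ[k] K := (exists_invAut (k := k) (K := K)).choose

theorem invAut_x : invAut (k := k) (ι x) = (ι x)⁻¹ := (exists_invAut (K := K)).choose_spec.1
theorem invAut_y : invAut (k := k) (ι y) = ι y := (exists_invAut (K := K)).choose_spec.2.1
theorem invAut_symm (f : BiPoly k) : (invAut (k := k) (K := K)).symm (ι f) =
    ι x ^ (-(f.natDegree : ℤ)) * ι f.reverse :=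
  (exists_invAut (K := K)).choose_spec.2.2 f

end Automorphisms

theorem ENNReal.tsum_option {α : Type*} (f : Option α → ℝ≥0∞) :
    ∑' j, f j = f none + ∑' a, f (some a) := by
  classical
  rw [ENNReal.tsum_eq_add_tsum_ite none]
  congr 1
  rw [← (Option.some_injective α).tsum_eq]
  · exact tsum_congr fun a => by simp
  · rintro (_ | a) h
    · simp at h
    · exact ⟨a, rfl⟩

section RootCount

variable {k : Type*} [Field k]

theorem natTrailingDegree_reflect {p : k[X]} (hp : p ≠ 0) {n : ℕ} (h : p.natDegree ≤ n) :
    (reflect n p).natTrailingDegree = n - p.natDegree := by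
  have h0 : (reflect n p).coeff (n - p.natDegree) ≠ 0 := by
    rw [coeff_reflect, revAt_le (by omega), show n - (n - p.natDegree) = p.natDegree by omega]
    exact leadingCoeff_ne_zero.2 hp
  refine le_antisymm (natTrailingDegree_le_of_ne_zero h0)
    (le_natTrailingDegree (fun h => h0 (by simp [h])) fun m hm => ?_)
  rw [coeff_reflect, revAt_le (by omega)]
  exact coeff_eq_zero_of_natDegree_lt (by omega)

theorem tsum_rootMultiplicity [IsAlgClosed k] {p : k[X]} (hp : p ≠ 0) :
    ∑' c, (p.rootMultiplicity c : ℝ≥0∞) = p.natDegree := by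
  classical
  rw [tsum_eq_sum (s := p.roots.toFinset)]
  · rw [← IsAlgClosed.card_roots_eq_natDegree, ← Multiset.toFinset_sum_count_eq]
    push_cast
    simp
  · intro c hc
    simpa [hp] using hc

theorem ip_x_right {g : BiPoly k} (hg : g.coeff 0 ≠ 0) :
    ip g x = ((g.coeff 0).rootMultiplicity 0 : ℝ≥0∞) := by
  have h1 : ip g x = ip (C (g.coeff 0)) x := by
    rw [ip_comm, ip_comm _ x, ← ip_add_mul_right x (C (g.coeff 0)) g.divX]
    congr 1
    rw [add_comm]
    exact (divX_mul_X_add g).symm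
  obtain ⟨q, hq, hnd⟩ := exists_eq_pow_rootMultiplicity_mul_and_not_dvd _ hg 0
  generalize (g.coeff 0).rootMultiplicity 0 = m at *
  rw [h1, hq, C_mul, ip_mul_left, C_pow, C_0, sub_zero, ip_comm, ip_comm (C q)]
  change ip x (y ^ m) + _ = _
  rw [ip_pow_right, ip_x_y, mul_one, ip_of_ev0_right, add_zero]
  rw [C_0, sub_zero, X_dvd_iff] at hnd
  simpa [ev0, coeff_zero_eq_eval_zero] using hnd

theorem natDegree_coeff_blowSub_le (f : BiPoly k) (n : ℕ) :
    ((blowSub f).coeff n).natDegree ≤ n := by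
  rw [natDegree_le_iff_coeff_eq_zero]
  intro m hm
  rw [coeff_blowSub, if_neg (by omega)]

theorem coeff_blowSub_sw (f : BiPoly k) (n : ℕ) :
    (blowSub (sw f)).coeff n = reflect n ((blowSub f).coeff n) := by
  ext m
  rw [coeff_reflect, coeff_blowSub, coeff_blowSub, coeff_sw]
  split_ifs with h1 h2 h2
  · rw [revAt_le h1]; congr 2; omega
  · rw [revAt_le h1] at h2; omega
  · rw [← revAtFun_eq, revAtFun, if_neg h1] at h2; omega
  · rfl

theorem coeff_blowSub_sw_eq_zero (f : BiPoly k) (n : ℕ) :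
    (blowSub (sw f)).coeff n = 0 ↔ (blowSub f).coeff n = 0 := by
  rw [coeff_blowSub_sw, reflect_eq_zero_iff]

theorem blowSub_ne_zero {f : BiPoly k} (hf : f ≠ 0) : blowSub f ≠ 0 :=
  fun h => hf (blowSub_injective (h.trans (map_zero _).symm))

theorem natDegree_blowSub_sw (f : BiPoly k) :
    (blowSub (sw f)).natDegree = (blowSub f).natDegree := by
  refine le_antisymm ?_ ?_ <;>
  · refine natDegree_le_iff_coeff_eq_zero.2 fun n hn => ?_
    first
    | exact (coeff_blowSub_sw_eq_zero f n).2 (coeff_eq_zero_of_natDegree_lt hn)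
    | exact (coeff_blowSub_sw_eq_zero f n).1 (coeff_eq_zero_of_natDegree_lt hn)

theorem natTrailingDegree_blowSub_sw (f : BiPoly k) :
    (blowSub (sw f)).natTrailingDegree = (blowSub f).natTrailingDegree := by
  by_cases hf : f = 0
  · simp [hf]
  have hf' := blowSub_ne_zero hf
  have hs : blowSub (sw f) ≠ 0 := blowSub_ne_zero (by simpa using hf)
  refine le_antisymm ?_ ?_
  · refine natTrailingDegree_le_of_ne_zero ?_
    rw [Ne, coeff_blowSub_sw_eq_zero]
    exact trailingCoeff_nonzero_iff_nonzero.2 hf'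
  · refine natTrailingDegree_le_of_ne_zero ?_
    rw [Ne, ← coeff_blowSub_sw_eq_zero]
    exact trailingCoeff_nonzero_iff_nonzero.2 hs

end RootCount

/-- One affine chart from which a whole family of charts is obtained by translating and
exchanging the variables. -/
structure BaseChart (k K : Type*) [Field k] [Field K] [Algebra k K]
    [Algebra (BiPoly k) K] where
  /-- The sign. -/
  ε : ℤ
  ε_mul : ε * ε = 1
  /-- The coordinate system. -/
  γ : K ≃ₐ[k] K
  /-- The order up to sign. -/
  n : BiPoly k → ℕ
  /-- The strict transform. -/
  s : BiPoly k → BiPoly k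
  n_add : ∀ f g, f ≠ 0 → g ≠ 0 → f + g ≠ 0 → min (ε * n f) (ε * n g) ≤ ε * n (f + g)
  n_sw : ∀ f, n (sw f) = n f
  eq : ∀ f, f ≠ 0 → γ.symm (algebraMap (BiPoly k) K f) =
    algebraMap (BiPoly k) K x ^ (ε * n f) * algebraMap _ K (s f)
  coeff_zero : ∀ f, f ≠ 0 → (s f).coeff 0 = (blowSub f).coeff (n f)
  coeff_ne_zero : ∀ f, f ≠ 0 → (blowSub f).coeff (n f) ≠ 0

section

variable {k K : Type*} [Field k] [IsAlgClosed k] [Field K] [Algebra k K] [Algebra (BiPoly k) K]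
  [IsScalarTower k (BiPoly k) K] [IsFractionRing (BiPoly k) K]

local notation "ι" => algebraMap (BiPoly k) K

/-- The charts of a family. -/
noncomputable def chartAut (γ : K ≃ₐ[k] K) : Option k → K ≃ₐ[k] K
  | none => γ.trans (planeAut sw)
  | some c => (planeAut (tr 0 c).symm).trans γ

/-- The strict transforms of a family. -/
noncomputable def chartTransform (s : BiPoly k → BiPoly k) : Option k → BiPoly k → BiPoly k
  | none, f => s (sw f)
  | some c, f => tr 0 c (s f)

/-- The chart family of a base chart. -/
noncomputable def BaseChart.family (D : BaseChart k K) : ChartFamily k K (Option k) where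
  ε := D.ε
  φ := chartAut D.γ
  v f := D.ε * D.n f
  σ := chartTransform D.s
  v_add := D.n_add
  eq j f hf := by
    cases j with
    | none =>
      have hs : sw f ≠ 0 := by simpa using hf
      change D.γ.symm (planeAut sw (ι f)) = _
      rw [planeAut_algebraMap, D.eq _ hs, D.n_sw]
      rfl
    | some c =>
      change planeAut (tr 0 c) (D.γ.symm (ι f)) = _
      rw [D.eq _ hf, map_mul, map_zpow₀, planeAut_algebraMap, planeAut_algebraMap, tr_x, map_zero,
        add_zero]
      rfl
  not_dvd j f hf := by
    rw [x_dvd_iff]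
    cases j with
    | none =>
      have hs : sw f ≠ 0 := by simpa using hf
      change (D.s (sw f)).coeff 0 ≠ 0
      rw [D.coeff_zero _ hs]
      exact D.coeff_ne_zero _ hs
    | some c =>
      change (tr 0 c (D.s f)).coeff 0 ≠ 0
      rw [coeff_zero_tr, D.coeff_zero _ hf, Ne, comp_X_add_C_eq_zero_iff]
      exact D.coeff_ne_zero _ hf
  nonneg f _ := by
    rw [← mul_assoc, D.ε_mul, one_mul]; positivity
  sum_x f hf := by
    have hs : sw f ≠ 0 := by simpa using hf
    have h0 := D.coeff_ne_zero _ hf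
    rw [ENNReal.tsum_option, ← mul_assoc, D.ε_mul, one_mul, Int.toNat_natCast]
    have e1 : ip (chartTransform D.s none f) x =
        ((D.n f - ((blowSub f).coeff (D.n f)).natDegree : ℕ) : ℝ≥0∞) := by
      have h := D.coeff_zero _ hs
      have h' := D.coeff_ne_zero _ hs
      rw [D.n_sw, coeff_blowSub_sw] at h h'
      change ip (D.s (sw f)) x = _
      rw [ip_x_right (by rwa [h]), h, rootMultiplicity_eq_natTrailingDegree',
        natTrailingDegree_reflect h0 (natDegree_coeff_blowSub_le _ _)]
    have e2 : ∀ c, ip (chartTransform D.s (some c) f) x =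
        (((blowSub f).coeff (D.n f)).rootMultiplicity c : ℝ≥0∞) := by
      intro c
      have h := coeff_zero_tr c (D.s f)
      rw [D.coeff_zero _ hf] at h
      change ip (tr 0 c (D.s f)) x = _
      rw [ip_x_right, h, ← rootMultiplicity_eq_rootMultiplicity]
      rwa [h, Ne, comp_X_add_C_eq_zero_iff]
    rw [e1, tsum_congr e2, tsum_rootMultiplicity h0, ← Nat.cast_add,
      Nat.sub_add_cancel (natDegree_coeff_blowSub_le _ _)]

omit [IsAlgClosed k] in
theorem exists_blowSub_eq (f : BiPoly k) :
    ∃ g, blowSub f = x ^ (blowSub f).natTrailingDegree * g :=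
  X_pow_dvd_iff.2 fun _ hd => coeff_eq_zero_of_lt_natTrailingDegree hd

/-- The chart of a blow-up of the origin. -/
noncomputable def blowBase : BaseChart k K where
  ε := 1
  ε_mul := one_mul 1
  γ := blowAut
  n f := (blowSub f).natTrailingDegree
  s f := (exists_blowSub_eq f).choose
  n_add f g hf hg hfg := by
    have : min (blowSub f).natTrailingDegree (blowSub g).natTrailingDegree ≤
        (blowSub (f + g)).natTrailingDegree := by
      refine le_natTrailingDegree (blowSub_ne_zero hfg) fun m hm => ?_
      rw [map_add, coeff_add, coeff_eq_zero_of_lt_natTrailingDegree (hm.trans_le (min_le_left _ _)),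
        coeff_eq_zero_of_lt_natTrailingDegree (hm.trans_le (min_le_right _ _)), add_zero]
    omega
  n_sw := natTrailingDegree_blowSub_sw
  eq f hf := by
    rw [blowAut_symm, one_mul, zpow_natCast, ← map_pow, ← map_mul,
      ← (exists_blowSub_eq f).choose_spec]
  coeff_zero f hf := by
    have h := congrFun (congrArg coeff (exists_blowSub_eq f).choose_spec)
      (blowSub f).natTrailingDegree
    rw [h]
    change _ = coeff (X ^ _ * _) _
    simp [coeff_X_pow_mul']
  coeff_ne_zero f hf := trailingCoeff_nonzero_iff_nonzero.2 (blowSub_ne_zero hf)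

/-- The chart at infinity. -/
noncomputable def infBase : BaseChart k K where
  ε := -1
  ε_mul := by norm_num
  γ := invAut.trans blowAut
  n f := (blowSub f).natDegree
  s f := (blowSub f).reverse
  n_add f g _ _ _ := by
    have := natDegree_add_le (blowSub f) (blowSub g)
    rw [map_add]
    omega
  n_sw := natDegree_blowSub_sw
  eq f _ := by
    change invAut.symm (blowAut.symm _) = _
    rw [blowAut_symm, invAut_symm, neg_one_mul]
  coeff_zero f _ := coeff_zero_reverse _
  coeff_ne_zero f hf := leadingCoeff_ne_zero.2 (blowSub_ne_zero hf)

end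

/-- Euclidean induction down to pairs of coordinate lines. -/
theorem BiPoly.line_induction {k : Type*} [Field k] [IsAlgClosed k]
    (Q : BiPoly k → BiPoly k → Prop)
    (symm : ∀ f g, Q f g → Q g f)
    (const : ∀ (c : k) g, c ≠ 0 → g ≠ 0 → Q (algebraMap k _ c) g)
    (lines : ∀ a b : k, Q (y - algebraMap k _ b) (x - algebraMap k _ a))
    (mul : ∀ f g h, f ≠ 0 → g ≠ 0 → h ≠ 0 → Q f g → Q f h → Q f (g * h))
    (cancel : ∀ f g h, f ≠ 0 → g ≠ 0 → h ≠ 0 → Q f h → Q f (g * h) → Q f g)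
    (shift : ∀ f g h, f ≠ 0 → g ≠ 0 → g + h * f ≠ 0 → Q f g → Q f (g + h * f))
    (f g : BiPoly k) (hf : f ≠ 0) (hg : g ≠ 0) (hfg : IsRelPrime f g) : Q f g := by
  refine BiPoly.euclid_induction Q symm const (fun b g hg hd => ?_) mul cancel shift f g hf hg hfg
  have hl0 : (C (X - C b) : BiPoly k) ≠ 0 := C_ne_zero.2 (X_sub_C_ne_zero b)
  have line : ∀ (n : ℕ) (h : k[X]), h.natDegree = n → h ≠ 0 → Q (C (X - C b)) (h.map C) := by
    intro n
    induction n with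
    | zero =>
      intro h hn h0
      obtain ⟨c, rfl⟩ := natDegree_eq_zero.1 hn
      rw [map_C]
      exact symm _ _ (const c _ (by rintro rfl; simp at h0) hl0)
    | succ n ih =>
      intro h hn h0
      obtain ⟨a, ha⟩ := IsAlgClosed.exists_root h (by
        rw [degree_eq_natDegree h0, hn]; exact_mod_cast Nat.succ_ne_zero n)
      obtain ⟨h', rfl⟩ := dvd_iff_isRoot.2 ha
      have h'0 : h' ≠ 0 := right_ne_zero_of_mul h0
      rw [natDegree_mul (X_sub_C_ne_zero a) h'0, natDegree_X_sub_C] at hn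
      rw [Polynomial.map_mul]
      refine mul _ _ _ hl0 ?_ ?_ ?_ (ih h' (by omega) h'0)
      · rw [Ne, Polynomial.map_eq_zero_iff (C_injective)]
        exact X_sub_C_ne_zero a
      · rwa [Ne, Polynomial.map_eq_zero_iff (C_injective)]
      · have := lines a b
        rw [BiPoly.algebraMap_eq, BiPoly.algebraMap_eq, y, x, ← C_sub] at this
        simpa using this
  set h : k[X] := g.map (evalRingHom b) with hh
  have hdvd : C (X - C b) ∣ g - h.map C := by
    rw [C_dvd_iff_dvd_coeff]
    intro i
    rw [dvd_iff_isRoot]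
    simp [hh]
  obtain ⟨q, hq⟩ := hdvd
  have hgq : g = h.map C + q * C (X - C b) := by rw [mul_comm q, ← hq]; ring
  have h0 : h ≠ 0 := by
    intro h0
    rw [h0, Polynomial.map_zero, zero_add] at hgq
    exact hd ⟨q, hgq.trans (mul_comm _ _)⟩
  have hm0 : (h.map C : BiPoly k) ≠ 0 := by rwa [Ne, Polynomial.map_eq_zero_iff C_injective]
  rw [hgq]
  exact shift _ _ _ hl0 hm0 (hgq ▸ hg) (line _ h rfl h0)

namespace ChartFamily

variable {k K J : Type*} [Field k] [Field K] [Algebra k K]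
  [Algebra (BiPoly k) K] [IsFractionRing (BiPoly k) K]
  (F : ChartFamily k K J)

theorem vσ_unique (j : J) {f g : BiPoly k} {m : ℤ} (hf : f ≠ 0) (hg : ¬ x ∣ g)
    (h : (F.φ j).symm (algebraMap (BiPoly k) K f) =
      algebraMap (BiPoly k) K x ^ m * algebraMap _ K g) :
    F.v f = m ∧ F.σ j f = g :=
  x_zpow_mul_unique (F.not_dvd j f hf) hg ((F.eq j f hf).symm.trans h)

end ChartFamily

section

variable {k K : Type*} [Field k] [IsAlgClosed k] [Field K] [Algebra k K] [Algebra (BiPoly k) K]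
  [IsScalarTower k (BiPoly k) K] [IsFractionRing (BiPoly k) K]

local notation "ι" => algebraMap (BiPoly k) K

/-- The charts around the exceptional curve of the blow-up of the origin. -/
noncomputable def blowFam (k K : Type*) [Field k] [IsAlgClosed k] [Field K] [Algebra k K]
    [Algebra (BiPoly k) K] [IsScalarTower k (BiPoly k) K] [IsFractionRing (BiPoly k) K] :
    ChartFamily k K (Option k) := blowBase.family

/-- The charts around the line at infinity. -/
noncomputable def infFam (k K : Type*) [Field k] [IsAlgClosed k] [Field K] [Algebra k K]
    [Algebra (BiPoly k) K] [IsScalarTower k (BiPoly k) K] [IsFractionRing (BiPoly k) K] :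
    ChartFamily k K (Option k) := infBase.family

theorem blowFam_ε : (blowFam k K).ε = 1 := rfl
theorem infFam_ε : (infFam k K).ε = -1 := rfl

theorem blowFam_some_x (c : k) : ((blowFam k K).φ (some c)).symm (ι x) = ι x := by
  change planeAut (tr 0 c) (blowAut.symm (ι x)) = _
  rw [blowAut_symm, planeAut_algebraMap, blowSub, bsub_x, tr_x, map_zero, add_zero]

theorem blowFam_some_y (c : k) :
    ((blowFam k K).φ (some c)).symm (ι y) = ι x * ι (y + algebraMap k _ c) := by
  change planeAut (tr 0 c) (blowAut.symm (ι y)) = _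
  rw [blowAut_symm, planeAut_algebraMap, blowSub, bsub_y, map_mul, map_mul, tr_x, map_zero,
    add_zero, tr_y]

theorem blowFam_none_x : ((blowFam k K).φ none).symm (ι x) = ι x * ι y := by
  change blowAut.symm (planeAut sw (ι x)) = _
  rw [planeAut_algebraMap, blowAut_symm, sw_x, blowSub, bsub_y, map_mul]

theorem blowFam_none_y : ((blowFam k K).φ none).symm (ι y) = ι x := by
  change blowAut.symm (planeAut sw (ι y)) = _
  rw [planeAut_algebraMap, blowAut_symm, sw_y, blowSub, bsub_x]

omit [IsAlgClosed k] in
theorem invAut_symm_x : (invAut (k := k)).symm (ι x) = (ι x)⁻¹ := by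
  rw [AlgEquiv.symm_apply_eq, map_inv₀, invAut_x, inv_inv]

omit [IsAlgClosed k] in
theorem invAut_symm_y : (invAut (k := k)).symm (ι y) = ι y := by
  rw [AlgEquiv.symm_apply_eq, invAut_y]

theorem infFam_some_x (c : k) : ((infFam k K).φ (some c)).symm (ι x) = (ι x)⁻¹ := by
  change planeAut (tr 0 c) (invAut.symm (blowAut.symm (ι x))) = _
  rw [blowAut_symm, blowSub, bsub_x, invAut_symm_x, map_inv₀, planeAut_algebraMap, tr_x, map_zero,
    add_zero]

theorem infFam_some_y (c : k) :
    ((infFam k K).φ (some c)).symm (ι y) = (ι x)⁻¹ * ι (y + algebraMap k _ c) := by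
  change planeAut (tr 0 c) (invAut.symm (blowAut.symm (ι y))) = _
  rw [blowAut_symm, blowSub, bsub_y, map_mul, map_mul, invAut_symm_x, invAut_symm_y, map_mul,
    map_inv₀, planeAut_algebraMap, planeAut_algebraMap, tr_x, map_zero, add_zero, tr_y]

theorem infFam_none_x : ((infFam k K).φ none).symm (ι x) = (ι x)⁻¹ * ι y := by
  change invAut.symm (blowAut.symm (planeAut sw (ι x))) = _
  rw [planeAut_algebraMap, blowAut_symm, sw_x, blowSub, bsub_y, map_mul, map_mul, invAut_symm_x,
    invAut_symm_y]

theorem infFam_none_y : ((infFam k K).φ none).symm (ι y) = (ι x)⁻¹ := by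
  change invAut.symm (blowAut.symm (planeAut sw (ι y))) = _
  rw [planeAut_algebraMap, blowAut_symm, sw_y, blowSub, bsub_x, invAut_symm_x]

omit [IsAlgClosed k] in
theorem not_x_dvd_of_coeff {f : BiPoly k} (m : ℕ) (h : (f.coeff 0).coeff m ≠ 0) : ¬ x ∣ f := by
  rw [x_dvd_iff]
  intro h0
  simp [h0] at h

omit [IsAlgClosed k] in
theorem not_x_dvd_of_ev0 {f : BiPoly k} (h : ev0 f ≠ 0) : ¬ x ∣ f := by
  rintro ⟨g, rfl⟩
  simp at h

theorem ChartFamily.vσ_algebraMap {J : Type*} (F : ChartFamily k K J) (j : J) {c : k}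
    (hc : c ≠ 0) : F.v (algebraMap k _ c) = 0 ∧ F.σ j (algebraMap k _ c) = algebraMap k _ c := by
  have h0 : ev0 (algebraMap k (BiPoly k) c) ≠ 0 := by rwa [ev0_algebraMap]
  refine F.vσ_unique j ?_ (not_x_dvd_of_ev0 h0) ?_
  · rintro h; rw [h] at h0; simp at h0
  · rw [← IsScalarTower.algebraMap_apply, AlgEquiv.commutes, zpow_zero, one_mul]

theorem ChartFamily.T_algebraMap {J : Type*} (F : ChartFamily k K J) {c : k} (hc : c ≠ 0)
    (g : BiPoly k) : F.T (algebraMap k _ c) g = 0 := by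
  rw [T, ENNReal.tsum_eq_zero]
  intro j
  rw [(F.vσ_algebraMap j hc).2, ip_of_ev0_left]
  rwa [ev0_algebraMap]

omit [IsAlgClosed k] in
theorem ENNReal_cancel {A B C C' : ℕ} {T T' : ℝ≥0∞} (h : T' + A = T + B)
    (hA : A + C = B + C') : T' + C' = T + C := by
  have h1 : T' + C' + A = T + C + A := by
    have : ((A + C : ℕ) : ℝ≥0∞) = ((B + C' : ℕ) : ℝ≥0∞) := by rw [hA]
    push_cast at this
    calc T' + C' + A = (T' + A) + C' := by ring
      _ = T + (B + C') := by rw [h]; ring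
      _ = T + C + A := by rw [← this]; ring
  exact (ENNReal.add_left_inj (ENNReal.natCast_ne_top A)).1 h1

theorem sub_algebraMap_ne_zero (b : k) :
    (y - algebraMap k _ b : BiPoly k) ≠ 0 ∧ (x - algebraMap k _ b : BiPoly k) ≠ 0 :=
  ⟨by rw [BiPoly.algebraMap_eq, y, ← C_sub]; exact C_ne_zero.2 (X_sub_C_ne_zero b),
    X_sub_C_ne_zero (C b)⟩

/-- Noether's formula for the behaviour of intersection numbers under blowing up. -/
theorem blowFam_T {f g : BiPoly k} (hf : f ≠ 0) (hg : g ≠ 0) (hfg : IsRelPrime f g) :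
    (blowFam k K).T f g + ((blowFam k K).v f * (blowFam k K).v g).toNat = ip f g ∧
      ip f g ≠ ⊤ := by
  set F := blowFam k K with hF
  have hn : ∀ f, f ≠ 0 → 0 ≤ F.v f := fun f hf => by simpa [hF, blowFam_ε] using F.nonneg f hf
  have hε : F.ε = 1 := rfl
  refine BiPoly.line_induction (fun f g => F.T f g + (F.v f * F.v g).toNat = ip f g ∧
      ip f g ≠ ⊤) ?_ ?_ ?_ ?_ ?_ ?_ f g hf hg hfg
  · intro f g h
    rw [F.T_comm, mul_comm, ip_comm]; exact h
  · intro c g hc hg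
    rw [F.T_algebraMap hc, (F.vσ_algebraMap none hc).1, ip_of_ev0_left]
    · simp
    · rwa [ev0_algebraMap]
  · intro a b
    obtain ⟨hy0, -⟩ := sub_algebraMap_ne_zero b
    obtain ⟨-, hx0⟩ := sub_algebraMap_ne_zero a
    by_cases hb : b = 0
    · by_cases ha : a = 0
      · subst ha hb
        simp only [map_zero, sub_zero] at *
        have hs : ∀ c, F.v (x : BiPoly k) = 1 ∧ F.σ (some c) (x : BiPoly k) = 1 := fun c =>
          F.vσ_unique (some c) hx0 (not_x_dvd_of_ev0 (by simp)) (by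
            rw [hF, blowFam_some_x]; simp)
        have ht : F.v (y : BiPoly k) = 1 ∧ F.σ none (y : BiPoly k) = 1 :=
          F.vσ_unique none hy0 (not_x_dvd_of_ev0 (by simp)) (by
            rw [hF, blowFam_none_y]; simp)
        have hT : F.T (y : BiPoly k) x = 0 := by
          rw [ChartFamily.T, ENNReal.tsum_eq_zero]
          rintro (_ | c)
          · rw [ht.2, ip_of_ev0_left _ (by simp)]
          · rw [(hs c).2, ip_of_ev0_right _ (by simp)]
        rw [hT, ht.1, (hs 0).1, ip_comm, ip_x_y]
        simp
      · have hu : ev0 (x - algebraMap k (BiPoly k) a) ≠ 0 := by simpa using ha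
        have hs : ∀ j, F.v (x - algebraMap k (BiPoly k) a) = 0 ∧
            ev0 (F.σ j (x - algebraMap k (BiPoly k) a)) ≠ 0 := by
          rintro (_ | c)
          · have h1 : ev0 (x * y - algebraMap k (BiPoly k) a) ≠ 0 := by simpa using ha
            have := F.vσ_unique none (m := 0) hx0 (not_x_dvd_of_ev0 h1) (by
              rw [hF, map_sub, map_sub, blowFam_none_x, ← IsScalarTower.algebraMap_apply,
                AlgEquiv.commutes]
              simp [IsScalarTower.algebraMap_apply k (BiPoly k) K])
            exact ⟨this.1, by rw [this.2]; exact h1⟩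
          · have := F.vσ_unique (some c) (m := 0) hx0 (not_x_dvd_of_ev0 hu) (by
              rw [hF, map_sub, map_sub, blowFam_some_x, ← IsScalarTower.algebraMap_apply,
                AlgEquiv.commutes]
              simp [IsScalarTower.algebraMap_apply k (BiPoly k) K])
            exact ⟨this.1, by rw [this.2]; exact hu⟩
        have hT : F.T (y - algebraMap k (BiPoly k) b) (x - algebraMap k (BiPoly k) a) = 0 := by
          rw [ChartFamily.T, ENNReal.tsum_eq_zero]
          exact fun j => ip_of_ev0_right _ (hs j).2
        rw [hT, (hs none).1, ip_of_ev0_right _ hu]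
        simp
    · have hu : ev0 (y - algebraMap k (BiPoly k) b) ≠ 0 := by simpa using hb
      have hs : ∀ j, F.v (y - algebraMap k (BiPoly k) b) = 0 ∧
          ev0 (F.σ j (y - algebraMap k (BiPoly k) b)) ≠ 0 := by
        rintro (_ | c)
        · have h1 : ev0 (x - algebraMap k (BiPoly k) b) ≠ 0 := by simpa using hb
          have := F.vσ_unique none (m := 0) hy0 (not_x_dvd_of_ev0 h1) (by
            rw [hF, map_sub, map_sub, blowFam_none_y, ← IsScalarTower.algebraMap_apply,
              AlgEquiv.commutes]
            simp [IsScalarTower.algebraMap_apply k (BiPoly k) K])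
          exact ⟨this.1, by rw [this.2]; exact h1⟩
        · have h1 : ev0 (x * (y + algebraMap k _ c) - algebraMap k (BiPoly k) b) ≠ 0 := by
            simpa using hb
          have := F.vσ_unique (some c) (m := 0) hy0 (not_x_dvd_of_ev0 h1) (by
            rw [hF, map_sub, map_sub, blowFam_some_y, ← IsScalarTower.algebraMap_apply,
              AlgEquiv.commutes]
            simp [IsScalarTower.algebraMap_apply k (BiPoly k) K])
          exact ⟨this.1, by rw [this.2]; exact h1⟩
      have hT : F.T (y - algebraMap k (BiPoly k) b) (x - algebraMap k (BiPoly k) a) = 0 := by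
        rw [ChartFamily.T, ENNReal.tsum_eq_zero]
        exact fun j => ip_of_ev0_left _ (hs j).2
      rw [hT, (hs none).1, ip_of_ev0_left _ hu]
      simp
  · rintro f g h hf hg hh ⟨h1, h1'⟩ ⟨h2, h2'⟩
    rw [F.T_mul _ hg hh, F.v_mul hg hh, ip_mul_right, ← h1, ← h2, mul_add,
      Int.toNat_add (mul_nonneg (hn f hf) (hn g hg)) (mul_nonneg (hn f hf) (hn h hh))]
    refine ⟨by push_cast; ring, ?_⟩
    rw [h1, h2]
    exact ENNReal.add_ne_top.2 ⟨h1', h2'⟩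
  · rintro f g h hf hg hh ⟨h2, h2'⟩ ⟨h1, h1'⟩
    rw [F.T_mul _ hg hh, F.v_mul hg hh, ip_mul_right, mul_add,
      Int.toNat_add (mul_nonneg (hn f hf) (hn g hg)) (mul_nonneg (hn f hf) (hn h hh)), ← h2] at h1
    rw [ip_mul_right] at h1'
    rw [← h2] at h2'
    refine ⟨(ENNReal.add_left_inj h2').1 ?_, (ENNReal.add_ne_top.1 h1').1⟩
    rw [← h1]
    push_cast; ring
  · rintro f g h hf hg hgh ⟨h1, h1'⟩
    rw [ip_add_mul_right]
    refine ⟨?_, h1'⟩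
    rw [← h1]
    obtain ⟨N, hN1, hN2, e⟩ := F.T_shift (g := g) (h := h) hf hg hgh
    rw [hε, one_mul, ← Nat.cast_mul, ← Nat.cast_mul] at e
    refine ENNReal_cancel e ?_
    have e1 := hn f hf
    have e2 := hn g hg
    have e3 := hn _ hgh
    zify
    rw [Int.toNat_of_nonneg e1, Int.toNat_of_nonneg (mul_nonneg e1 e2),
      Int.toNat_of_nonneg (mul_nonneg e1 e3), Int.toNat_of_nonneg (sub_nonneg.2 hN1),
      Int.toNat_of_nonneg (sub_nonneg.2 hN2)]
    ring

end

section

variable {k K : Type*} [Field k] [IsAlgClosed k] [Field K] [Algebra k K] [Algebra (BiPoly k) K]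
  [IsScalarTower k (BiPoly k) K] [IsFractionRing (BiPoly k) K]

local notation "ι" => algebraMap (BiPoly k) K

omit [IsAlgClosed k] in
theorem tr_algebraMap (a b c : k) :
    tr a b (algebraMap k (BiPoly k) c) = algebraMap k _ c := AlgEquiv.commutes _ _

omit [IsAlgClosed k] in
theorem tr_isUnit_algebraMap {a b c : k} (hc : c ≠ 0) :
    ev0 (tr a b (algebraMap k (BiPoly k) c)) ≠ 0 := by
  rwa [tr_algebraMap, ev0_algebraMap]

/-- Bezout's theorem: the affine intersection numbers and the intersection numbers of the
strict transforms at infinity add up to the product of the degrees. -/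
theorem infFam_T {f g : BiPoly k} (hf : f ≠ 0) (hg : g ≠ 0) (hfg : IsRelPrime f g) :
    (infFam k K).T f g + ∑' p : k × k, ip (tr p.1 p.2 f) (tr p.1 p.2 g) =
      ((infFam k K).v f * (infFam k K).v g).toNat := by
  set F := infFam k K with hF
  have hn : ∀ f, f ≠ 0 → F.v f ≤ 0 := fun f hf => by
    have := F.nonneg f hf
    rw [show F.ε = -1 from rfl, neg_one_mul] at this
    omega
  have hε : F.ε = -1 := rfl
  refine BiPoly.line_induction (fun f g => F.T f g + ∑' p : k × k,
    ip (tr p.1 p.2 f) (tr p.1 p.2 g) = (F.v f * F.v g).toNat) ?_ ?_ ?_ ?_ ?_ ?_ f g hf hg hfg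
  · intro f g h
    rw [F.T_comm, mul_comm]; simpa only [ip_comm] using h
  · intro c g hc hg
    rw [F.T_algebraMap hc, (F.vσ_algebraMap none hc).1, ENNReal.tsum_eq_zero.2 (fun p =>
      ip_of_ev0_left _ (tr_isUnit_algebraMap hc))]
    simp
  · intro a b
    obtain ⟨hy0, -⟩ := sub_algebraMap_ne_zero b
    obtain ⟨-, hx0⟩ := sub_algebraMap_ne_zero a
    have hs : ∀ c, F.v (x - algebraMap k (BiPoly k) a) = -1 ∧
        ev0 (F.σ (some c) (x - algebraMap k (BiPoly k) a)) ≠ 0 := by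
      intro c
      have h1 : ev0 (1 - algebraMap k (BiPoly k) a * x) ≠ 0 := by simp
      have := F.vσ_unique (some c) (m := -1) hx0 (not_x_dvd_of_ev0 h1) (by
        have h0 := algebraMap_x_ne_zero (k := k) (K := K)
        rw [hF, map_sub, map_sub, infFam_some_x, ← IsScalarTower.algebraMap_apply,
          AlgEquiv.commutes, map_sub, map_mul, ← IsScalarTower.algebraMap_apply, map_one]
        field_simp)
      exact ⟨this.1, by rw [this.2]; exact h1⟩
    have ht : F.v (y - algebraMap k (BiPoly k) b) = -1 ∧
        ev0 (F.σ none (y - algebraMap k (BiPoly k) b)) ≠ 0 := by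
      have h1 : ev0 (1 - algebraMap k (BiPoly k) b * x) ≠ 0 := by simp
      have := F.vσ_unique none (m := -1) hy0 (not_x_dvd_of_ev0 h1) (by
        have h0 := algebraMap_x_ne_zero (k := k) (K := K)
        rw [hF, map_sub, map_sub, infFam_none_y, ← IsScalarTower.algebraMap_apply,
          AlgEquiv.commutes, map_sub, map_mul, ← IsScalarTower.algebraMap_apply, map_one]
        field_simp)
      exact ⟨this.1, by rw [this.2]; exact h1⟩
    have hT : F.T (y - algebraMap k (BiPoly k) b) (x - algebraMap k (BiPoly k) a) = 0 := by
      rw [ChartFamily.T, ENNReal.tsum_eq_zero]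
      rintro (_ | c)
      · exact ip_of_ev0_left _ ht.2
      · exact ip_of_ev0_right _ (hs c).2
    rw [hT, ht.1, (hs 0).1, zero_add, tsum_eq_single (a, b)]
    · have e1 : tr a b (y - algebraMap k (BiPoly k) b) = y := by
        rw [map_sub, tr_y, tr_algebraMap, add_sub_cancel_right]
      have e2 : tr a b (x - algebraMap k (BiPoly k) a) = x := by
        rw [map_sub, tr_x, tr_algebraMap, add_sub_cancel_right]
      rw [e1, e2, ip_comm, ip_x_y]; simp
    · rintro ⟨a', b'⟩ hne
      by_cases ha : a' = a
      · have hb : b' ≠ b := fun hb => hne (by rw [ha, hb])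
        refine ip_of_ev0_left _ ?_
        rw [map_sub, tr_y, tr_algebraMap, map_sub, map_add, ev0_y, ev0_algebraMap, ev0_algebraMap,
          zero_add, sub_ne_zero]
        exact hb
      · refine ip_of_ev0_right _ ?_
        rw [map_sub, tr_x, tr_algebraMap, map_sub, map_add, ev0_x, ev0_algebraMap, ev0_algebraMap,
          zero_add, sub_ne_zero]
        exact ha
  · rintro f g h hf hg hh h1 h2
    rw [F.T_mul _ hg hh, F.v_mul hg hh, mul_add,
      Int.toNat_add (mul_nonneg_of_nonpos_of_nonpos (hn f hf) (hn g hg))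
        (mul_nonneg_of_nonpos_of_nonpos (hn f hf) (hn h hh)), Nat.cast_add, ← h1, ← h2]
    simp only [map_mul, ip_mul_right]
    rw [ENNReal.tsum_add]
    ring
  · rintro f g h hf hg hh h2 h1
    rw [F.T_mul _ hg hh, F.v_mul hg hh, mul_add,
      Int.toNat_add (mul_nonneg_of_nonpos_of_nonpos (hn f hf) (hn g hg))
        (mul_nonneg_of_nonpos_of_nonpos (hn f hf) (hn h hh)), Nat.cast_add, ← h2] at h1
    simp only [map_mul, ip_mul_right] at h1
    rw [ENNReal.tsum_add] at h1
    refine (ENNReal.add_left_inj (h2 ▸ ENNReal.natCast_ne_top _)).1 (Eq.trans ?_ h1)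
    ring
  · rintro f g h hf hg hgh h1
    obtain ⟨N, hN1, hN2, e⟩ := F.T_shift (g := g) (h := h) hf hg hgh
    have hS : ∀ p : k × k, ip (tr p.1 p.2 f) (tr p.1 p.2 (g + h * f)) =
        ip (tr p.1 p.2 f) (tr p.1 p.2 g) := fun p => by
      rw [map_add, map_mul, ip_add_mul_right]
    simp only [hS]
    set S := ∑' p : k × k, ip (tr p.1 p.2 f) (tr p.1 p.2 g)
    rw [hε, ← Nat.cast_mul, ← Nat.cast_mul] at e
    refine (ENNReal.add_left_inj (ENNReal.natCast_ne_top
      ((F.v (g + h * f) - N).toNat * (-1 * F.v f).toNat))).1 ?_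
    rw [add_right_comm, e, add_right_comm, h1, ← Nat.cast_add, ← Nat.cast_add]
    congr 1
    have e1 := hn f hf
    have e2 := hn g hg
    have e3 := hn _ hgh
    zify
    rw [Int.toNat_of_nonneg (mul_nonneg_of_nonpos_of_nonpos e1 e2),
      Int.toNat_of_nonneg (show 0 ≤ -1 * F.v f by omega),
      Int.toNat_of_nonneg (mul_nonneg_of_nonpos_of_nonpos e1 e3),
      Int.toNat_of_nonneg (sub_nonneg.2 hN1), Int.toNat_of_nonneg (sub_nonneg.2 hN2)]
    ring

end

/-- The intersection number as an integer, with value `0` when it is infinite. -/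
noncomputable def iL {k : Type*} [Field k] (f g : Loc k) : ℤ :=
  (Module.length k (Loc k ⧸ Ideal.span {f, g})).toNat

section

variable {k : Type*} [Field k]

theorem coe_iL {f g : Loc k} (h : inum k f g ≠ ⊤) : ((inum k f g).toReal : ℝ) = iL f g := by
  unfold iL inum at *
  rw [Ne, ENat.toENNReal_eq_top] at h
  obtain ⟨n, hn⟩ := ENat.ne_top_iff_exists.1 h
  rw [← hn]; simp

theorem hasSum_iL {α : Type*} {f g : α → Loc k} {N : ℕ} (h : ∑' a, inum k (f a) (g a) = N) :
    HasSum (fun a => iL (f a) (g a)) (N : ℤ) := by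
  have hne : ∑' a, inum k (f a) (g a) ≠ ⊤ := h ▸ ENNReal.natCast_ne_top _
  have hf := fun a => coe_iL (ENNReal.ne_top_of_tsum_ne_top hne a)
  have h1 : HasSum (fun a => (inum k (f a) (g a)).toReal) N := by
    have := ENNReal.hasSum_toReal hne
    rwa [← ENNReal.tsum_toReal_eq (ENNReal.ne_top_of_tsum_ne_top hne), h,
      ENNReal.toReal_natCast] at this
  simp only [hf] at h1
  have h2 : Filter.Tendsto ((↑) ∘ fun s => ∑ a ∈ s, iL (f a) (g a)) Filter.atTop
      (nhds (((N : ℤ) : ℝ))) := by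
    simpa [HasSum, Function.comp_def] using h1
  exact Int.isClosedEmbedding_coe_real.isInducing.tendsto_nhds_iff.2 h2

theorem iL_comm (f g : Loc k) : iL f g = iL g f := by
  unfold iL; rw [Set.pair_comm]

theorem iL_eq_of_inum_eq {f g f' g' : Loc k} (h : inum k f g = inum k f' g') :
    iL f g = iL f' g' := by
  unfold iL inum at *
  rw [ENat.toENNReal_inj.1 h]

theorem iL_of_isUnit_left {f : Loc k} (g : Loc k) (h : IsUnit f) : iL f g = 0 := by
  have := inum_of_isUnit_left (k := k) g h
  have h2 := coe_iL (f := f) (g := g) (by simp [this])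
  rw [this] at h2
  exact_mod_cast h2.symm

theorem iL_of_isUnit_right (f : Loc k) {g : Loc k} (h : IsUnit g) : iL f g = 0 := by
  rw [iL_comm, iL_of_isUnit_left _ h]

theorem iL_of_associated {f g f' g' : Loc k} (h : Associated f f') (h' : Associated g g') :
    iL f g = iL f' g' := iL_eq_of_inum_eq (inum_of_associated h h')

theorem iL_add_mul_right (f g h : Loc k) : iL f (g + h * f) = iL f g :=
  iL_eq_of_inum_eq (inum_add_mul_right f g h)

theorem iL_algEquiv (e : Loc k ≃ₐ[k] Loc k) (f g : Loc k) : iL (e f) (e g) = iL f g :=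
  iL_eq_of_inum_eq (inum_algEquiv e f g)

variable [IsAlgClosed k]

theorem inum_loc_ne_top {f g : Loc k} (h : IsRelPrime f g) : inum k f g ≠ ⊤ := by
  by_cases hf : f = 0
  · rw [inum_of_isUnit_right]
    · simp
    · exact h (hf ▸ dvd_zero _) dvd_rfl
  by_cases hg : g = 0
  · rw [inum_of_isUnit_left]
    · simp
    · exact h dvd_rfl (hg ▸ dvd_zero _)
  obtain ⟨p, hp⟩ := loc_associated f
  obtain ⟨q, hq⟩ := loc_associated g
  have hp0 : p ≠ 0 := by rintro rfl; simp [hf] at hp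
  have hq0 : q ≠ 0 := by rintro rfl; simp [hg] at hq
  obtain ⟨p', q', d, hr, rfl, rfl⟩ := UniqueFactorizationMonoid.exists_reduced_factors p hp0 q
  have hd : IsUnit (toLoc k d) := by
    refine h ?_ ?_
    · rw [hp.dvd_iff_dvd_right, map_mul]; exact dvd_mul_right _ _
    · rw [hq.dvd_iff_dvd_right, map_mul]; exact dvd_mul_right _ _
  have e : inum k f g = ip p' q' := by
    unfold ip
    refine inum_of_associated (hp.trans ?_) (hq.trans ?_)
    · rw [map_mul]; exact (associated_isUnit_mul_left_iff hd).2 (Associated.refl _)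
    · rw [map_mul]; exact (associated_isUnit_mul_left_iff hd).2 (Associated.refl _)
  rw [e]
  exact (blowFam_T (K := FractionRing (BiPoly k)) (right_ne_zero_of_mul hp0)
    (right_ne_zero_of_mul hq0) (by exact hr)).2

theorem iL_mul_right {f g h : Loc k} (hg : IsRelPrime f g) (hh : IsRelPrime f h) :
    iL f (g * h) = iL f g + iL f h := by
  have h1 := coe_iL (inum_loc_ne_top hg)
  have h2 := coe_iL (inum_loc_ne_top hh)
  have h3 := coe_iL (inum_loc_ne_top (hg.mul_right hh))
  rw [inum_loc_mul, ENNReal.toReal_add (inum_loc_ne_top hg) (inum_loc_ne_top hh), h1, h2] at h3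
  exact_mod_cast h3.symm

theorem iL_mul_left {f g h : Loc k} (hg : IsRelPrime g f) (hh : IsRelPrime h f) :
    iL (g * h) f = iL g f + iL h f := by
  rw [iL_comm, iL_mul_right hg.symm hh.symm, iL_comm, iL_comm f h]

end

theorem exists_tsum_ip_eq_natCast {k : Type*} [Field k] {α : Type*} {f g : α → BiPoly k}
    (h : ∑' a, ip (f a) (g a) ≠ ⊤) : ∃ n : ℕ, ∑' a, ip (f a) (g a) = n := by
  have hfin := ENNReal.finite_const_le_of_tsum_ne_top h one_ne_zero
  choose n hn using fun a => ip_eq_natCast (ENNReal.ne_top_of_tsum_ne_top h a)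
  refine ⟨∑ a ∈ hfin.toFinset, n a, ?_⟩
  rw [tsum_eq_sum (s := hfin.toFinset), Nat.cast_sum]
  · exact Finset.sum_congr rfl fun a _ => hn a
  · intro a ha
    rw [Set.Finite.mem_toFinset, Set.mem_ofPred_eq, hn a, not_le] at ha
    rw [hn a]
    have : n a < 1 := by exact_mod_cast ha
    simp [Nat.lt_one_iff.1 this]

theorem hasSum_iL_ip {k : Type*} [Field k] {α : Type*} {f g : α → BiPoly k} {N : ℕ}
    (h : ∑' a, ip (f a) (g a) = N) :
    HasSum (fun a => iL (toLoc k (f a)) (toLoc k (g a))) (N : ℤ) := hasSum_iL h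

theorem isRelPrime_toLoc_of_tsum {k : Type*} [Field k] {α : Type*} {f g : α → BiPoly k}
    (h : ∑' a, ip (f a) (g a) ≠ ⊤) (a : α) : IsRelPrime (toLoc k (f a)) (toLoc k (g a)) :=
  isRelPrime_of_inum_ne_top (ENNReal.ne_top_of_tsum_ne_top h a)

section

variable {k K : Type*} [Field k] [IsAlgClosed k] [Field K] [Algebra k K] [Algebra (BiPoly k) K]
  [IsScalarTower k (BiPoly k) K] [IsFractionRing (BiPoly k) K]

omit [IsAlgClosed k] [IsScalarTower k (BiPoly k) K] [IsFractionRing (BiPoly k) K] in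
theorem ChartFamily.hasSum_x {J : Type*} (F : ChartFamily k K J) {f : BiPoly k} (hf : f ≠ 0) :
    HasSum (fun j => iL (toLoc k (F.σ j f)) (toLoc k x)) (F.ε * F.v f) ∧
      ∀ j, IsRelPrime (toLoc k (F.σ j f)) (toLoc k x) := by
  have h := F.sum_x f hf
  refine ⟨?_, isRelPrime_toLoc_of_tsum (by rw [h]; exact ENNReal.natCast_ne_top _)⟩
  have := hasSum_iL_ip h
  rwa [Int.toNat_of_nonneg (F.nonneg f hf)] at this

theorem blowFam_hasSum {f g : BiPoly k} (hf : f ≠ 0) (hg : g ≠ 0) (hfg : IsRelPrime f g) :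
    HasSum (fun j => iL (toLoc k ((blowFam k K).σ j f)) (toLoc k ((blowFam k K).σ j g)))
        (iL (toLoc k f) (toLoc k g) - (blowFam k K).v f * (blowFam k K).v g) ∧
      ∀ j, IsRelPrime (toLoc k ((blowFam k K).σ j f)) (toLoc k ((blowFam k K).σ j g)) := by
  obtain ⟨h1, h2⟩ := blowFam_T (K := K) hf hg hfg
  have h3 : (blowFam k K).T f g ≠ ⊤ := by
    rw [← h1] at h2
    exact (ENNReal.add_ne_top.1 h2).1
  refine ⟨?_, isRelPrime_toLoc_of_tsum h3⟩
  have e := coe_iL (f := toLoc k f) (g := toLoc k g) h2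
  obtain ⟨n, hn⟩ := ip_eq_natCast h2
  change (ip f g).toReal = _ at e
  rw [hn] at h1 e
  rw [ENNReal.toReal_natCast] at e
  have e' : (n : ℤ) = iL (toLoc k f) (toLoc k g) := by exact_mod_cast e
  obtain ⟨m, hm⟩ : ∃ m : ℕ, (blowFam k K).T f g = m := by
    refine ⟨n - ((blowFam k K).v f * (blowFam k K).v g).toNat, ?_⟩
    rw [ENNReal.natCast_sub, ← h1, ENNReal.add_sub_cancel_right (ENNReal.natCast_ne_top _)]
  have hs := hasSum_iL_ip hm
  rw [hm] at h1
  have h4 : m + ((blowFam k K).v f * (blowFam k K).v g).toNat = n := by exact_mod_cast h1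
  have hn : ∀ f, f ≠ 0 → 0 ≤ (blowFam k K).v f := fun f hf => by
    simpa [blowFam_ε] using (blowFam k K).nonneg f hf
  have h5 := Int.toNat_of_nonneg (mul_nonneg (hn f hf) (hn g hg))
  convert hs using 1
  rw [← e', ← h4, ← h5]; push_cast; simp

theorem infFam_hasSum {f g : BiPoly k} (hf : f ≠ 0) (hg : g ≠ 0) (hfg : IsRelPrime f g) :
    (∃ S : ℤ, HasSum (fun p : k × k => iL (toLoc k (tr p.1 p.2 f)) (toLoc k (tr p.1 p.2 g))) S ∧
      HasSum (fun j => iL (toLoc k ((infFam k K).σ j f)) (toLoc k ((infFam k K).σ j g)))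
        ((infFam k K).v f * (infFam k K).v g - S)) ∧
      (∀ j, IsRelPrime (toLoc k ((infFam k K).σ j f)) (toLoc k ((infFam k K).σ j g))) ∧
      ∀ p : k × k, IsRelPrime (toLoc k (tr p.1 p.2 f)) (toLoc k (tr p.1 p.2 g)) := by
  have h1 := infFam_T (K := K) hf hg hfg
  set N := ((infFam k K).v f * (infFam k K).v g).toNat with hN
  have h2 := h1.trans_ne (ENNReal.natCast_ne_top _)
  obtain ⟨h3, h4⟩ := ENNReal.add_ne_top.1 h2
  refine ⟨?_, isRelPrime_toLoc_of_tsum h3, isRelPrime_toLoc_of_tsum h4⟩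
  obtain ⟨m, hm⟩ : ∃ m : ℕ, (infFam k K).T f g = m :=
    exists_tsum_ip_eq_natCast h3
  obtain ⟨n, hn⟩ : ∃ n : ℕ, ∑' p : k × k, ip (tr p.1 p.2 f) (tr p.1 p.2 g) = n :=
    exists_tsum_ip_eq_natCast h4
  have hs := hasSum_iL_ip hm
  refine ⟨n, hasSum_iL_ip hn, ?_⟩
  rw [hm, hn] at h1
  have h4 : m + n = N := by exact_mod_cast h1
  have hn : ∀ f, f ≠ 0 → (infFam k K).v f ≤ 0 := fun f hf => by
    have := (infFam k K).nonneg f hf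
    rw [show (infFam k K).ε = -1 from rfl, neg_one_mul] at this
    omega
  have h5 := Int.toNat_of_nonneg (mul_nonneg_of_nonpos_of_nonpos (hn f hf) (hn g hg))
  convert hs using 1
  rw [← hN] at h5
  rw [← h5, ← h4]; push_cast; ring

end

/-- Integer-valued functions on a field that are additive on products of nonzero elements. -/
structure IsAddv {K : Type*} [Field K] (V : K → ℤ) : Prop where
  zero : V 0 = 0
  mul : ∀ a b, a ≠ 0 → b ≠ 0 → V (a * b) = V a + V b

namespace IsAddv

variable {K : Type*} [Field K] {V W : K → ℤ}

theorem one (hV : IsAddv V) : V 1 = 0 := by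
  have := hV.mul 1 1 one_ne_zero one_ne_zero
  rw [mul_one] at this; omega

theorem inv (hV : IsAddv V) (a : K) : V a⁻¹ = - V a := by
  by_cases ha : a = 0
  · simp [ha, hV.zero]
  · have := hV.mul a a⁻¹ ha (inv_ne_zero ha)
    rw [mul_inv_cancel₀ ha, hV.one] at this; omega

theorem div (hV : IsAddv V) {a b : K} (ha : a ≠ 0) (hb : b ≠ 0) : V (a / b) = V a - V b := by
  rw [div_eq_mul_inv, hV.mul _ _ ha (inv_ne_zero hb), hV.inv]; ring

theorem pow (hV : IsAddv V) {a : K} (ha : a ≠ 0) (n : ℕ) : V (a ^ n) = n * V a := by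
  induction n with
  | zero => simp [hV.one]
  | succ n ih => rw [pow_succ, hV.mul _ _ (pow_ne_zero _ ha) ha, ih]; push_cast; ring

theorem zpow (hV : IsAddv V) {a : K} (ha : a ≠ 0) (n : ℤ) : V (a ^ n) = n * V a := by
  obtain ⟨m, rfl | rfl⟩ := n.eq_nat_or_neg
  · rw [zpow_natCast, hV.pow ha]
  · rw [zpow_neg, zpow_natCast, hV.inv, hV.pow ha]; ring

theorem comp (hV : IsAddv V) {F L : Type*} [Field L] [FunLike F L K] [RingHomClass F L K]
    (e : F) : IsAddv (fun z => V (e z)) where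
  zero := by rw [map_zero, hV.zero]
  mul a b ha hb := by
    rw [map_mul, hV.mul _ _ ((map_ne_zero e).2 ha) ((map_ne_zero e).2 hb)]

theorem add (hV : IsAddv V) (hW : IsAddv W) : IsAddv (fun z => V z + W z) where
  zero := by rw [hV.zero, hW.zero, add_zero]
  mul a b ha hb := by rw [hV.mul _ _ ha hb, hW.mul _ _ ha hb]; ring

theorem smul (hV : IsAddv V) (c : ℤ) : IsAddv (fun z => c * V z) where
  zero := by rw [hV.zero, mul_zero]
  mul a b ha hb := by rw [hV.mul _ _ ha hb]; ring

theorem ext (R : Type*) [CommRing R] [IsDomain R] [Algebra R K] [IsFractionRing R K]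
    (hV : IsAddv V) (hW : IsAddv W)
    (h : ∀ r : R, r ≠ 0 → V (algebraMap R K r) = W (algebraMap R K r)) : V = W := by
  funext z
  by_cases hz : z = 0
  · rw [hz, hV.zero, hW.zero]
  obtain ⟨a, b, hb, rfl⟩ := IsFractionRing.div_surjective (A := R) z
  have hb0 : b ≠ 0 := nonZeroDivisors.ne_zero hb
  have ha0 : a ≠ 0 := by rintro rfl; simp at hz
  have hb' : algebraMap R K b ≠ 0 := by simpa using hb0
  have ha' : algebraMap R K a ≠ 0 := by simpa using ha0
  rw [hV.div ha' hb', hW.div ha' hb', h a ha0, h b hb0]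

end IsAddv

section fext

variable {R : Type*} (K : Type*) [CommRing R] [IsDomain R] [Field K] [Algebra R K]
  [IsFractionRing R K]

open Classical in
/-- The additive extension of a function to the field of fractions. -/
noncomputable def fext (h : R → ℤ) (z : K) : ℤ :=
  if z = 0 then 0 else h (IsLocalization.sec (nonZeroDivisors R) z).1 -
    h (IsLocalization.sec (nonZeroDivisors R) z).2

variable {K} {h : R → ℤ} (hm : ∀ a b, a ≠ 0 → b ≠ 0 → h (a * b) = h a + h b)
include hm

theorem fext_div {a b : R} (ha : a ≠ 0) (hb : b ≠ 0) :
    fext K h (algebraMap R K a / algebraMap R K b) = h a - h b := by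
  set z := algebraMap R K a / algebraMap R K b with hz
  have hb' : algebraMap R K b ≠ 0 := by simpa using hb
  have ha' : algebraMap R K a ≠ 0 := by simpa using ha
  have hz0 : z ≠ 0 := div_ne_zero ha' hb'
  rw [fext, if_neg hz0]
  have e := IsLocalization.sec_spec (nonZeroDivisors R) z
  set s := IsLocalization.sec (nonZeroDivisors R) z
  have hs2 : (s.2 : R) ≠ 0 := nonZeroDivisors.ne_zero s.2.2
  have hs1 : s.1 ≠ 0 := by
    intro h0
    rw [h0, map_zero, mul_eq_zero] at e
    rcases e with e | e
    · exact hz0 e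
    · exact hs2 (by simp at e)
  have e2 : a * s.2 = s.1 * b := by
    apply IsFractionRing.injective R K
    rw [map_mul, map_mul, ← e, hz]; field_simp
  have := hm a s.2 ha hs2
  have := hm s.1 b hs1 hb
  rw [e2] at *
  omega

theorem fext_isAddv : IsAddv (fext K h) where
  zero := if_pos rfl
  mul z w hz hw := by
    obtain ⟨a, b, hb, rfl⟩ := IsFractionRing.div_surjective (A := R) z
    obtain ⟨c, d, hd, rfl⟩ := IsFractionRing.div_surjective (A := R) w
    have hb0 : b ≠ 0 := nonZeroDivisors.ne_zero hb
    have hd0 : d ≠ 0 := nonZeroDivisors.ne_zero hd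
    have ha0 : a ≠ 0 := by rintro rfl; simp at hz
    have hc0 : c ≠ 0 := by rintro rfl; simp at hw
    rw [div_mul_div_comm, ← map_mul, ← map_mul, fext_div hm (mul_ne_zero ha0 hc0)
      (mul_ne_zero hb0 hd0), fext_div hm ha0 hb0, fext_div hm hc0 hd0, hm _ _ ha0 hc0,
      hm _ _ hb0 hd0]
    ring

theorem fext_algebraMap {a : R} (ha : a ≠ 0) : fext K h (algebraMap R K a) = h a := by
  have := fext_div (K := K) hm ha one_ne_zero
  have h1 := hm 1 1 one_ne_zero one_ne_zero
  rw [mul_one] at h1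
  rw [map_one, div_one] at this
  rw [this]; omega

end fext

section mult

variable {R : Type*} [CommRing R] [IsDomain R] [UniqueFactorizationMonoid R]

open Classical in
/-- The part of `f` prime to `p`. -/
noncomputable def cof (p f : R) : R :=
  if h : ∃ c, f = p ^ multiplicity p f * c ∧ ¬ p ∣ c then h.choose else 0

theorem cof_spec {p f : R} (hp : Prime p) (hf : f ≠ 0) :
    f = p ^ multiplicity p f * cof p f ∧ ¬ p ∣ cof p f := by
  have h : ∃ c, f = p ^ multiplicity p f * c ∧ ¬ p ∣ c :=
    (FiniteMultiplicity.of_prime_left hp hf).exists_eq_pow_mul_and_not_dvd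
  rw [cof, dif_pos h]
  exact h.choose_spec

theorem mult_unique {p f c : R} {n : ℕ} (hp : Prime p) (h : f = p ^ n * c) (hc : ¬ p ∣ c) :
    multiplicity p f = n ∧ cof p f = c := by
  have hf : f ≠ 0 := by
    rw [h]; exact mul_ne_zero (pow_ne_zero _ hp.ne_zero) (fun h0 => hc (h0 ▸ dvd_zero _))
  have h1 : multiplicity p f = n := by
    refine multiplicity_eq_of_dvd_of_not_dvd (h ▸ dvd_mul_right _ _) ?_
    rw [h, pow_succ, mul_dvd_mul_iff_left (pow_ne_zero _ hp.ne_zero)]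
    exact hc
  refine ⟨h1, ?_⟩
  have := (cof_spec hp hf).1
  rw [h1] at this
  exact mul_left_cancel₀ (pow_ne_zero n hp.ne_zero) (this.symm.trans h)

theorem mult_mul {p f g : R} (hp : Prime p) (hf : f ≠ 0) (hg : g ≠ 0) :
    multiplicity p (f * g) = multiplicity p f + multiplicity p g ∧
      cof p (f * g) = cof p f * cof p g := by
  obtain ⟨h1, h2⟩ := cof_spec hp hf
  obtain ⟨h3, h4⟩ := cof_spec hp hg
  refine mult_unique hp ?_ fun h => (hp.dvd_or_dvd h).elim h2 h4
  conv_lhs => rw [h1, h3]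
  ring

theorem mult_of_not_dvd {p f : R} (hp : Prime p) (hf : ¬ p ∣ f) :
    multiplicity p f = 0 ∧ cof p f = f :=
  mult_unique hp (by simp) hf

theorem Prime.isRelPrime_of_not_dvd {p c : R} (hp : Prime p) (hc : ¬ p ∣ c) : IsRelPrime p c :=
  (hp.irreducible.isRelPrime_iff_not_dvd).2 hc

/-- The valuation of the fraction field attached to `p`. -/
noncomputable def plc (K : Type*) [Field K] [Algebra R K] [IsFractionRing R K] (p : R) : K → ℤ :=
  fext K (fun f => (multiplicity p f : ℤ))

variable {K : Type*} [Field K] [Algebra R K] [IsFractionRing R K] {p : R} (hp : Prime p)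
include hp

theorem mult_hm : ∀ a b : R, a ≠ 0 → b ≠ 0 →
    (multiplicity p (a * b) : ℤ) = multiplicity p a + multiplicity p b := fun a b ha hb => by
  rw [(mult_mul hp ha hb).1]; push_cast; rfl

theorem plc_isAddv : IsAddv (plc K p) := fext_isAddv (mult_hm hp)

theorem plc_algebraMap {a : R} (ha : a ≠ 0) : plc K p (algebraMap R K a) = multiplicity p a :=
  fext_algebraMap (mult_hm hp) ha

theorem plc_of_not_dvd {a : R} (ha : ¬ p ∣ a) : plc K p (algebraMap R K a) = 0 := by
  rw [plc_algebraMap hp (by rintro rfl; exact ha (dvd_zero _)), (mult_of_not_dvd hp ha).1]; rfl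

theorem plc_pos_of_dvd {a : R} (ha : a ≠ 0) (h : p ∣ a) : 1 ≤ plc K p (algebraMap R K a) := by
  rw [plc_algebraMap hp ha]
  by_contra! h1
  have h0 : multiplicity p a = 0 := by omega
  obtain ⟨h2, h3⟩ := cof_spec hp ha
  rw [h0, pow_zero, one_mul] at h2
  exact h3 (h2 ▸ h)

theorem plc_self : plc K p (algebraMap R K p) = 1 := by
  rw [plc_algebraMap hp hp.ne_zero, (mult_unique (n := 1) (c := 1) hp (by simp)
    hp.not_dvd_one).1]; rfl

theorem plc_eq_of_associated {p' : R} (h : Associated p p') : plc K p = plc K p' := by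
  have hp' : Prime p' := h.prime hp
  refine IsAddv.ext R (plc_isAddv hp) (plc_isAddv hp') fun r hr => ?_
  rw [plc_algebraMap hp hr, plc_algebraMap hp' hr, multiplicity_eq_of_associated_left h]

/-- A function on the fraction field which is proportional to the valuation of `p` and takes the
value `1`, and is positive on `p`, is the valuation of `p`. -/
theorem eq_plc {V : K → ℤ} (hV : IsAddv V) (h0 : ∀ f : R, ¬ p ∣ f → V (algebraMap R K f) = 0)
    (h1 : 1 ≤ V (algebraMap R K p)) (hs : ∃ z, V z = 1) : V = plc K p := by
  have h : V = fun z => V (algebraMap R K p) * plc K p z := by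
    refine IsAddv.ext R hV ((plc_isAddv hp).smul _) fun r hr => ?_
    obtain ⟨h2, h3⟩ := cof_spec hp hr
    have h4 : algebraMap R K p ≠ 0 := by simpa using hp.ne_zero
    have h5 : algebraMap R K (cof p r) ≠ 0 := by
      rw [Ne, map_eq_zero_iff _ (IsFractionRing.injective R K)]
      intro h; rw [h] at h3; exact h3 (dvd_zero _)
    rw [plc_algebraMap hp hr]
    conv_lhs => rw [h2, map_mul, hV.mul _ _ (by rw [map_pow]; exact pow_ne_zero _ h4) h5, h0 _ h3,
      map_pow, hV.pow h4]
    ring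
  obtain ⟨z, hz⟩ := hs
  rw [h] at hz
  have h6 : V (algebraMap R K p) = 1 := by
    rcases Int.eq_one_or_neg_one_of_mul_eq_one hz with h | h <;> omega
  rw [h6] at h
  simpa using h

end mult

section hsum

variable {R : Type*} [CommRing R] [IsDomain R] [UniqueFactorizationMonoid R]

/-- The sum of a function over the prime factors. -/
noncomputable def hsum (g : R → ℤ) (f : R) : ℤ :=
  ((UniqueFactorizationMonoid.factors f).map g).sum

theorem hsum_mul {g : R → ℤ} (hg : ∀ p p', Prime p → Associated p p' → g p = g p')
    (a b : R) (ha : a ≠ 0) (hb : b ≠ 0) : hsum g (a * b) = hsum g a + hsum g b := by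
  unfold hsum
  rw [← Multiset.sum_add, ← Multiset.map_add]
  congr 1
  rw [← Multiset.rel_eq, Multiset.rel_map]
  refine (UniqueFactorizationMonoid.factors_mul ha hb).mono fun p hp p' _ h => ?_
  exact hg p p' (UniqueFactorizationMonoid.prime_of_factor p hp) h

theorem hsum_of_isUnit (g : R → ℤ) {u : R} (hu : IsUnit u) : hsum g u = 0 := by
  have : UniqueFactorizationMonoid.factors u = 0 := by
    obtain h | h := (UniqueFactorizationMonoid.factors u).empty_or_exists_mem
    · exact h
    · obtain ⟨p, hp⟩ := h
      exact ((UniqueFactorizationMonoid.prime_of_factor p hp).not_isUnit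
        (isUnit_of_dvd_unit (UniqueFactorizationMonoid.dvd_of_mem_factors hp) hu)).elim
  simp [hsum, this]

theorem hsum_prime {g : R → ℤ} (hg : ∀ p p', Prime p → Associated p p' → g p = g p')
    {p : R} (hp : Prime p) : hsum g p = g p := by
  obtain ⟨q, hq, e⟩ := prime_factors_irreducible hp.irreducible
    ⟨UniqueFactorizationMonoid.prime_of_factor, UniqueFactorizationMonoid.factors_prod hp.ne_zero⟩
  rw [hsum, e]
  simp [hg p q hp hq]

theorem hsum_congr {g g' : R → ℤ} {f : R}
    (h : ∀ p, Prime p → p ∣ f → g p = g' p) : hsum g f = hsum g' f := by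
  unfold hsum
  congr 1
  exact Multiset.map_congr rfl fun p hp => h p (UniqueFactorizationMonoid.prime_of_factor p hp)
    (UniqueFactorizationMonoid.dvd_of_mem_factors hp)

end hsum

section kappa

variable {k K : Type*} [Field k] [IsAlgClosed k] [Field K] [Algebra k K]
  [Algebra (Loc k) K] [IsFractionRing (Loc k) K]

variable (K) in
/-- The intersection number of the curve `p = 0` with the part of a function prime to `p`. -/
noncomputable def IK (p : Loc k) : K → ℤ := fext K (fun f => iL p (cof p f))

variable {p : Loc k}

theorem IK_hm (hp : Prime p) : ∀ a b : Loc k, a ≠ 0 → b ≠ 0 →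
    iL p (cof p (a * b)) = iL p (cof p a) + iL p (cof p b) := fun a b ha hb => by
  rw [(mult_mul hp ha hb).2, iL_mul_right (hp.isRelPrime_of_not_dvd (cof_spec hp ha).2)
    (hp.isRelPrime_of_not_dvd (cof_spec hp hb).2)]

theorem IK_isAddv (hp : Prime p) : IsAddv (IK K p) := fext_isAddv (IK_hm hp)

theorem IK_algebraMap (hp : Prime p) {a : Loc k} (ha : a ≠ 0) :
    IK K p (algebraMap _ K a) = iL p (cof p a) := fext_algebraMap (IK_hm hp) ha

theorem IK_of_not_dvd (hp : Prime p) {a : Loc k} (ha : ¬ p ∣ a) :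
    IK K p (algebraMap _ K a) = iL p a := by
  rw [IK_algebraMap hp (by rintro rfl; exact ha (dvd_zero _)), (mult_of_not_dvd hp ha).2]

theorem IK_self (hp : Prime p) : IK K p (algebraMap _ K p) = 0 := by
  rw [IK_algebraMap hp hp.ne_zero, (mult_unique (n := 1) (c := 1) hp (by simp)
    hp.not_dvd_one).2, iL_of_isUnit_right _ isUnit_one]

theorem IK_eq_of_associated (hp : Prime p) {p' : Loc k} (h : Associated p p') :
    IK K p = IK K p' := by
  have hp' : Prime p' := h.prime hp
  refine IsAddv.ext (Loc k) (IK_isAddv hp) (IK_isAddv hp') fun r hr => ?_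
  rw [IK_algebraMap hp hr, IK_algebraMap hp' hr]
  obtain ⟨h1, h2⟩ := cof_spec hp' hr
  obtain ⟨u, rfl⟩ := id h
  set n := multiplicity (p * u) r
  have := mult_unique (p := p) (f := r) (n := n) (c := (u : Loc k) ^ n * cof (p * u) r) hp
    (by conv_lhs => rw [h1]
        ring) (by
    intro h3
    rw [← Units.val_pow_eq_pow_val, Units.dvd_mul_left] at h3
    exact h2 (h.dvd_iff_dvd_left.1 h3))
  rw [this.2]
  refine iL_of_associated h ?_
  rw [← Units.val_pow_eq_pow_val]
  exact (associated_isUnit_mul_left_iff (Units.isUnit _)).2 (Associated.refl _)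

/-- The contribution of the prime `p` to the pairing. -/
noncomputable def wgt (t : (K → ℤ) → K) (p : Loc k) (b : K) : ℤ :=
  IK K p b - plc K p b * IK K p (t (plc K p))

theorem wgt_of_associated (t : (K → ℤ) → K) (b : K) (p p' : Loc k) (hp : Prime p)
    (h : Associated p p') : wgt t p b = wgt t p' b := by
  rw [wgt, wgt, IK_eq_of_associated hp h, plc_eq_of_associated hp h]

theorem wgt_isAddv (t : (K → ℤ) → K) (hp : Prime p) : IsAddv (wgt t p) := by
  have := (IK_isAddv (K := K) hp).add ((plc_isAddv (K := K) hp).smul (-IK K p (t (plc K p))))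
  convert this using 2
  rw [wgt]; ring

/-- The local pairing of two functions. -/
noncomputable def kap (t : (K → ℤ) → K) (a b : K) : ℤ :=
  fext K (hsum (fun p : Loc k => wgt t p b)) a

variable (k)

theorem kap_left (t : (K → ℤ) → K) (b : K) : IsAddv (fun a => kap (k := k) t a b) :=
  fext_isAddv (hsum_mul (wgt_of_associated t b))

theorem kap_right (t : (K → ℤ) → K) (a : K) : IsAddv (fun b => kap (k := k) t a b) := by
  have h0 : ∀ f : Loc k, hsum (fun p : Loc k => wgt t p 0) f = 0 := fun f => by
    rw [hsum, Multiset.sum_eq_zero]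
    intro z hz
    obtain ⟨p, hp, rfl⟩ := Multiset.mem_map.1 hz
    exact (wgt_isAddv t (UniqueFactorizationMonoid.prime_of_factor p hp)).zero
  have h1 : ∀ (f : Loc k) (b c : K), b ≠ 0 → c ≠ 0 → hsum (fun p : Loc k => wgt t p (b * c)) f =
      hsum (fun p : Loc k => wgt t p b) f + hsum (fun p : Loc k => wgt t p c) f := by
    intro f b c hb hc
    rw [hsum, hsum, hsum, ← Multiset.sum_map_add]
    congr 1
    refine Multiset.map_congr rfl fun p hp => ?_
    exact (wgt_isAddv t (UniqueFactorizationMonoid.prime_of_factor p hp)).mul b c hb hc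
  constructor
  · simp [kap, fext, h0]
  · intro b c hb hc
    simp only [kap, fext, h1 _ _ _ hb hc]
    split_ifs <;> ring

variable {k}

theorem kap_algebraMap (t : (K → ℤ) → K) {f : Loc k} (hf : f ≠ 0) (b : K) :
    kap (k := k) t (algebraMap _ K f) b = hsum (fun p : Loc k => wgt t p b) f :=
  fext_algebraMap (hsum_mul (wgt_of_associated t b)) hf

theorem hsum_map {g : Loc k → ℤ} (hg : ∀ p p', Prime p → Associated p p' → g p = g p')
    (e : Loc k ≃ₐ[k] Loc k) {f : Loc k} (hf : f ≠ 0) :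
    hsum g (e f) = hsum (fun p => g (e p)) f := by
  have hg' : ∀ p p', Prime p → Associated p p' → g (e p) = g (e p') := fun p p' hp h =>
    hg _ _ ((MulEquiv.prime_iff e).2 hp) (h.map e)
  induction f using UniqueFactorizationMonoid.induction_on_prime with
  | h₁ => exact absurd rfl hf
  | h₂ u hu => rw [hsum_of_isUnit _ hu, hsum_of_isUnit _ (hu.map e)]
  | h₃ a p ha hp ih =>
    have he : ∀ z, z ≠ 0 → e z ≠ 0 := fun z hz => (map_ne_zero_iff _ e.injective).2 hz
    rw [map_mul, hsum_mul hg _ _ (he p hp.ne_zero) (he a ha), hsum_mul hg' _ _ hp.ne_zero ha,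
      ih ha, hsum_prime hg ((MulEquiv.prime_iff e).2 hp), hsum_prime hg' hp]

section auto

variable (θ : K ≃ₐ[k] K) (e : Loc k ≃ₐ[k] Loc k)
  (h : ∀ z, θ (algebraMap (Loc k) K z) = algebraMap (Loc k) K (e z))
include h

theorem plc_auto (hp : Prime p) : (fun z => plc K (e p) (θ z)) = plc K p := by
  have hp' : Prime (e p) := (MulEquiv.prime_iff e).2 hp
  refine eq_plc hp ((plc_isAddv hp').comp θ) (fun f hf => ?_) ?_ ?_
  · rw [h, plc_of_not_dvd hp']
    rwa [map_dvd_iff]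
  · rw [h, plc_self hp']
  · exact ⟨algebraMap _ K p, by rw [h, plc_self hp']⟩

theorem IK_auto (hp : Prime p) (z : K) : IK K (e p) (θ z) = IK K p z := by
  have hp' : Prime (e p) := (MulEquiv.prime_iff e).2 hp
  refine congrFun (IsAddv.ext (Loc k) ((IK_isAddv hp').comp θ) (IK_isAddv hp) fun r hr => ?_) z
  rw [h, IK_algebraMap hp hr, IK_algebraMap hp' ((map_ne_zero_iff _ e.injective).2 hr)]
  obtain ⟨h1, h2⟩ := cof_spec hp hr
  have := mult_unique (p := e p) (f := e r) (n := multiplicity p r) (c := e (cof p r)) hp'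
    (by conv_lhs => rw [h1]
        rw [map_mul, map_pow]) (by rwa [map_dvd_iff])
  rw [this.2, iL_algEquiv]

theorem kap_auto (t : (K → ℤ) → K) (a b : K) :
    kap (k := k) (fun V => θ (t fun z => V (θ z))) (θ a) (θ b) = kap (k := k) t a b := by
  refine congrFun (IsAddv.ext (Loc k) ((kap_left k _ (θ b)).comp θ) (kap_left k t b)
    fun r hr => ?_) a
  rw [h, kap_algebraMap _ ((map_ne_zero_iff _ e.injective).2 hr), kap_algebraMap _ hr,
    hsum_map (wgt_of_associated _ _) e hr]
  refine hsum_congr fun p hp _ => ?_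
  rw [wgt, wgt, IK_auto θ e h hp, plc_auto θ e h hp, IK_auto θ e h hp]
  congr 2
  exact congrFun (plc_auto θ e h hp) b

end auto

theorem hsum_iL (S c : Loc k) (hS : S ≠ 0) (h : IsRelPrime S c) :
    hsum (fun p => iL p c) S = iL S c := by
  have hg : ∀ p p' : Loc k, Prime p → Associated p p' → iL p c = iL p' c := fun p p' _ h =>
    iL_of_associated h (Associated.refl _)
  induction S using UniqueFactorizationMonoid.induction_on_prime with
  | h₁ => exact absurd rfl hS
  | h₂ u hu => rw [hsum_of_isUnit _ hu, iL_of_isUnit_left _ hu]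
  | h₃ a p ha hp ih =>
    rw [hsum_mul hg _ _ hp.ne_zero ha, hsum_prime hg hp, iL_mul_left
      (IsRelPrime.of_mul_left_left h) (IsRelPrime.of_mul_left_right h),
      ih ha (IsRelPrime.of_mul_left_right h)]

theorem kap_eq_iL (t : (K → ℤ) → K) {S c : Loc k} (hS : S ≠ 0) (h : IsRelPrime S c) :
    kap (k := k) t (algebraMap _ K S) (algebraMap _ K c) = iL S c := by
  rw [kap_algebraMap _ hS, ← hsum_iL S c hS h]
  refine hsum_congr fun p hp hpS => ?_
  have : ¬ p ∣ c := fun hc => hp.not_isUnit (h hpS hc)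
  rw [wgt, plc_of_not_dvd hp this, IK_of_not_dvd hp this]; ring

theorem kap_isUnit (t : (K → ℤ) → K) {u : Loc k} (hu : IsUnit u) (b : K) :
    kap (k := k) t (algebraMap _ K u) b = 0 := by
  rw [kap_algebraMap _ hu.ne_zero, hsum_of_isUnit _ hu]

theorem kap_prime (t : (K → ℤ) → K) (hp : Prime p) (b : K) :
    kap (k := k) t (algebraMap _ K p) b = wgt t p b := by
  rw [kap_algebraMap _ hp.ne_zero, hsum_prime (wgt_of_associated t b) hp]

end kappa

section strict

variable {k K : Type*} [Field k] [IsAlgClosed k] [Field K] [Algebra k K] [Algebra (BiPoly k) K]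
  [IsScalarTower k (BiPoly k) K] [IsFractionRing (BiPoly k) K]
  [Algebra (Loc k) K] [IsFractionRing (Loc k) K] [IsScalarTower (BiPoly k) (Loc k) K]

/-- Transport of a choice of uniformizers by a coordinate change. -/
noncomputable def tw (t : (K → ℤ) → K) (φ : K ≃ₐ[k] K) (V : K → ℤ) : K :=
  φ.symm (t fun z => V (φ.symm z))

omit [IsAlgClosed k] [IsScalarTower (BiPoly k) (Loc k) K] [IsScalarTower k (BiPoly k) K] in
theorem plc_comp_eq {ψ : K ≃ₐ[k] K} {p : BiPoly k} (hp : Prime p) {q : Loc k} (hq : Prime q)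
    (h1 : 1 ≤ plc K q (ψ (algebraMap _ K p)))
    (h0 : ∀ f : BiPoly k, ¬ p ∣ f → plc K q (ψ (algebraMap _ K f)) = 0) :
    (fun z => plc K q (ψ z)) = plc K p :=
  eq_plc hp ((plc_isAddv hq).comp ψ) h0 h1
    ⟨ψ.symm (algebraMap _ K q), by simp [plc_self hq]⟩

/-- A choice of uniformizers for all the divisors of all the coordinate systems. -/
def IsUnif (k : Type*) {K : Type*} [Field k] [Field K] [Algebra k K] [Algebra (Loc k) K]
    [IsFractionRing (Loc k) K] (t : (K → ℤ) → K) : Prop :=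
  ∀ (φ : K ≃ₐ[k] K) (q : Loc k), Prime q → plc K q (tw t φ (plc K q)) = 1

omit [IsScalarTower (BiPoly k) (Loc k) K] [IsScalarTower k (BiPoly k) K] in
/-- The uniformizer pairs to zero with the strict transform of its curve. -/
theorem kap_tw_uniformizer (t : (K → ℤ) → K) (φ : K ≃ₐ[k] K) {p : BiPoly k} (hp : Prime p)
    {S : Loc k} (hS : S ≠ 0) {τ : K} (hτ : plc K p τ = 1)
    (ht : plc K p (t (plc K p)) = 1 → t (plc K p) = τ)
    (ht' : IsUnif k t)
    (h1 : ∀ q, Prime q → q ∣ S → 1 ≤ plc K q (φ.symm (algebraMap _ K p)))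
    (h0 : ∀ q, Prime q → q ∣ S → ∀ f : BiPoly k, ¬ p ∣ f →
      plc K q (φ.symm (algebraMap _ K f)) = 0) :
    kap (k := k) (tw t φ) (algebraMap _ K S) (φ.symm τ) = 0 := by
  rw [kap_algebraMap _ hS, hsum, Multiset.sum_eq_zero]
  intro z hz
  obtain ⟨q, hq, rfl⟩ := Multiset.mem_map.1 hz
  have hqS := UniqueFactorizationMonoid.dvd_of_mem_factors hq
  replace hq := UniqueFactorizationMonoid.prime_of_factor q hq
  have e := plc_comp_eq hp hq (h1 q hq hqS) (h0 q hq hqS)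
  have e1 := ht' φ q hq
  rw [tw, e] at e1
  have e2 : plc K q (φ.symm (t (plc K p))) = plc K p (t (plc K p)) := congrFun e _
  have e3 : plc K q (φ.symm τ) = plc K p τ := congrFun e _
  rw [wgt, tw, e, ht (e2 ▸ e1), e3, hτ]
  ring

end strict

section

variable {k K : Type*} [Field k] [IsAlgClosed k] [Field K] [Algebra k K] [Algebra (BiPoly k) K]
  [IsScalarTower k (BiPoly k) K] [IsFractionRing (BiPoly k) K]
  [Algebra (Loc k) K] [IsFractionRing (Loc k) K] [IsScalarTower (BiPoly k) (Loc k) K]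

local notation "ι" => algebraMap (BiPoly k) K

omit [IsAlgClosed k] [Algebra k K] [IsScalarTower k (BiPoly k) K] [IsFractionRing (Loc k) K]
  [IsFractionRing (BiPoly k) K] in
theorem algebraMap_toLoc (f : BiPoly k) : algebraMap (Loc k) K (toLoc k f) = ι f :=
  (IsScalarTower.algebraMap_apply (BiPoly k) (Loc k) K f).symm

omit [IsAlgClosed k] [Algebra k K] [IsScalarTower k (BiPoly k) K] in
theorem algebraMap_induction (P : K → Prop)
    (mul : ∀ a b, a ≠ 0 → b ≠ 0 → P a → P b → P (a * b))
    (inv : ∀ a, a ≠ 0 → P a → P a⁻¹) (h : ∀ f : BiPoly k, f ≠ 0 → P (ι f))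
    (a : K) (ha : a ≠ 0) : P a := by
  obtain ⟨f, g, hg, rfl⟩ := IsFractionRing.div_surjective (A := BiPoly k) a
  have hg0 : g ≠ 0 := nonZeroDivisors.ne_zero hg
  have hf0 : f ≠ 0 := by rintro rfl; simp at ha
  have hg' : ι g ≠ 0 := by simpa using hg0
  have hf' : ι f ≠ 0 := by simpa using hf0
  rw [div_eq_mul_inv]
  exact mul _ _ hf' (inv_ne_zero hg') (h f hf0) (inv _ hg' (h g hg0))

omit [IsAlgClosed k] [IsScalarTower k (BiPoly k) K] [Algebra k K] in
/-- Induction for bimultiplicative statements. -/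
theorem biadd_induction (P : K → K → Prop)
    (mul_left : ∀ a b c, a ≠ 0 → b ≠ 0 → c ≠ 0 → P a c → P b c → P (a * b) c)
    (inv_left : ∀ a c, a ≠ 0 → c ≠ 0 → P a c → P a⁻¹ c)
    (mul_right : ∀ a b c, a ≠ 0 → b ≠ 0 → c ≠ 0 → P a b → P a c → P a (b * c))
    (inv_right : ∀ a c, a ≠ 0 → c ≠ 0 → P a c → P a c⁻¹)
    (unit : ∀ (u : BiPoly k) b, IsUnit u → b ≠ 0 → P (ι u) b)
    (prime : ∀ p c : BiPoly k, Prime p → c ≠ 0 → ¬ p ∣ c → P (ι p) (ι c))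
    (unif : ∀ p : BiPoly k, Prime p → ∃ τ, plc K p τ = 1 ∧ P (ι p) τ)
    (a b : K) (ha : a ≠ 0) (hb : b ≠ 0) : P a b := by
  refine algebraMap_induction (k := k) (fun a => P a b)
    (fun a a' h h' => mul_left a a' b h h' hb) (fun a h => inv_left a b h hb) ?_ a ha
  intro f
  induction f using UniqueFactorizationMonoid.induction_on_prime with
  | h₁ => exact fun h => absurd rfl h
  | h₂ u hu => exact fun _ => unit u b hu hb
  | h₃ f p hf hp ih =>
    intro _
    have hp' : ι p ≠ 0 := by simpa using hp.ne_zero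
    rw [map_mul]
    refine mul_left _ _ _ hp' (by simpa using hf) hb ?_ (ih hf)
    obtain ⟨τ, hτ, hPτ⟩ := unif p hp
    have hτ0 : τ ≠ 0 := by rintro rfl; rw [(plc_isAddv hp).zero] at hτ; omega
    have hpow : ∀ n : ℕ, P (ι p) (τ ^ (n + 1)) := by
      intro n
      induction n with
      | zero => simpa using hPτ
      | succ n ih => rw [pow_succ]; exact mul_right _ _ _ hp' (pow_ne_zero _ hτ0) hτ0 ih hPτ
    have h0 : ∀ c : K, c ≠ 0 → plc K p c = 0 → P (ι p) c := by
      intro c hc hc0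
      obtain ⟨f, g, hg, rfl⟩ := IsFractionRing.div_surjective (A := BiPoly k) c
      have hg0 : g ≠ 0 := nonZeroDivisors.ne_zero hg
      have hf0 : f ≠ 0 := by rintro rfl; simp at hc
      have hg' : ι g ≠ 0 := by simpa using hg0
      have hf' : ι f ≠ 0 := by simpa using hf0
      obtain ⟨e1, e2⟩ := cof_spec hp hf0
      obtain ⟨e3, e4⟩ := cof_spec hp hg0
      have hn : multiplicity p f = multiplicity p g := by
        rw [(plc_isAddv hp).div hf' hg', plc_algebraMap hp hf0, plc_algebraMap hp hg0] at hc0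
        omega
      have hc1 : cof p f ≠ 0 := by intro h; rw [h] at e2; exact e2 (dvd_zero _)
      have hc2 : cof p g ≠ 0 := by intro h; rw [h] at e4; exact e4 (dvd_zero _)
      have hc1' : ι (cof p f) ≠ 0 := by simpa using hc1
      have hc2' : ι (cof p g) ≠ 0 := by simpa using hc2
      have : ι f / ι g = ι (cof p f) * (ι (cof p g))⁻¹ := by
        conv_lhs => rw [e1, e3, hn]
        rw [map_mul, map_mul, map_pow]
        field_simp
      rw [this]
      exact mul_right _ _ _ hp' hc1' (inv_ne_zero hc2') (prime _ _ hp hc1 e2)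
        (inv_right _ _ hp' hc2' (prime _ _ hp hc2 e4))
    have hone : P (ι p) 1 := h0 1 one_ne_zero (plc_isAddv hp).one
    have hz : ∀ n : ℤ, P (ι p) (τ ^ n) := by
      intro n
      have hpow' : ∀ n : ℕ, P (ι p) (τ ^ n) := by
        rintro (_ | n)
        · simpa using hone
        · exact hpow n
      obtain ⟨m, rfl | rfl⟩ := n.eq_nat_or_neg
      · rw [zpow_natCast]; exact hpow' m
      · rw [zpow_neg, zpow_natCast]; exact inv_right _ _ hp' (pow_ne_zero _ hτ0) (hpow' m)
    have hb' : b = τ ^ plc K p b * (b / τ ^ plc K p b) := by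
      rw [mul_div_cancel₀]
      exact zpow_ne_zero _ hτ0
    have hd : b / τ ^ plc K p b ≠ 0 := div_ne_zero hb (zpow_ne_zero _ hτ0)
    have hd0 : plc K p (b / τ ^ plc K p b) = 0 := by
      rw [(plc_isAddv hp).div hb (zpow_ne_zero _ hτ0), (plc_isAddv hp).zpow hτ0, hτ]; ring
    rw [hb']
    exact mul_right _ _ _ hp' (zpow_ne_zero _ hτ0) hd (hz _) (h0 _ hd hd0)

omit [IsAlgClosed k] in
theorem isRelPrime_map (e : BiPoly k ≃ₐ[k] BiPoly k) {f g : BiPoly k} (hfg : IsRelPrime f g) :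
    IsRelPrime (e f) (e g) := by
  intro d h1 h2
  obtain ⟨d, rfl⟩ := e.surjective d
  rw [map_dvd_iff] at h1 h2
  exact (hfg h1 h2).map e

variable (t : (K → ℤ) → K)

section affine

omit [IsAlgClosed k] [IsFractionRing (BiPoly k) K] [IsFractionRing (Loc k) K] [IsScalarTower k (BiPoly k) K] in
theorem affine_symm_eq (φ : K ≃ₐ[k] K) (e : BiPoly k ≃ₐ[k] BiPoly k)
    (h : ∀ f, φ.symm (ι f) = ι (e f)) (f : BiPoly k) :
    φ.symm (ι f) = algebraMap (Loc k) K (toLoc k (e f)) := by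
  rw [h, algebraMap_toLoc]

theorem affine_kap_unif (φ : K ≃ₐ[k] K) (e : BiPoly k ≃ₐ[k] BiPoly k)
    (h : ∀ f, φ.symm (ι f) = ι (e f))
    (ht : IsUnif k t) {p : BiPoly k} (hp : Prime p) {τ : K}
    (hτ : plc K p τ = 1) (hτ' : plc K p (t (plc K p)) = 1 → t (plc K p) = τ) :
    kap (k := k) (tw t φ) (φ.symm (ι p)) (φ.symm τ) = 0 := by
  have hS : toLoc k (e p) ≠ 0 := by
    rw [Ne, map_eq_zero_iff _ toLoc_injective, map_eq_zero_iff _ e.injective]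
    exact hp.ne_zero
  rw [affine_symm_eq φ e h]
  refine kap_tw_uniformizer t φ hp hS hτ hτ' ht ?_ ?_
  · intro q hq hqS
    rw [affine_symm_eq φ e h]
    exact plc_pos_of_dvd hq hS hqS
  · intro q hq hqS f hf
    rw [affine_symm_eq φ e h]
    refine plc_of_not_dvd hq fun hqf => hq.not_isUnit ?_
    exact isRelPrime_toLoc (isRelPrime_map e (hp.isRelPrime_of_not_dvd hf)) hqS hqf

theorem affine_kap_prime (φ : K ≃ₐ[k] K) (e : BiPoly k ≃ₐ[k] BiPoly k)
    (h : ∀ f, φ.symm (ι f) = ι (e f))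
    {p c : BiPoly k} (hp : p ≠ 0) (hpc : IsRelPrime p c) :
    kap (k := k) (tw t φ) (φ.symm (ι p)) (φ.symm (ι c)) = iL (toLoc k (e p)) (toLoc k (e c)) := by
  have hS : toLoc k (e p) ≠ 0 := by
    rw [Ne, map_eq_zero_iff _ toLoc_injective, map_eq_zero_iff _ e.injective]
    exact hp
  rw [affine_symm_eq φ e h, affine_symm_eq φ e h, kap_eq_iL _ hS]
  exact isRelPrime_toLoc (isRelPrime_map e hpc)

theorem affine_kap_unit (φ : K ≃ₐ[k] K) (e : BiPoly k ≃ₐ[k] BiPoly k)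
    (h : ∀ f, φ.symm (ι f) = ι (e f))
    {u : BiPoly k} (hu : IsUnit u) (b : K) :
    kap (k := k) (tw t φ) (φ.symm (ι u)) (φ.symm b) = 0 := by
  rw [affine_symm_eq φ e h, kap_isUnit _ ((hu.map e).map (toLoc k))]

end affine

end

section

theorem HasSum.congr' {α : Type*} {f g : α → ℤ} {a b : ℤ} (h : HasSum f a)
    (hfg : ∀ i, g i = f i) (hab : b = a := by ring) : HasSum g b := by
  rw [funext hfg, hab]; exact h

variable {k K : Type*} [Field k] [IsAlgClosed k] [Field K] [Algebra k K] [Algebra (BiPoly k) K]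
  [IsScalarTower k (BiPoly k) K] [IsFractionRing (BiPoly k) K]
  [Algebra (Loc k) K] [IsFractionRing (Loc k) K] [IsScalarTower (BiPoly k) (Loc k) K]

local notation "ι" => algebraMap (BiPoly k) K

theorem IsAddv.hasSum_div {α : Type*} {V : α → K → ℤ} (hV : ∀ a, IsAddv (V a)) {W : K → ℤ}
    (hW : IsAddv W) (h : ∀ f : BiPoly k, f ≠ 0 → HasSum (fun a => V a (ι f)) (W (ι f))) (z : K) :
    HasSum (fun a => V a z) (W z) := by
  by_cases hz : z = 0
  · subst hz
    simp only [(hV _).zero, hW.zero]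
    exact hasSum_zero
  obtain ⟨f, g, hg, rfl⟩ := IsFractionRing.div_surjective (A := BiPoly k) z
  have hg0 : g ≠ 0 := nonZeroDivisors.ne_zero hg
  have hf0 : f ≠ 0 := by rintro rfl; simp at hz
  have hg' : ι g ≠ 0 := by simpa using hg0
  have hf' : ι f ≠ 0 := by simpa using hf0
  simp only [(hV _).div hf' hg', hW.div hf' hg']
  exact (h f hf0).sub (h g hg0)

theorem prime_toLoc_x : Prime (toLoc k x) := prime_toLoc prime_x (by simp)

namespace ChartFamily

variable {J : Type*} (F : ChartFamily k K J)

/-- The order along the divisor, as a function on the field. -/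
noncomputable def vK : K → ℤ := fext K F.v

section

variable [Nonempty J]

theorem vK_isAddv : IsAddv F.vK := fext_isAddv (fun _ _ ha hb => F.v_mul ha hb)

theorem vK_algebraMap {f : BiPoly k} (hf : f ≠ 0) : F.vK (ι f) = F.v f :=
  fext_algebraMap (fun _ _ ha hb => F.v_mul ha hb) hf

theorem toLoc_σ_not_dvd (j : J) {f : BiPoly k} (hf : f ≠ 0) : ¬ toLoc k x ∣ toLoc k (F.σ j f) :=
  fun h => prime_toLoc_x.not_isUnit (((F.hasSum_x hf).2 j) h dvd_rfl)

theorem toLoc_σ_ne_zero (j : J) {f : BiPoly k} (hf : f ≠ 0) : toLoc k (F.σ j f) ≠ 0 := by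
  rw [Ne, map_eq_zero_iff _ toLoc_injective]; exact F.σ_ne_zero j hf

theorem eq_toLoc (j : J) {f : BiPoly k} (hf : f ≠ 0) : (F.φ j).symm (ι f) =
    ι x ^ F.v f * algebraMap (Loc k) K (toLoc k (F.σ j f)) := by
  rw [F.eq j f hf, algebraMap_toLoc]

theorem map_toLoc_σ_ne_zero (j : J) {f : BiPoly k} (hf : f ≠ 0) :
    algebraMap (Loc k) K (toLoc k (F.σ j f)) ≠ 0 := by
  rw [Ne, map_eq_zero_iff _ (IsFractionRing.injective (Loc k) K)]
  exact F.toLoc_σ_ne_zero j hf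

theorem _root_.IsAddv.chart {V : K → ℤ} (hV : IsAddv V) (j : J) {f : BiPoly k} (hf : f ≠ 0) :
    V ((F.φ j).symm (ι f)) =
      F.v f * V (ι x) + V (algebraMap (Loc k) K (toLoc k (F.σ j f))) := by
  rw [F.eq_toLoc j hf, hV.mul _ _ (zpow_ne_zero _ algebraMap_x_ne_zero)
    (F.map_toLoc_σ_ne_zero j hf), hV.zpow algebraMap_x_ne_zero]

theorem plc_x (j : J) : (fun z => plc K (toLoc k x) ((F.φ j).symm z)) = F.vK := by
  refine IsAddv.ext (BiPoly k) ((plc_isAddv prime_toLoc_x).comp _) F.vK_isAddv fun f hf => ?_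
  rw [(plc_isAddv prime_toLoc_x).chart F j hf, F.vK_algebraMap hf,
    plc_of_not_dvd prime_toLoc_x (F.toLoc_σ_not_dvd j hf), ← algebraMap_toLoc,
    plc_self prime_toLoc_x]
  ring

theorem hasSum_IK (z : K) :
    HasSum (fun j => IK K (toLoc k x) ((F.φ j).symm z)) (F.ε * F.vK z) := by
  refine IsAddv.hasSum_div (k := k) (fun j => (IK_isAddv prime_toLoc_x).comp (F.φ j).symm)
    (F.vK_isAddv.smul F.ε) (fun f hf => ?_) z
  rw [F.vK_algebraMap hf]
  refine HasSum.congr' ((F.hasSum_x hf).1) (fun j => ?_)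
  rw [(IK_isAddv prime_toLoc_x).chart F j hf, ← algebraMap_toLoc, IK_self prime_toLoc_x,
    IK_of_not_dvd prime_toLoc_x (F.toLoc_σ_not_dvd j hf), iL_comm]
  ring

variable (t : (K → ℤ) → K)

theorem wgt_x (j : J) (z : K) : wgt (tw t (F.φ j)) (toLoc k x) z =
    IK K (toLoc k x) z -
      plc K (toLoc k x) z * IK K (toLoc k x) ((F.φ j).symm (t F.vK)) := by
  rw [wgt, tw, plc_x]

theorem vK_unif (ht : IsUnif k t) : F.vK (t F.vK) = 1 := by
  have j : J := Classical.arbitrary J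
  have := ht (F.φ j) _ prime_toLoc_x
  rw [tw, plc_x] at this
  exact (congrFun (F.plc_x j) _).symm.trans this

theorem hasSum_kap_x_left (ht : IsUnif k t) (z : K) :
    HasSum (fun j => kap (k := k) (tw t (F.φ j)) (ι x) ((F.φ j).symm z)) 0 := by
  have h := (F.hasSum_IK z).sub ((F.hasSum_IK (t F.vK)).mul_left (F.vK z))
  rw [F.vK_unif t ht] at h
  refine HasSum.congr' (h) (fun j => ?_)
  · rw [← algebraMap_toLoc, kap_prime _ prime_toLoc_x, wgt_x]
    congr 2
    exact congrFun (F.plc_x j) z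

theorem hasSum_kap_x_x (ht : IsUnif k t) :
    HasSum (fun j => kap (k := k) (tw t (F.φ j)) (ι x) (ι x)) (-F.ε) := by
  have h := (F.hasSum_IK (t F.vK)).neg
  rw [F.vK_unif t ht, mul_one] at h
  refine HasSum.congr' (h) (fun j => ?_)
  rw [← algebraMap_toLoc, kap_prime _ prime_toLoc_x, wgt_x, IK_self prime_toLoc_x,
    plc_self prime_toLoc_x]
  ring

theorem kap_σ_x (j : J) {f : BiPoly k} (hf : f ≠ 0) :
    kap (k := k) (tw t (F.φ j)) (algebraMap (Loc k) K (toLoc k (F.σ j f))) (ι x) =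
      iL (toLoc k (F.σ j f)) (toLoc k x) := by
  rw [← algebraMap_toLoc, kap_eq_iL _ (F.toLoc_σ_ne_zero j hf) ((F.hasSum_x hf).2 j)]

theorem hasSum_kap_x_right (ht : IsUnif k t) (z : K) :
    HasSum (fun j => kap (k := k) (tw t (F.φ j)) ((F.φ j).symm z) (ι x)) 0 := by
  have h0 : IsAddv (fun _ : K => (0 : ℤ)) := ⟨rfl, fun _ _ _ _ => rfl⟩
  refine IsAddv.hasSum_div (k := k) (fun j => (kap_left k (tw t (F.φ j)) (ι x)).comp (F.φ j).symm)
    h0 (fun f hf => ?_) z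
  refine HasSum.congr' (((F.hasSum_kap_x_x t ht).mul_left (F.v f)).add (F.hasSum_x hf).1) (fun j => ?_)
  · rw [(kap_left k (tw t (F.φ j)) (ι x)).chart F j hf, kap_σ_x _ _ _ hf]

/-- The total intersection number of coprime functions in the charts. -/
theorem hasSum_kap_coprime (ht : IsUnif k t) {p c : BiPoly k} (hp : p ≠ 0) (hc : c ≠ 0) {N : ℤ}
    (h : HasSum (fun j => iL (toLoc k (F.σ j p)) (toLoc k (F.σ j c)))
      (N - F.ε * F.v p * F.v c))
    (h' : ∀ j, IsRelPrime (toLoc k (F.σ j p)) (toLoc k (F.σ j c))) :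
    HasSum (fun j => kap (k := k) (tw t (F.φ j)) ((F.φ j).symm (ι p)) ((F.φ j).symm (ι c))) N := by
  refine HasSum.congr' ((((F.hasSum_kap_x_left t ht (ι c)).mul_left (F.v p)).add
    (((F.hasSum_x hp).1.mul_left (F.v c)).add h))) (fun j => ?_)
  · rw [(kap_left k (tw t (F.φ j)) ((F.φ j).symm (ι c))).chart F j hp]
    congr 1
    rw [(kap_right k (tw t (F.φ j)) _).chart F j hc, kap_σ_x _ _ _ hp,
      kap_eq_iL _ (F.toLoc_σ_ne_zero j hp) (h' j)]

theorem hasSum_kap_unif (ht : IsUnif k t) {p : BiPoly k} (hp : Prime p) {τ : K}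
    (hτ : plc K p τ = 1) (hτ' : plc K p (t (plc K p)) = 1 → t (plc K p) = τ)
    (h' : ∀ j c, ¬ p ∣ c → IsRelPrime (toLoc k (F.σ j p)) (toLoc k (F.σ j c))) :
    HasSum (fun j => kap (k := k) (tw t (F.φ j)) ((F.φ j).symm (ι p)) ((F.φ j).symm τ)) 0 := by
  refine HasSum.congr' ((F.hasSum_kap_x_left t ht τ).mul_left (F.v p)) (fun j => ?_)
  · rw [(kap_left k (tw t (F.φ j)) ((F.φ j).symm τ)).chart F j hp.ne_zero, add_eq_left]
    have hx : ∀ q : Loc k, Prime q → q ∣ toLoc k (F.σ j p) → plc K q (ι x) = 0 := by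
      intro q hq hqS
      rw [← algebraMap_toLoc]
      exact plc_of_not_dvd hq fun hqx => hq.not_isUnit ((F.hasSum_x hp.ne_zero).2 j hqS hqx)
    refine kap_tw_uniformizer t (F.φ j) hp (F.toLoc_σ_ne_zero j hp.ne_zero) hτ hτ' ht ?_ ?_
    · intro q hq hqS
      rw [(plc_isAddv hq).chart F j hp.ne_zero, hx q hq hqS]
      have := plc_pos_of_dvd (K := K) hq (F.toLoc_σ_ne_zero j hp.ne_zero) hqS
      omega
    · intro q hq hqS f hf
      have hf0 : f ≠ 0 := by rintro rfl; exact hf (dvd_zero _)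
      rw [(plc_isAddv hq).chart F j hf0, hx q hq hqS, plc_of_not_dvd hq
        fun hqf => hq.not_isUnit (h' j f hf hqS hqf)]
      ring

theorem kap_unit (j : J) {u : BiPoly k} (hu : IsUnit u) (b : K) :
    kap (k := k) (tw t (F.φ j)) ((F.φ j).symm (ι u)) b = 0 := by
  obtain ⟨c, hc, rfl⟩ : ∃ c : k, c ≠ 0 ∧ algebraMap k (BiPoly k) c = u := by
    obtain ⟨c, hc, rfl⟩ := Polynomial.isUnit_iff.1 hu
    obtain ⟨d, hd, rfl⟩ := Polynomial.isUnit_iff.1 hc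
    exact ⟨d, hd.ne_zero, rfl⟩
  rw [← IsScalarTower.algebraMap_apply, AlgEquiv.commutes,
    IsScalarTower.algebraMap_apply k (BiPoly k) K, ← algebraMap_toLoc, kap_isUnit]
  rw [isUnit_toLoc, ev0_algebraMap]
  exact hc

/-- Comparison of a family of pairings with the pairings in the charts. -/
theorem exists_hasSum_kap (ht : IsUnif k t) {I : Type*} (κ : I → K → K → ℤ)
    (hl : ∀ i b, IsAddv (fun a => κ i a b)) (hr : ∀ i a, IsAddv (fun b => κ i a b)) (c : ℤ)
    (unit : ∀ i (u : BiPoly k) b, IsUnit u → κ i (ι u) b = 0)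
    (prime : ∀ p f : BiPoly k, Prime p → f ≠ 0 → ¬ p ∣ f →
      (∃ S, HasSum (fun i => κ i (ι p) (ι f)) S ∧
        HasSum (fun j => iL (toLoc k (F.σ j p)) (toLoc k (F.σ j f)))
          (c * S - F.ε * F.v p * F.v f)) ∧
      ∀ j, IsRelPrime (toLoc k (F.σ j p)) (toLoc k (F.σ j f)))
    (unif : ∀ i (p : BiPoly k) τ, Prime p → plc K p τ = 1 →
      (plc K p (t (plc K p)) = 1 → t (plc K p) = τ) → κ i (ι p) τ = 0)
    {a b : K} (ha : a ≠ 0) (hb : b ≠ 0) :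
    ∃ S, HasSum (fun i => κ i a b) S ∧
      HasSum (fun j => kap (k := k) (tw t (F.φ j)) ((F.φ j).symm a) ((F.φ j).symm b)) (c * S) := by
  have hl' := fun j b => (kap_left k (tw t (F.φ j)) ((F.φ j).symm b)).comp (F.φ j).symm
  have hr' := fun j a => (kap_right k (tw t (F.φ j)) ((F.φ j).symm a)).comp (F.φ j).symm
  refine biadd_induction (k := k) (fun a b => ∃ S, HasSum (fun i => κ i a b) S ∧
      HasSum (fun j => kap (k := k) (tw t (F.φ j)) ((F.φ j).symm a) ((F.φ j).symm b)) (c * S))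
    ?_ ?_ ?_ ?_ ?_ ?_ ?_ a b ha hb
  · rintro a b d ha hb hd ⟨S, h1, h2⟩ ⟨S', h3, h4⟩
    refine ⟨S + S', ?_, ?_⟩
    · refine HasSum.congr' (h1.add h3) (fun i => ?_)
      exact (hl i d).mul a b ha hb
    · refine HasSum.congr' (h2.add h4) (fun j => ?_)
      · exact (hl' j d).mul a b ha hb
  · rintro a d ha hd ⟨S, h1, h2⟩
    refine ⟨-S, ?_, ?_⟩
    · refine HasSum.congr' (h1.neg) (fun i => ?_)
      exact (hl i d).inv a
    · refine HasSum.congr' (h2.neg) (fun j => ?_)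
      · exact (hl' j d).inv a
  · rintro d a b hd ha hb ⟨S, h1, h2⟩ ⟨S', h3, h4⟩
    refine ⟨S + S', ?_, ?_⟩
    · refine HasSum.congr' (h1.add h3) (fun i => ?_)
      exact (hr i d).mul a b ha hb
    · refine HasSum.congr' (h2.add h4) (fun j => ?_)
      · exact (hr' j d).mul a b ha hb
  · rintro d a hd ha ⟨S, h1, h2⟩
    refine ⟨-S, ?_, ?_⟩
    · refine HasSum.congr' (h1.neg) (fun i => ?_)
      exact (hr i d).inv a
    · refine HasSum.congr' (h2.neg) (fun j => ?_)
      · exact (hr' j d).inv a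
  · intro u b hu hb
    refine ⟨0, ?_, ?_⟩
    · simp only [unit _ u b hu]; exact hasSum_zero
    · simp only [F.kap_unit t _ hu, mul_zero]; exact hasSum_zero
  · intro p f hp hf hpf
    obtain ⟨⟨S, h1, h2⟩, h3⟩ := prime p f hp hf hpf
    exact ⟨S, h1, F.hasSum_kap_coprime t ht hp.ne_zero hf h2 h3⟩
  · intro p hp
    obtain ⟨τ, hτ, hτ'⟩ : ∃ τ, plc K p τ = 1 ∧ (plc K p (t (plc K p)) = 1 → t (plc K p) = τ) := by
      by_cases h : plc K p (t (plc K p)) = 1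
      · exact ⟨_, h, fun _ => rfl⟩
      · exact ⟨ι p, plc_self hp, fun h' => absurd h' h⟩
    refine ⟨τ, hτ, 0, ?_, ?_⟩
    · simp only [unif _ p τ hp hτ hτ']; exact hasSum_zero
    · rw [mul_zero]
      exact F.hasSum_kap_unif t ht hp hτ hτ' fun j f hf =>
        (prime p f hp (by rintro rfl; exact hf (dvd_zero _)) hf).2 j

/-- The effect of twisting by powers of the equation of the divisor. -/
theorem hasSum_kap_twist (ht : IsUnif k t) {a b : K} (ha : a ≠ 0) (hb : b ≠ 0) {N : ℤ}
    (h : HasSum (fun j => kap (k := k) (tw t (F.φ j)) ((F.φ j).symm a) ((F.φ j).symm b)) N)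
    (m n : ℤ) :
    HasSum (fun j => kap (k := k) (tw t (F.φ j)) (ι x ^ m * (F.φ j).symm a)
      (ι x ^ n * (F.φ j).symm b)) (N - F.ε * m * n) := by
  have ha' : ∀ j, (F.φ j).symm a ≠ 0 := fun j => (_root_.map_ne_zero _).2 ha
  have hb' : ∀ j, (F.φ j).symm b ≠ 0 := fun j => (_root_.map_ne_zero _).2 hb
  have hx : ι x ≠ 0 := algebraMap_x_ne_zero
  refine HasSum.congr' (((((F.hasSum_kap_x_x t ht).mul_left (m * n)).add
    ((F.hasSum_kap_x_left t ht b).mul_left m)).add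
    ((F.hasSum_kap_x_right t ht a).mul_left n)).add h) (fun j => ?_)
  · rw [(kap_left k (tw t (F.φ j)) _).mul _ _ (zpow_ne_zero _ hx) (ha' j),
      (kap_left k (tw t (F.φ j)) _).zpow hx,
      (kap_right k (tw t (F.φ j)) _).mul _ _ (zpow_ne_zero _ hx) (hb' j),
      (kap_right k (tw t (F.φ j)) _).zpow hx,
      (kap_right k (tw t (F.φ j)) _).mul _ _ (zpow_ne_zero _ hx) (hb' j),
      (kap_right k (tw t (F.φ j)) _).zpow hx]
    ring

end

end ChartFamily

variable (t : (K → ℤ) → K)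

theorem tw_tw (φ ψ : K ≃ₐ[k] K) : tw (tw t ψ) φ = tw t (φ.trans ψ) := rfl

theorem IsUnif.tw {t : (K → ℤ) → K} (ht : IsUnif k t) (ψ : K ≃ₐ[k] K) : IsUnif k (tw t ψ) := by
  intro φ q hq
  rw [tw_tw]
  exact ht _ q hq

/-- Invariance of the pairing under blow-ups. -/
theorem blowFam_hasSum_kap (ht : IsUnif k t) {a b : K} (ha : a ≠ 0) (hb : b ≠ 0) :
    HasSum (fun j => kap (k := k) (tw t ((blowFam k K).φ j)) (((blowFam k K).φ j).symm a)
      (((blowFam k K).φ j).symm b)) (kap (k := k) t a b) := by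
  have hs : ∀ f : Unit → ℤ, HasSum f (f ()) := fun f => hasSum_unique f
  obtain ⟨S, h1, h2⟩ := (blowFam k K).exists_hasSum_kap t ht (fun _ : Unit => kap (k := k) t)
    (fun _ b => kap_left k t b) (fun _ a => kap_right k t a) 1
    (fun _ u b hu => affine_kap_unit t AlgEquiv.refl AlgEquiv.refl (fun f => rfl) hu b)
    (fun p f hp hf hpf => by
      have hr := hp.isRelPrime_of_not_dvd hpf
      obtain ⟨h1, h2⟩ := blowFam_hasSum (K := K) hp.ne_zero hf hr
      refine ⟨⟨_, hs _, ?_⟩, h2⟩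
      have := affine_kap_prime (K := K) t AlgEquiv.refl AlgEquiv.refl (fun f => rfl) hp.ne_zero hr
      change kap t (ι p) (ι f) = iL (toLoc k p) (toLoc k f) at this
      refine h1.congr' (fun _ => rfl) ?_
      rw [this, blowFam_ε]; ring)
    (fun _ p τ hp hτ hτ' =>
      affine_kap_unif t AlgEquiv.refl AlgEquiv.refl (fun f => rfl) ht hp hτ hτ') ha hb
  rw [h1.unique (hs _), one_mul] at h2
  exact h2

/-- The pairings in the affine plane and in the charts at infinity. -/
theorem infFam_hasSum_kap (ht : IsUnif k t) {a b : K} (ha : a ≠ 0) (hb : b ≠ 0) :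
    ∃ S, HasSum (fun q : k × k => kap (k := k) (tw t (planeAut (K := K) (tr q.1 q.2)).symm)
        (planeAut (K := K) (tr q.1 q.2) a) (planeAut (K := K) (tr q.1 q.2) b)) S ∧
      HasSum (fun j => kap (k := k) (tw t ((infFam k K).φ j)) (((infFam k K).φ j).symm a)
        (((infFam k K).φ j).symm b)) (-S) := by
  have hA : ∀ (q : k × k) f, (planeAut (K := K) (tr q.1 q.2)).symm.symm (ι f) =
    ι (tr q.1 q.2 f) := fun q f => planeAut_algebraMap _ _
  obtain ⟨S, h1, h2⟩ := (infFam k K).exists_hasSum_kap t ht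
    (fun q : k × k => fun a b => kap (k := k) (tw t (planeAut (K := K) (tr q.1 q.2)).symm)
        (planeAut (K := K) (tr q.1 q.2) a) (planeAut (K := K) (tr q.1 q.2) b))
    (fun q b => (kap_left k _ _).comp _) (fun q a => (kap_right k _ _).comp _) (-1)
    (fun q u b hu => affine_kap_unit t _ _ (hA q) hu b)
    (fun p f hp hf hpf => by
      have hr := hp.isRelPrime_of_not_dvd hpf
      obtain ⟨⟨S, h1, h1'⟩, h2, h3⟩ := infFam_hasSum (K := K) hp.ne_zero hf hr
      refine ⟨⟨S, ?_, ?_⟩, h2⟩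
      · refine HasSum.congr' (h1) (fun q => ?_)
        exact affine_kap_prime (K := K) t _ _ (hA q) hp.ne_zero hr
      · convert h1' using 1
        rw [infFam_ε]; ring)
    (fun q p τ hp hτ hτ' => affine_kap_unif t _ _ (hA q) ht hp hτ hτ') ha hb
  refine ⟨S, h1, ?_⟩
  rwa [neg_one_mul] at h2

end

section derivations

variable {k K : Type*} [Field k] [Field K] [Algebra k K] [Algebra (BiPoly k) K]
  [IsScalarTower k (BiPoly k) K] [IsFractionRing (BiPoly k) K]

local notation "ι" => algebraMap (BiPoly k) K

theorem dualNumber_hom_ext {f g : K →ₐ[k] DualNumber K} (hx : f (ι x) = g (ι x))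
    (hy : f (ι y) = g (ι y)) : f = g := by
  have h : f.comp (IsScalarTower.toAlgHom k (BiPoly k) K) =
      g.comp (IsScalarTower.toAlgHom k (BiPoly k) K) := bhom_ext hx hy
  exact IsLocalization.algHom_ext (nonZeroDivisors (BiPoly k)) (AlgHom.ext fun z =>
    DFunLike.congr_fun h z)

/-- The homomorphism to the dual numbers attached to a derivation. -/
noncomputable def derHom (D : Derivation k K K) : K →ₐ[k] DualNumber K where
  toFun z := TrivSqZeroExt.inl z + TrivSqZeroExt.inr (D z)
  map_one' := by simp
  map_mul' a b := by ext <;> simp [mul_comm]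
  map_zero' := by simp
  map_add' a b := by ext <;> simp
  commutes' c := by ext <;> simp [TrivSqZeroExt.algebraMap_eq_inl']

theorem derivation_ext {D D' : Derivation k K K} (hx : D (ι x) = D' (ι x))
    (hy : D (ι y) = D' (ι y)) : D = D' := by
  have : derHom D = derHom D' := dualNumber_hom_ext (by simp [derHom, hx]) (by simp [derHom, hy])
  ext z
  simpa [derHom] using congrArg TrivSqZeroExt.snd (DFunLike.congr_fun this z)

theorem exists_derivation (a b : K) : ∃ D : Derivation k K K, D (ι x) = a ∧ D (ι y) = b := by
  set g : BiPoly k →ₐ[k] DualNumber K := bsub (TrivSqZeroExt.inl (ι x) + TrivSqZeroExt.inr a)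
    (TrivSqZeroExt.inl (ι y) + TrivSqZeroExt.inr b)
  have hg : ∀ f, TrivSqZeroExt.fst (g f) = ι f := by
    intro f
    have : (TrivSqZeroExt.fstHom k K K).comp g = IsScalarTower.toAlgHom k (BiPoly k) K :=
      bhom_ext (by simp [g]) (by simp [g])
    exact DFunLike.congr_fun this f
  have hu : ∀ f : nonZeroDivisors (BiPoly k), IsUnit (g f) := by
    intro f
    rw [TrivSqZeroExt.isUnit_iff_isUnit_fst, hg, isUnit_iff_ne_zero]
    simp
  set e : K →ₐ[k] DualNumber K := IsLocalization.liftAlgHom (M := nonZeroDivisors (BiPoly k)) hu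
  have he : ∀ f, e (ι f) = g f := fun f => by simp [e]
  have hf : ∀ z, TrivSqZeroExt.fst (e z) = z := by
    intro z
    have : (TrivSqZeroExt.fstHom k K K).comp e = AlgHom.id k K :=
      khom_ext (by simp [he, hg]) (by simp [he, hg])
    exact DFunLike.congr_fun this z
  refine ⟨Derivation.mk' ((TrivSqZeroExt.sndHom K K).restrictScalars k ∘ₗ e.toLinearMap) ?_, ?_, ?_⟩
  · intro a b
    simp [hf]; ring
  · simp [he, g]
  · simp [he, g]

/-- The partial derivative with respect to `x`. -/
noncomputable def Dx (k K : Type*) [Field k] [Field K] [Algebra k K] [Algebra (BiPoly k) K]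
    [IsScalarTower k (BiPoly k) K] [IsFractionRing (BiPoly k) K] : Derivation k K K :=
  (exists_derivation (k := k) (K := K) 1 0).choose

/-- The partial derivative with respect to `y`. -/
noncomputable def Dy (k K : Type*) [Field k] [Field K] [Algebra k K] [Algebra (BiPoly k) K]
    [IsScalarTower k (BiPoly k) K] [IsFractionRing (BiPoly k) K] : Derivation k K K :=
  (exists_derivation (k := k) (K := K) 0 1).choose

@[simp] theorem Dx_x : Dx k K (ι x) = 1 := (exists_derivation (k := k) (K := K) 1 0).choose_spec.1
@[simp] theorem Dx_y : Dx k K (ι y) = 0 := (exists_derivation (k := k) (K := K) 1 0).choose_spec.2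
@[simp] theorem Dy_x : Dy k K (ι x) = 0 := (exists_derivation (k := k) (K := K) 0 1).choose_spec.1
@[simp] theorem Dy_y : Dy k K (ι y) = 1 := (exists_derivation (k := k) (K := K) 0 1).choose_spec.2

theorem derivation_eq (D : Derivation k K K) (z : K) :
    D z = D (ι x) * Dx k K z + D (ι y) * Dy k K z := by
  have : D = D (ι x) • Dx k K + D (ι y) • Dy k K := derivation_ext (by simp) (by simp)
  exact DFunLike.congr_fun this z

/-- Conjugation of a derivation by an automorphism. -/
noncomputable def conjDer (D : Derivation k K K) (θ : K ≃ₐ[k] K) : Derivation k K K :=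
  Derivation.mk' (θ.symm.toLinearMap ∘ₗ (D : K →ₗ[k] K) ∘ₗ θ.toLinearMap) (by
    intro a b
    simp)

@[simp] theorem conjDer_apply (D : Derivation k K K) (θ : K ≃ₐ[k] K) (z : K) :
    conjDer D θ z = θ.symm (D (θ z)) := rfl

theorem chain_rule (D : Derivation k K K) (θ : K ≃ₐ[k] K) (z : K) :
    D (θ z) = D (θ (ι x)) * θ (Dx k K z) + D (θ (ι y)) * θ (Dy k K z) := by
  have := congrArg θ (derivation_eq (conjDer D θ) z)
  simpa using this

variable (k) in
/-- The Jacobian determinant of two functions. -/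
noncomputable def jac (z w : K) : K := Dx k K z * Dy k K w - Dy k K z * Dx k K w

theorem jac_auto (θ : K ≃ₐ[k] K) (z w : K) :
    jac k (θ z) (θ w) = jac k (θ (ι x)) (θ (ι y)) * θ (jac k z w) := by
  simp only [jac, chain_rule (Dx k K) θ z, chain_rule (Dx k K) θ w, chain_rule (Dy k K) θ z,
    chain_rule (Dy k K) θ w, map_sub, map_mul]
  ring

theorem Dx_mem (f : BiPoly k) : ∃ g : BiPoly k, Dx k K (ι f) = ι g := by
  induction f using bipoly_induction with
  | add f g hf hg =>
    obtain ⟨f', hf⟩ := hf; obtain ⟨g', hg⟩ := hg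
    exact ⟨f' + g', by simp [hf, hg]⟩
  | mon n m r =>
    refine ⟨algebraMap k _ r * y ^ m * ((n : BiPoly k) * x ^ (n - 1)), ?_⟩
    rw [monomial_monomial_eq]
    simp only [map_mul, map_pow, Derivation.leibniz, Derivation.leibniz_pow, Dx_x, Dx_y,
      ← IsScalarTower.algebraMap_apply, Derivation.map_algebraMap]
    simp

theorem Dy_mem (f : BiPoly k) : ∃ g : BiPoly k, Dy k K (ι f) = ι g := by
  induction f using bipoly_induction with
  | add f g hf hg =>
    obtain ⟨f', hf⟩ := hf; obtain ⟨g', hg⟩ := hg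
    exact ⟨f' + g', by simp [hf, hg]⟩
  | mon n m r =>
    refine ⟨algebraMap k _ r * x ^ n * ((m : BiPoly k) * y ^ (m - 1)), ?_⟩
    rw [monomial_monomial_eq]
    simp only [map_mul, map_pow, Derivation.leibniz, Derivation.leibniz_pow, Dy_x, Dy_y,
      ← IsScalarTower.algebraMap_apply, Derivation.map_algebraMap]
    simp; ring

variable [Algebra (Loc k) K] [IsFractionRing (Loc k) K] [IsScalarTower (BiPoly k) (Loc k) K]

theorem der_mem_of {D : Derivation k K K} (hD : ∀ f : BiPoly k, ∃ g : BiPoly k, D (ι f) = ι g)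
    (z : Loc k) : ∃ w : Loc k, D (algebraMap (Loc k) K z) = algebraMap (Loc k) K w := by
  obtain ⟨p, q, hq, h⟩ := loc_exists z
  obtain ⟨p', hp'⟩ := hD p
  obtain ⟨q', hq'⟩ := hD q
  obtain ⟨u, hu⟩ := isUnit_toLoc.2 hq
  refine ⟨(toLoc k p' - z * toLoc k q') * ↑u⁻¹, ?_⟩
  have hz : algebraMap (Loc k) K z * ι q = ι p := by
    rw [← algebraMap_toLoc, ← algebraMap_toLoc, ← h, map_mul]
  have h2 : ι q * algebraMap (Loc k) K ↑u⁻¹ = 1 := by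
    rw [← algebraMap_toLoc, ← hu, ← map_mul, Units.mul_inv, map_one]
  have := congrArg D hz
  rw [Derivation.leibniz, hp', hq', smul_eq_mul, smul_eq_mul] at this
  rw [map_mul, map_sub, map_mul, algebraMap_toLoc, algebraMap_toLoc, ← this]
  linear_combination -(D (algebraMap (Loc k) K z)) * h2

theorem Dx_mem_loc (z : Loc k) : ∃ w : Loc k, Dx k K (algebraMap (Loc k) K z) =
    algebraMap (Loc k) K w := der_mem_of Dx_mem z

theorem Dy_mem_loc (z : Loc k) : ∃ w : Loc k, Dy k K (algebraMap (Loc k) K z) =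
    algebraMap (Loc k) K w := der_mem_of Dy_mem z

end derivations

section lam

variable {k K : Type*} [Field k] [IsAlgClosed k] [Field K] [Algebra k K] [Algebra (BiPoly k) K]
  [IsScalarTower k (BiPoly k) K] [IsFractionRing (BiPoly k) K]
  [Algebra (Loc k) K] [IsFractionRing (Loc k) K] [IsScalarTower (BiPoly k) (Loc k) K]

local notation "ι" => algebraMap (BiPoly k) K
local notation "ℓ" => algebraMap (Loc k) K

theorem kap_isUnit_right (t : (K → ℤ) → K) {u : Loc k} (hu : IsUnit u) (a : K) :
    kap (k := k) t a (ℓ u) = 0 := by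
  have h0 : IsAddv (fun _ : K => (0 : ℤ)) := ⟨rfl, fun _ _ _ _ => rfl⟩
  refine congrFun (IsAddv.ext (Loc k) (kap_left k t (ℓ u)) h0 fun f hf => ?_) a
  rw [kap_algebraMap _ hf, hsum, Multiset.sum_eq_zero]
  intro z hz
  obtain ⟨q, hq, rfl⟩ := Multiset.mem_map.1 hz
  replace hq := UniqueFactorizationMonoid.prime_of_factor q hq
  have : ¬ q ∣ u := fun h => hq.not_isUnit (isUnit_of_dvd_unit h hu)
  rw [wgt, plc_of_not_dvd hq this, IK_of_not_dvd hq this, iL_of_isUnit_right _ hu]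
  ring

theorem ℓ_ne_zero {u : Loc k} (hu : u ≠ 0) : ℓ u ≠ 0 := by
  rwa [Ne, map_eq_zero_iff _ (IsFractionRing.injective (Loc k) K)]

theorem kap_mul_unit (t : (K → ℤ) → K) {u u' : Loc k} (hu : IsUnit u) (hu' : IsUnit u') {a b : K}
    (ha : a ≠ 0) (hb : b ≠ 0) : kap (k := k) t (ℓ u * a) (ℓ u' * b) = kap (k := k) t a b := by
  rw [(kap_left k t _).mul _ _ (ℓ_ne_zero hu.ne_zero) ha, kap_isUnit _ hu,
    (kap_right k t _).mul _ _ (ℓ_ne_zero hu'.ne_zero) hb, kap_isUnit_right _ hu']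
  ring

theorem kap_congr_unif {t t' : (K → ℤ) → K}
    (h : ∀ V, ∃ u : Loc k, IsUnit u ∧ t' V = ℓ u * t V) (a b : K) :
    kap (k := k) t' a b = kap (k := k) t a b := by
  refine congrFun (IsAddv.ext (Loc k) (kap_left k t' b) (kap_left k t b) fun f hf => ?_) a
  rw [kap_algebraMap _ hf, kap_algebraMap _ hf]
  refine hsum_congr fun p hp _ => ?_
  obtain ⟨u, hu, e⟩ := h (plc K p)
  rw [wgt, wgt, e]
  by_cases h0 : t (plc K p) = 0
  · rw [h0, mul_zero]
  have : ¬ p ∣ u := fun h => hp.not_isUnit (isUnit_of_dvd_unit h hu)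
  rw [(IK_isAddv hp).mul _ _ (ℓ_ne_zero hu.ne_zero) h0, IK_of_not_dvd hp this,
    iL_of_isUnit_right _ hu]
  ring

/-- `θ * (a, b)` is the gradient of `w`, and `a`, `b` are coprime. -/
structure IsGrad (w θ : K) (a b : Loc k) : Prop where
  ne : θ ≠ 0
  x : Dx k K w = θ * ℓ a
  y : Dy k K w = θ * ℓ b
  cop : IsRelPrime a b

theorem IsGrad.unique {w θ θ' : K} {a b a' b' : Loc k} (h : IsGrad w θ a b)
    (h' : IsGrad w θ' a' b') : ∃ u : (Loc k)ˣ, θ = ℓ u * θ' ∧ a' = u * a ∧ b' = u * b := by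
  obtain ⟨c, d, hd, e⟩ := IsFractionRing.div_surjective (A := Loc k) (θ / θ')
  have hd0 : d ≠ 0 := nonZeroDivisors.ne_zero hd
  have hd0' := ℓ_ne_zero (K := K) hd0
  have hne := h.ne
  have hne' := h'.ne
  have hc0 : ℓ c ≠ 0 := by
    intro h0; rw [h0, zero_div] at e
    exact div_ne_zero hne hne' e.symm
  have hc : c ≠ 0 := by rintro rfl; simp at hc0
  obtain ⟨c', d', g, hcd, rfl, rfl⟩ := UniqueFactorizationMonoid.exists_reduced_factors c hc d
  have hg : g ≠ 0 := left_ne_zero_of_mul hc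
  have hd' : d' ≠ 0 := right_ne_zero_of_mul hd0
  have hd'' := ℓ_ne_zero (K := K) hd'
  have hg' := ℓ_ne_zero (K := K) hg
  have e' : θ * ℓ d' = θ' * ℓ c' := by
    rw [map_mul, map_mul] at e
    field_simp at e
    linear_combination -e
  have key : ∀ {s s' : Loc k}, θ * ℓ s = θ' * ℓ s' → c' * s = d' * s' := by
    intro s s' hs
    apply IsFractionRing.injective (Loc k) K
    rw [map_mul, map_mul]
    apply mul_left_cancel₀ hne'
    linear_combination -ℓ s * e' + ℓ d' * hs
  have ha := key (h.x.symm.trans h'.x)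
  have hb := key (h.y.symm.trans h'.y)
  have hd1 : IsUnit d' := h.cop (hcd.symm.dvd_of_dvd_mul_left ⟨_, ha⟩)
    (hcd.symm.dvd_of_dvd_mul_left ⟨_, hb⟩)
  have hc1 : IsUnit c' := h'.cop (hcd.dvd_of_dvd_mul_left ⟨_, ha.symm⟩)
    (hcd.dvd_of_dvd_mul_left ⟨_, hb.symm⟩)
  obtain ⟨d', rfl⟩ := hd1
  obtain ⟨c', rfl⟩ := hc1
  refine ⟨c' * d'⁻¹, ?_, ?_, ?_⟩
  · have h1 : ℓ ↑d' * ℓ ↑(d'⁻¹) = 1 := by rw [← map_mul, Units.mul_inv, map_one]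
    rw [Units.val_mul, map_mul]
    linear_combination ℓ ↑(d'⁻¹) * e' - θ * h1
  · rw [Units.val_mul, mul_right_comm, ha]
    simp [mul_assoc, mul_comm]
  · rw [Units.val_mul, mul_right_comm, hb]
    simp [mul_assoc, mul_comm]

open Classical in
variable (k) in
/-- The local contribution of a pair of functions at the origin. -/
noncomputable def lam (t : (K → ℤ) → K) (w w₂ : K) : ℤ :=
  if h : ∃ q : K × Loc k × Loc k, IsGrad w q.1 q.2.1 q.2.2 then
    kap (k := k) t (jac k w w₂) (jac k w w₂) + kap (k := k) t (jac k w w₂) h.choose.1 -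
      kap (k := k) t h.choose.1 h.choose.1 + iL h.choose.2.1 h.choose.2.2
  else 0

theorem lam_eq (t : (K → ℤ) → K) {w w₂ θ : K} {a b : Loc k} (h : IsGrad w θ a b)
    (hJ : jac k w w₂ ≠ 0) : lam k t w w₂ =
    kap (k := k) t (jac k w w₂) (jac k w w₂) + kap (k := k) t (jac k w w₂) θ -
      kap (k := k) t θ θ + iL a b := by
  have hex : ∃ q : K × Loc k × Loc k, IsGrad w q.1 q.2.1 q.2.2 := ⟨(θ, a, b), h⟩
  rw [lam, dif_pos hex]
  obtain ⟨u, h1, h2, h3⟩ := h.unique hex.choose_spec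
  have hn := hex.choose_spec.ne
  set q := hex.choose
  rw [h1, kap_mul_unit t u.isUnit u.isUnit hn hn, h2, h3]
  have := kap_mul_unit t isUnit_one u.isUnit hJ hn
  rw [map_one, one_mul] at this
  rw [this]
  congr 1
  apply iL_of_associated <;> exact (associated_unit_mul_left _ _ u.isUnit)

theorem exists_isGrad_bipoly {w : K} (hw : Dx k K w ≠ 0 ∨ Dy k K w ≠ 0) :
    ∃ (θ : K) (a b : BiPoly k), θ ≠ 0 ∧ IsRelPrime a b ∧ Dx k K w = θ * ι a ∧ Dy k K w = θ * ι b := by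
  obtain ⟨f, g, hg, e⟩ := IsFractionRing.div_surjective (A := BiPoly k) (Dx k K w)
  obtain ⟨f', g', hg', e'⟩ := IsFractionRing.div_surjective (A := BiPoly k) (Dy k K w)
  have hg0 : ι g ≠ 0 := by simpa using nonZeroDivisors.ne_zero hg
  have hg0' : ι g' ≠ 0 := by simpa using nonZeroDivisors.ne_zero hg'
  have key : ∃ a b c : BiPoly k, IsRelPrime a b ∧ c * a = f * g' ∧ c * b = f' * g := by
    by_cases h0 : f * g' = 0
    · have h1 : f' * g ≠ 0 := by
        intro h1
        simp only [mul_eq_zero] at h0 h1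
        have h2 : f = 0 := h0.resolve_right (by rintro rfl; simp at hg0')
        have h3 : f' = 0 := h1.resolve_right (by rintro rfl; simp at hg0)
        rw [← e, ← e', h2, h3] at hw
        simp at hw
      obtain ⟨a, b, c, h2, h3, h4⟩ := UniqueFactorizationMonoid.exists_reduced_factors _ h1 (f * g')
      exact ⟨b, a, c, h2.symm, h4, h3⟩
    · exact UniqueFactorizationMonoid.exists_reduced_factors _ h0 _
  obtain ⟨a, b, c, h2, h3, h4⟩ := key
  have h3' := congrArg ι h3
  have h4' := congrArg ι h4
  rw [map_mul, map_mul] at h3' h4'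
  have ea : Dx k K w = ι c / (ι g * ι g') * ι a := by
    rw [← e]; field_simp; linear_combination -h3'
  have eb : Dy k K w = ι c / (ι g * ι g') * ι b := by
    rw [← e']; field_simp; linear_combination -h4'
  refine ⟨ι c / (ι g * ι g'), a, b, ?_, h2, ea, eb⟩
  intro h0
  rw [ea, eb, h0] at hw
  simp at hw

theorem grad_ne_zero_of_jac {w w₂ : K} (hJ : jac k w w₂ ≠ 0) : Dx k K w ≠ 0 ∨ Dy k K w ≠ 0 := by
  by_contra! h
  rw [jac, h.1, h.2] at hJ
  simp at hJ

theorem exists_isGrad {w w₂ : K} (hJ : jac k w w₂ ≠ 0) :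
    ∃ (θ : K) (a b : Loc k), IsGrad w θ a b := by
  obtain ⟨θ, a, b, h0, h1, h2, h3⟩ := exists_isGrad_bipoly (grad_ne_zero_of_jac hJ)
  exact ⟨θ, toLoc k a, toLoc k b, h0, by rwa [algebraMap_toLoc], by rwa [algebraMap_toLoc],
    isRelPrime_toLoc h1⟩

theorem isUnit_algebraMap_loc {c : k} (hc : c ≠ 0) : IsUnit (algebraMap k (Loc k) c) :=
  (isUnit_iff_ne_zero.2 hc).map _

theorem ℓ_algebraMap (c : k) : ℓ (algebraMap k (Loc k) c) = algebraMap k K c := by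
  rw [IsScalarTower.algebraMap_apply k (BiPoly k) (Loc k), algebraMap_toLoc,
    ← IsScalarTower.algebraMap_apply]

/-- Constants do not affect the local contribution. -/
theorem lam_const {t t' : (K → ℤ) → K} {w w₂ : K} {c c₂ : k} (hc : c ≠ 0) (hc₂ : c₂ ≠ 0)
    (h : ∀ V, ∃ u : k, u ≠ 0 ∧ t' V = algebraMap k K u * t V) (hJ : jac k w w₂ ≠ 0) :
    lam k t' (algebraMap k K c * w) (algebraMap k K c₂ * w₂) = lam k t w w₂ := by
  obtain ⟨θ, a, b, hg⟩ := exists_isGrad hJ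
  have e : jac k (algebraMap k K c * w) (algebraMap k K c₂ * w₂) =
      ℓ (algebraMap k (Loc k) (c * c₂)) * jac k w w₂ := by
    rw [ℓ_algebraMap]
    simp [jac]; ring
  have hu := isUnit_algebraMap_loc hc
  have hu2 := isUnit_algebraMap_loc (mul_ne_zero hc hc₂)
  have hJ' : jac k (algebraMap k K c * w) (algebraMap k K c₂ * w₂) ≠ 0 := by
    rw [e]; exact mul_ne_zero (ℓ_ne_zero hu2.ne_zero) hJ
  have hg' : IsGrad (algebraMap k K c * w) (ℓ (algebraMap k (Loc k) c) * θ) a b :=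
    ⟨mul_ne_zero (ℓ_ne_zero hu.ne_zero) hg.ne, by simp [ℓ_algebraMap, hg.x, mul_assoc],
      by simp [ℓ_algebraMap, hg.y, mul_assoc], hg.cop⟩
  have ht : ∀ a b, kap (k := k) t' a b = kap (k := k) t a b := kap_congr_unif fun V => by
    obtain ⟨u, hu, e⟩ := h V
    exact ⟨_, isUnit_algebraMap_loc hu, by rw [ℓ_algebraMap, e]⟩
  rw [lam_eq t' hg' hJ', lam_eq t hg hJ, e, ht, ht, ht, kap_mul_unit t hu2 hu2 hJ hJ,
    kap_mul_unit t hu2 hu hJ hg.ne, kap_mul_unit t hu hu hg.ne hg.ne]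

/-- Invariance of the local contribution under automorphisms of the local ring. -/
theorem lam_auto (θ : K ≃ₐ[k] K) (e : Loc k ≃ₐ[k] Loc k) (h : ∀ z, θ (ℓ z) = ℓ (e z))
    (t : (K → ℤ) → K) {w w₂ : K} (hJ : jac k w w₂ ≠ 0) :
    lam k (tw t θ.symm) (θ w) (θ w₂) = lam k t w w₂ := by
  obtain ⟨η, a, b, hg⟩ := exists_isGrad hJ
  have hx : ∀ f, ι f = ℓ (toLoc k f) := fun f => (algebraMap_toLoc f).symm
  obtain ⟨m₁, h₁⟩ := Dx_mem_loc (K := K) (e (toLoc k x))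
  obtain ⟨m₂, h₂⟩ := Dx_mem_loc (K := K) (e (toLoc k y))
  obtain ⟨m₃, h₃⟩ := Dy_mem_loc (K := K) (e (toLoc k x))
  obtain ⟨m₄, h₄⟩ := Dy_mem_loc (K := K) (e (toLoc k y))
  obtain ⟨n₁, g₁⟩ := Dx_mem_loc (K := K) (e.symm (toLoc k x))
  obtain ⟨n₂, g₂⟩ := Dx_mem_loc (K := K) (e.symm (toLoc k y))
  obtain ⟨n₃, g₃⟩ := Dy_mem_loc (K := K) (e.symm (toLoc k x))
  obtain ⟨n₄, g₄⟩ := Dy_mem_loc (K := K) (e.symm (toLoc k y))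
  have hs : ∀ z, θ.symm (ℓ z) = ℓ (e.symm z) := fun z => by
    rw [AlgEquiv.symm_apply_eq, h, AlgEquiv.apply_symm_apply]
  have hjac : jac k (θ (ι x)) (θ (ι y)) = ℓ (m₁ * m₄ - m₃ * m₂) := by
    rw [jac, hx, hx, h, h, h₁, h₂, h₃, h₄]; simp
  have hjac' : jac k (θ.symm (ι x)) (θ.symm (ι y)) = ℓ (n₁ * n₄ - n₃ * n₂) := by
    rw [jac, hx, hx, hs, hs, g₁, g₂, g₃, g₄]; simp
  have hdet : IsUnit (m₁ * m₄ - m₃ * m₂) := by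
    refine IsUnit.of_mul_eq_one (e (n₁ * n₄ - n₃ * n₂)) ?_
    apply IsFractionRing.injective (Loc k) K
    rw [map_mul, ← hjac, ← h, ← hjac', ← jac_auto, AlgEquiv.apply_symm_apply,
      AlgEquiv.apply_symm_apply, map_one]
    simp [jac]
  have hJe := jac_auto θ w w₂
  rw [hjac] at hJe
  have hJ0 : θ (jac k w w₂) ≠ 0 := by simpa using hJ
  have hη0 : θ η ≠ 0 := by simpa using hg.ne
  have hJ' : jac k (θ w) (θ w₂) ≠ 0 := by
    rw [hJe]; exact mul_ne_zero (ℓ_ne_zero hdet.ne_zero) hJ0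
  set a' := m₁ * e a + m₂ * e b
  set b' := m₃ * e a + m₄ * e b
  obtain ⟨δ, hδ⟩ := hdet
  have ia : e a = ↑δ⁻¹ * (m₄ * a' - m₂ * b') := by
    have h1 : (↑δ⁻¹ : Loc k) * (m₁ * m₄ - m₃ * m₂) = 1 := by rw [← hδ, Units.inv_mul]
    simp only [a', b']
    linear_combination -e a * h1
  have ib : e b = ↑δ⁻¹ * (m₁ * b' - m₃ * a') := by
    have h1 : (↑δ⁻¹ : Loc k) * (m₁ * m₄ - m₃ * m₂) = 1 := by rw [← hδ, Units.inv_mul]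
    simp only [a', b']
    linear_combination -e b * h1
  have hcop : IsRelPrime (e a) (e b) := by
    intro d h1 h2
    obtain ⟨d, rfl⟩ := e.surjective d
    rw [map_dvd_iff] at h1 h2
    exact (hg.cop h1 h2).map e
  have hcop' : IsRelPrime a' b' := by
    intro d h1 h2
    refine hcop ?_ ?_
    · rw [ia]; exact (dvd_sub (h1.mul_left _) (h2.mul_left _)).mul_left _
    · rw [ib]; exact (dvd_sub (h2.mul_left _) (h1.mul_left _)).mul_left _
  have hg' : IsGrad (θ w) (θ η) a' b' := by
    refine ⟨hη0, ?_, ?_, hcop'⟩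
    · rw [chain_rule, hx, hx, h, h, h₁, h₂, hg.x, hg.y]
      simp only [map_mul, h, a', map_add]; ring
    · rw [chain_rule, hx, hx, h, h, h₃, h₄, hg.x, hg.y]
      simp only [map_mul, h, b', map_add]; ring
  have hu : IsUnit (m₁ * m₄ - m₃ * m₂) := ⟨δ, hδ⟩
  have hk : ∀ c d, kap (k := k) (tw t θ.symm) (θ c) (θ d) = kap (k := k) t c d :=
    fun c d => kap_auto θ e h t c d
  have hi : iL a' b' = iL a b := by
    rw [← iL_algEquiv e a b]
    refine iL_eq_of_inum_eq (inum_eq_of_span_eq ?_)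
    apply le_antisymm <;> rw [Ideal.span_le] <;> rintro z (rfl | rfl)
    · exact Ideal.mem_span_pair.2 ⟨m₁, m₂, rfl⟩
    · exact Ideal.mem_span_pair.2 ⟨m₃, m₄, rfl⟩
    · exact Ideal.mem_span_pair.2 ⟨↑δ⁻¹ * m₄, -(↑δ⁻¹ * m₂), by rw [ia]; ring⟩
    · exact Ideal.mem_span_pair.2 ⟨-(↑δ⁻¹ * m₃), ↑δ⁻¹ * m₁, by rw [ib]; ring⟩
  have hk2 : kap (k := k) (tw t θ.symm) (ℓ (m₁ * m₄ - m₃ * m₂) * θ (jac k w w₂)) (θ η) =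
      kap (k := k) t (jac k w w₂) η := by
    have := kap_mul_unit (tw t θ.symm) hu isUnit_one hJ0 hη0
    rw [map_one, one_mul] at this
    rw [this, hk]
  rw [lam_eq _ hg' hJ', lam_eq t hg hJ, hJe, hk2, kap_mul_unit _ hu hu hJ0 hJ0, hk, hk, hi]

end lam

section charts

variable {k K : Type*} [Field k] [IsAlgClosed k] [Field K] [Algebra k K] [Algebra (BiPoly k) K]
  [IsScalarTower k (BiPoly k) K] [IsFractionRing (BiPoly k) K]
  [Algebra (Loc k) K] [IsFractionRing (Loc k) K] [IsScalarTower (BiPoly k) (Loc k) K]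

local notation "ι" => algebraMap (BiPoly k) K
local notation "ℓ" => algebraMap (Loc k) K

theorem lam_eq_of_unit (t : (K → ℤ) → K) {w w₂ θ J : K} {a b u : Loc k} (h : IsGrad w θ a b)
    (hu : IsUnit u) (hJ : jac k w w₂ = ℓ u * J) (hJ0 : J ≠ 0) : lam k t w w₂ =
    kap (k := k) t J J + kap (k := k) t J θ - kap (k := k) t θ θ + iL a b := by
  have hJ' : jac k w w₂ ≠ 0 := by rw [hJ]; exact mul_ne_zero (ℓ_ne_zero hu.ne_zero) hJ0
  have := kap_mul_unit t hu isUnit_one hJ0 h.ne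
  rw [map_one, one_mul] at this
  rw [lam_eq t h hJ', hJ, kap_mul_unit t hu hu hJ0 hJ0, this]

theorem iL_mul_x {f g : Loc k} (hf : IsRelPrime f (toLoc k x)) (hg : IsRelPrime f g) (m : ℕ) :
    iL f (toLoc k x ^ m * g) = m * iL f (toLoc k x) + iL f g ∧
      IsRelPrime f (toLoc k x ^ m * g) := by
  have hr : IsRelPrime f (toLoc k x ^ m * g) := (IsRelPrime.pow_right hf).mul_right hg
  refine ⟨?_, hr⟩
  induction m with
  | zero => simp
  | succ m ih =>
    have h2 : IsRelPrime f (toLoc k x ^ m * g) := (IsRelPrime.pow_right hf).mul_right hg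
    rw [pow_succ', mul_assoc, iL_mul_right hf h2, ih h2]
    push_cast; ring

/-- The gradient in a chart, when the exceptional curve is not dicritical. -/
theorem isGrad_chart {e n : ℤ} (he : e = 1 ∨ e = -1) {w θ : K} {P α β ρ : BiPoly k}
    (hθ : θ ≠ 0) (hP : P = α + ρ * β) (hr : IsRelPrime (toLoc k α) (toLoc k β))
    (hx : Dx k K w = e * ι x ^ (e - 1) * (θ * ι x ^ n * ι P))
    (hy : Dy k K w = ι x ^ e * (θ * ι x ^ n * ι β)) (hPx : IsRelPrime (toLoc k P) (toLoc k x)) :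
    IsGrad w (ι x ^ (n + e - 1) * θ) ((e : Loc k) * toLoc k P) (toLoc k x * toLoc k β) ∧
    iL ((e : Loc k) * toLoc k P) (toLoc k x * toLoc k β) =
      iL (toLoc k P) (toLoc k x) + iL (toLoc k α) (toLoc k β) := by
  have hx0 : ι x ≠ 0 := algebraMap_x_ne_zero
  have hu : IsUnit (e : Loc k) := by rcases he with rfl | rfl <;> simp
  have hPβ : IsRelPrime (toLoc k P) (toLoc k β) := by
    intro d h1 h2
    refine hr ?_ h2
    rw [hP, map_add, map_mul] at h1
    exact (dvd_add_left (h2.mul_left _)).1 h1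
  have ha : Associated ((e : Loc k) * toLoc k P) (toLoc k P) :=
    associated_unit_mul_left _ _ hu
  have hc := hPx.mul_right hPβ
  constructor
  · refine ⟨mul_ne_zero (zpow_ne_zero _ hx0) hθ, ?_, ?_, ?_⟩
    · rw [hx, map_mul, algebraMap_toLoc, map_intCast, add_sub_assoc, zpow_add₀ hx0]; ring
    · rw [hy, map_mul, algebraMap_toLoc, algebraMap_toLoc, zpow_sub₀ hx0, zpow_add₀ hx0]
      field_simp
    · exact fun d h1 h2 => hc (h1.trans ha.dvd) h2
  · rw [iL_of_associated ha (Associated.refl _), iL_mul_right hPx hPβ]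
    congr 1
    rw [hP, map_add, map_mul, iL_comm, iL_add_mul_right, iL_comm]

/-- The gradient in a chart, when the exceptional curve is dicritical. -/
theorem isGrad_chart_dicritical {e n : ℤ} (he : e = 1 ∨ e = -1) {w θ : K} {P α β ρ : BiPoly k}
    (hθ : θ ≠ 0) (hP : x * P = α + ρ * β) (hr : IsRelPrime (toLoc k α) (toLoc k β))
    (hx : Dx k K w = e * ι x ^ (e - 1) * (θ * ι x ^ n * ι (x * P)))
    (hy : Dy k K w = ι x ^ e * (θ * ι x ^ n * ι β)) (hβ : IsRelPrime (toLoc k x) (toLoc k β)) :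
    IsGrad w (ι x ^ (n + e) * θ) ((e : Loc k) * toLoc k P) (toLoc k β) ∧
    iL ((e : Loc k) * toLoc k P) (toLoc k β) =
      iL (toLoc k α) (toLoc k β) - iL (toLoc k x) (toLoc k β) := by
  have hx0 : ι x ≠ 0 := algebraMap_x_ne_zero
  have hu : IsUnit (e : Loc k) := by rcases he with rfl | rfl <;> simp
  have hPβ : IsRelPrime (toLoc k P) (toLoc k β) := by
    intro d h1 h2
    refine hr ?_ h2
    have h3 : d ∣ toLoc k α + toLoc k ρ * toLoc k β := by
      rw [← map_mul, ← map_add, ← hP, map_mul]; exact h1.mul_left _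
    exact (dvd_add_left (h2.mul_left _)).1 h3
  have ha : Associated ((e : Loc k) * toLoc k P) (toLoc k P) :=
    associated_unit_mul_left _ _ hu
  constructor
  · refine ⟨mul_ne_zero (zpow_ne_zero _ hx0) hθ, ?_, ?_, ?_⟩
    · rw [hx, map_mul, map_mul, algebraMap_toLoc, map_intCast, zpow_sub₀ hx0, zpow_add₀ hx0]
      field_simp
    · rw [hy, algebraMap_toLoc, zpow_add₀ hx0]; ring
    · exact fun d h1 h2 => hPβ (h1.trans ha.dvd) h2
  · rw [iL_of_associated ha (Associated.refl _)]
    have h1 := iL_mul_left hβ hPβ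
    rw [← map_mul, hP, map_add, map_mul, iL_comm, iL_add_mul_right, iL_comm] at h1
    linarith

theorem derivation_zpow_x (D : Derivation k K K) {e : ℤ} (he : e = 1 ∨ e = -1) :
    D (ι x ^ e) = e * ι x ^ (e - 1) * D (ι x) := by
  rcases he with rfl | rfl
  · simp
  · have hx0 : ι x ≠ 0 := algebraMap_x_ne_zero
    have := Derivation.leibniz_inv D (ι x)
    have h2 : ι x ^ (-1 - 1 : ℤ) = (ι x)⁻¹ ^ 2 := by
      rw [show (-1 - 1 : ℤ) = -((2 : ℕ) : ℤ) by norm_num, zpow_neg, zpow_natCast, inv_pow]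
    rw [zpow_neg_one, this, h2]
    simp

theorem grad_chart_some {e : ℤ} (he : e = 1 ∨ e = -1) {Θ : K ≃ₐ[k] K} {c : k}
    (hx : Θ (ι x) = ι x ^ e) (hy : Θ (ι y) = ι x ^ e * ι (y + algebraMap k _ c)) (w w₂ : K) :
    Dx k K (Θ w) = e * ι x ^ (e - 1) *
        (Θ (Dx k K w) + ι (y + algebraMap k _ c) * Θ (Dy k K w)) ∧
      Dy k K (Θ w) = ι x ^ e * Θ (Dy k K w) ∧
      jac k (Θ w) (Θ w₂) = ℓ e * (ι x ^ (2 * e - 1) * Θ (jac k w w₂)) := by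
  have hx0 : ι x ≠ 0 := algebraMap_x_ne_zero
  have h1 : Dx k K (ι (y + algebraMap k _ c)) = 0 := by
    rw [map_add, map_add, ← IsScalarTower.algebraMap_apply, Derivation.map_algebraMap]; simp
  have h2 : Dy k K (ι (y + algebraMap k _ c)) = 1 := by
    rw [map_add, map_add, ← IsScalarTower.algebraMap_apply, Derivation.map_algebraMap]; simp
  have a1 : Dx k K (Θ (ι x)) = e * ι x ^ (e - 1) := by
    rw [hx, derivation_zpow_x _ he, Dx_x, mul_one]
  have a2 : Dy k K (Θ (ι x)) = 0 := by rw [hx, derivation_zpow_x _ he, Dy_x, mul_zero]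
  have a3 : Dx k K (Θ (ι y)) = e * ι x ^ (e - 1) * ι (y + algebraMap k _ c) := by
    rw [hy, Derivation.leibniz, h1, derivation_zpow_x _ he, Dx_x, smul_eq_mul, smul_eq_mul]; ring
  have a4 : Dy k K (Θ (ι y)) = ι x ^ e := by
    rw [hy, Derivation.leibniz, h2, derivation_zpow_x _ he, Dy_x, smul_eq_mul, smul_eq_mul]; ring
  refine ⟨?_, ?_, ?_⟩
  · rw [chain_rule, a1, a3]; ring
  · rw [chain_rule, a2, a4]; ring
  · rw [jac_auto, jac, a1, a2, a3, a4, map_intCast, two_mul, add_sub_assoc, zpow_add₀ hx0]; ring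

theorem grad_chart_none {e : ℤ} (he : e = 1 ∨ e = -1) {Θ : K ≃ₐ[k] K}
    (hx : Θ (ι x) = ι x ^ e * ι y) (hy : Θ (ι y) = ι x ^ e) (w w₂ : K) :
    Dx k K (Θ w) = e * ι x ^ (e - 1) * (Θ (Dy k K w) + ι y * Θ (Dx k K w)) ∧
      Dy k K (Θ w) = ι x ^ e * Θ (Dx k K w) ∧
      jac k (Θ w) (Θ w₂) = ℓ (-e) * (ι x ^ (2 * e - 1) * Θ (jac k w w₂)) := by
  have hx0 : ι x ≠ 0 := algebraMap_x_ne_zero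
  have a1 : Dx k K (Θ (ι y)) = e * ι x ^ (e - 1) := by
    rw [hy, derivation_zpow_x _ he, Dx_x, mul_one]
  have a2 : Dy k K (Θ (ι y)) = 0 := by rw [hy, derivation_zpow_x _ he, Dy_x, mul_zero]
  have a3 : Dx k K (Θ (ι x)) = e * ι x ^ (e - 1) * ι y := by
    rw [hx, Derivation.leibniz, Dx_y, derivation_zpow_x _ he, Dx_x, smul_eq_mul, smul_eq_mul]; ring
  have a4 : Dy k K (Θ (ι x)) = ι x ^ e := by
    rw [hx, Derivation.leibniz, Dy_y, derivation_zpow_x _ he, Dy_x, smul_eq_mul, smul_eq_mul]; ring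
  refine ⟨?_, ?_, ?_⟩
  · rw [chain_rule, a1, a3]; ring
  · rw [chain_rule, a2, a4]; ring
  · rw [jac_auto, jac, a1, a2, a3, a4, map_neg, map_intCast, two_mul, add_sub_assoc, zpow_add₀ hx0]
    ring

namespace ChartFamily

/-- The sum of the local contributions over the charts of a family. -/
theorem hasSum_lam (F : ChartFamily k K (Option k)) (hε : F.ε = 1 ∨ F.ε = -1)
    (hsx : ∀ c, (F.φ (some c)).symm (ι x) = ι x ^ F.ε)
    (hsy : ∀ c, (F.φ (some c)).symm (ι y) = ι x ^ F.ε * ι (y + algebraMap k _ c))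
    (hnx : (F.φ none).symm (ι x) = ι x ^ F.ε * ι y) (hny : (F.φ none).symm (ι y) = ι x ^ F.ε)
    {t : (K → ℤ) → K} (ht : IsUnif k t) {w w₂ θ : K} {a b : BiPoly k} (hJ : jac k w w₂ ≠ 0)
    (hθ : θ ≠ 0) (ha : Dx k K w = θ * ι a) (hb : Dy k K w = θ * ι b) {n : ℤ}
    {α β : Option k → BiPoly k} (hα : ∀ j, (F.φ j).symm (ι a) = ι x ^ n * ι (α j))
    (hβ : ∀ j, (F.φ j).symm (ι b) = ι x ^ n * ι (β j))
    (hr : ∀ j, IsRelPrime (toLoc k (α j)) (toLoc k (β j))) {N₁ N₂ N₃ N₄ : ℤ}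
    (h₁ : HasSum (fun j => kap (k := k) (tw t (F.φ j)) ((F.φ j).symm (jac k w w₂))
      ((F.φ j).symm (jac k w w₂))) N₁)
    (h₂ : HasSum (fun j => kap (k := k) (tw t (F.φ j)) ((F.φ j).symm (jac k w w₂))
      ((F.φ j).symm θ)) N₂)
    (h₃ : HasSum (fun j => kap (k := k) (tw t (F.φ j)) ((F.φ j).symm θ) ((F.φ j).symm θ)) N₃)
    (h₄ : HasSum (fun j => iL (toLoc k (α j)) (toLoc k (β j))) (N₄ - F.ε * n ^ 2)) :
    HasSum (fun j => lam k (tw t (F.φ j)) ((F.φ j).symm w) ((F.φ j).symm w₂))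
      (N₁ + N₂ - N₃ + N₄ + 6 * (1 - F.ε)) := by
  have hx0 : ι x ≠ 0 := algebraMap_x_ne_zero
  set e := F.ε with he
  have hθj : ∀ j, (F.φ j).symm θ ≠ 0 := fun j => (_root_.map_ne_zero _).2 hθ
  have hJj : ∀ j, ι x ^ (2 * e - 1) * (F.φ j).symm (jac k w w₂) ≠ 0 := fun j =>
    mul_ne_zero (zpow_ne_zero _ hx0) ((_root_.map_ne_zero _).2 hJ)
  let α' : Option k → BiPoly k := fun j => j.elim (β none) (fun c => α (some c))
  let β' : Option k → BiPoly k := fun j => j.elim (α none) (fun c => β (some c))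
  let ρ : Option k → BiPoly k := fun j => j.elim y (fun c => y + algebraMap k _ c)
  have hr' : ∀ j, IsRelPrime (toLoc k (α' j)) (toLoc k (β' j)) := by
    rintro (_ | c)
    exacts [(hr none).symm, hr (some c)]
  have hi' : ∀ j, iL (toLoc k (α' j)) (toLoc k (β' j)) = iL (toLoc k (α j)) (toLoc k (β j)) := by
    rintro (_ | c)
    exacts [iL_comm _ _, rfl]
  have hu : IsUnit (e : Loc k) := by rcases hε with h | h <;> simp [h]
  have hgrad : ∀ j, Dx k K ((F.φ j).symm w) = e * ι x ^ (e - 1) *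
        ((F.φ j).symm θ * ι x ^ n * ι (α' j + ρ j * β' j)) ∧
      Dy k K ((F.φ j).symm w) = ι x ^ e * ((F.φ j).symm θ * ι x ^ n * ι (β' j)) ∧
      ∃ u : Loc k, IsUnit u ∧ jac k ((F.φ j).symm w) ((F.φ j).symm w₂) =
        ℓ u * (ι x ^ (2 * e - 1) * (F.φ j).symm (jac k w w₂)) := by
    rintro (_ | c)
    · obtain ⟨h1, h2, h3⟩ := grad_chart_none hε hnx hny w w₂
      refine ⟨?_, ?_, _, hu.neg, h3⟩
      · rw [h1, ha, hb, map_mul, map_mul, hα, hβ, map_add, map_mul]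
        simp only [α', β', ρ, Option.elim]; ring
      · rw [h2, ha, map_mul, hα]
        simp only [β', Option.elim]; ring
    · obtain ⟨h1, h2, h3⟩ := grad_chart_some hε (hsx c) (hsy c) w w₂
      refine ⟨?_, ?_, _, hu, h3⟩
      · rw [h1, ha, hb, map_mul, map_mul, hα, hβ, map_add ι (α' _), map_mul]
        simp only [α', β', ρ, Option.elim]; ring
      · rw [h2, hb, map_mul, hβ]
        simp only [β', Option.elim]; ring
  have hz : ∀ j, (F.φ j).symm (ι (x * a + y * b)) =
      ι x ^ (n + e) * ι (α' j + ρ j * β' j) := by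
    rintro (_ | c)
    · rw [map_add, map_mul, map_mul, map_add, map_mul, map_mul, hnx, hny, hα, hβ, map_add, map_mul,
        zpow_add₀ hx0]
      simp only [α', β', ρ, Option.elim]; ring
    · rw [map_add, map_mul, map_mul, map_add, map_mul, map_mul, hsx, hsy, hα, hβ,
        map_add ι (α' _), map_mul, zpow_add₀ hx0]
      simp only [α', β', ρ, Option.elim]; ring
  have k₁ := F.hasSum_kap_twist t ht hJ hJ h₁ (2 * e - 1) (2 * e - 1)
  have hxp : Prime (toLoc k x) := prime_toLoc_x
  by_cases hd : x * a + y * b ≠ 0 ∧ F.v (x * a + y * b) = n + e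
  · obtain ⟨hz0, hv⟩ := hd
    have hσ : ∀ j, α' j + ρ j * β' j = F.σ j (x * a + y * b) := by
      intro j
      have h1 := F.eq j _ hz0
      rw [hz, hv] at h1
      exact algebraMap_bipoly_injective (K := K) (mul_left_cancel₀ (zpow_ne_zero _ hx0) h1)
    obtain ⟨s1, s2⟩ := F.hasSum_x hz0
    rw [hv] at s1
    have k₂ := F.hasSum_kap_twist t ht hJ hθ h₂ (2 * e - 1) (n + e - 1)
    have k₃ := F.hasSum_kap_twist t ht hθ hθ h₃ (n + e - 1) (n + e - 1)
    refine HasSum.congr' (((k₁.add k₂).sub k₃).add (s1.add h₄)) (fun j => ?_) ?_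
    · obtain ⟨g1, g2, u, hu, g3⟩ := hgrad j
      obtain ⟨q1, q2⟩ := isGrad_chart hε (hθj j) rfl (hr' j) g1 g2 (by rw [hσ]; exact s2 j)
      rw [lam_eq_of_unit _ q1 hu g3 (hJj j), q2, hi', hσ]
    · rcases hε with h | h <;> rw [← he, h] <;> ring
  · have hdvd : ∀ j, x ∣ α' j + ρ j * β' j := by
      intro j
      by_contra hnd
      apply hd
      have hz0 : x * a + y * b ≠ 0 := by
        intro h0
        have h1 := hz j
        rw [h0, map_zero, map_zero, eq_comm, mul_eq_zero] at h1
        rcases h1 with h1 | h1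
        · exact zpow_ne_zero _ hx0 h1
        · rw [algebraMap_bipoly_eq_zero] at h1
          exact hnd (h1 ▸ dvd_zero _)
      exact ⟨hz0, (F.vσ_unique j hz0 hnd (hz j)).1⟩
    choose P hP using id hdvd
    have hnd : ∀ j, ¬ x ∣ β j := by
      intro j h
      have hα : x ∣ α j := by
        rcases j with _ | c
        · have : x ∣ y * α none := by
            exact (dvd_add_right h).1 (hdvd none)
          exact (prime_x.dvd_or_dvd this).resolve_left
            (fun h => not_x_dvd_of_coeff 1 (by simp [y]) h)
        · exact (dvd_add_left (h.mul_left _)).1 (hdvd (some c))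
      exact hxp.not_isUnit (hr j (map_dvd _ hα) (map_dvd _ h))
    have hb0 : b ≠ 0 := by
      rintro rfl
      have := hβ none
      rw [map_zero, map_zero, eq_comm, mul_eq_zero] at this
      rcases this with h1 | h1
      · exact zpow_ne_zero _ hx0 h1
      · rw [algebraMap_bipoly_eq_zero] at h1
        exact hnd none (h1 ▸ dvd_zero _)
    have hv : ∀ j, F.v b = n ∧ F.σ j b = β j := fun j => F.vσ_unique j hb0 (hnd j) (hβ j)
    obtain ⟨s1, s2⟩ := F.hasSum_x hb0
    rw [(hv none).1] at s1
    simp only [(hv _).2] at s1 s2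
    have hβ' : ∀ j, IsRelPrime (toLoc k x) (toLoc k (β' j)) ∧
        iL (toLoc k x) (toLoc k (β' j)) = iL (toLoc k (β j)) (toLoc k x) -
          (if j = none then 1 else 0) := by
      rintro (_ | c)
      · have h1 : ¬ x ∣ α none := by
          intro h
          refine hnd none ?_
          exact (dvd_add_left (h.mul_left _)).1 (hdvd none)
        have h2 : IsRelPrime (toLoc k x) (toLoc k (α none)) :=
          isRelPrime_toLoc (prime_x.isRelPrime_of_not_dvd h1)
        refine ⟨h2, ?_⟩
        have h3 : β none = -(y * α none) + P none * x := by
          have := hP none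
          simp only [α', β', ρ, Option.elim] at this
          linear_combination this
        have h4 : Associated (toLoc k (-(y * α none))) (toLoc k y * toLoc k (α none)) := by
          rw [map_neg, map_mul]; exact (Associated.refl _).neg_left
        have h5 : iL (toLoc k x) (toLoc k y) = 1 := by
          have := coe_iL (f := toLoc k x) (g := toLoc k y) (by rw [inum_loc_x_y]; simp)
          rw [inum_loc_x_y] at this
          exact_mod_cast this.symm
        simp only [β', Option.elim, if_true]
        rw [iL_comm _ (toLoc k x), h3, map_add, map_mul, iL_add_mul_right,
          iL_of_associated (Associated.refl _) h4, iL_mul_right (isRelPrime_toLoc isRelPrime_x_y) h2,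
          h5]
        ring
      · refine ⟨(s2 (some c)).symm, ?_⟩
        simp only [β', Option.elim, reduceCtorEq, if_false, sub_zero]
        exact iL_comm _ _
    have k₂ := F.hasSum_kap_twist t ht hJ hθ h₂ (2 * e - 1) (n + e)
    have k₃ := F.hasSum_kap_twist t ht hθ hθ h₃ (n + e) (n + e)
    have s3 : HasSum (fun j : Option k => if j = none then (1 : ℤ) else 0) 1 :=
      hasSum_ite_eq none 1
    refine HasSum.congr' (((k₁.add k₂).sub k₃).add (h₄.sub (s1.sub s3))) (fun j => ?_) ?_
    · obtain ⟨g1, g2, u, hu, g3⟩ := hgrad j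
      rw [hP j] at g1
      obtain ⟨q1, q2⟩ := isGrad_chart_dicritical hε (hθj j) (hP j).symm (hr' j) g1 g2 (hβ' j).1
      rw [lam_eq_of_unit _ q1 hu g3 (hJj j), q2, hi', (hβ' j).2]
    · rcases hε with h | h <;> rw [← he, h] <;> ring

/-- Virtual transforms of a coprime pair. -/
theorem exists_virtual_pair (F : ChartFamily k K (Option k)) {a b : BiPoly k} (hab : IsRelPrime a b)
    {N : ℤ} (h0 : a = 0 ∨ b = 0 → N = 0)
    (h : a ≠ 0 → b ≠ 0 → HasSum (fun j => iL (toLoc k (F.σ j a)) (toLoc k (F.σ j b)))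
      (N - F.ε * F.v a * F.v b) ∧ ∀ j, IsRelPrime (toLoc k (F.σ j a)) (toLoc k (F.σ j b))) :
    ∃ (n : ℤ) (α β : Option k → BiPoly k), (∀ j, (F.φ j).symm (ι a) = ι x ^ n * ι (α j)) ∧
      (∀ j, (F.φ j).symm (ι b) = ι x ^ n * ι (β j)) ∧
      (∀ j, IsRelPrime (toLoc k (α j)) (toLoc k (β j))) ∧
      HasSum (fun j => iL (toLoc k (α j)) (toLoc k (β j))) (N - F.ε * n ^ 2) := by
  wlog hv : a ≠ 0 ∧ (b ≠ 0 → F.v a ≤ F.v b) generalizing a b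
  · obtain ⟨n, α, β, h1, h2, h3, h4⟩ := this hab.symm (fun h => h0 h.symm)
      (fun hb ha => ⟨by
        refine (h ha hb).1.congr' (fun j => iL_comm _ _), fun j => ((h ha hb).2 j).symm⟩) (by
          refine ⟨?_, fun ha => ?_⟩
          · rintro rfl
            refine hv ⟨?_, by simp⟩
            rintro rfl
            exact prime_x.not_isUnit (hab (dvd_zero _) (dvd_zero _))
          · by_contra! hlt
            exact hv ⟨ha, fun _ => hlt.le⟩)
    exact ⟨n, β, α, h2, h1, fun j => (h3 j).symm, h4.congr' (fun j => iL_comm _ _)⟩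
  obtain ⟨ha, hv⟩ := hv
  by_cases hb : b = 0
  · subst hb
    have hu : IsUnit a := hab dvd_rfl (dvd_zero _)
    obtain ⟨c, hc, rfl⟩ : ∃ c : k, c ≠ 0 ∧ a = algebraMap k _ c := by
      obtain ⟨f, hf, rfl⟩ := Polynomial.isUnit_iff.1 hu
      obtain ⟨c, hc, rfl⟩ := Polynomial.isUnit_iff.1 hf
      exact ⟨c, hc.ne_zero, rfl⟩
    refine ⟨0, fun _ => algebraMap k _ c, fun _ => 0, fun j => ?_, fun j => by simp, fun j => ?_, ?_⟩
    · rw [← IsScalarTower.algebraMap_apply, AlgEquiv.commutes, zpow_zero, one_mul]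
    · exact (hu.map (algebraMap (BiPoly k) (Loc k))).isRelPrime_left
    · rw [h0 (Or.inr rfl)]
      have : HasSum (fun _ : Option k => (0 : ℤ)) 0 := hasSum_zero
      exact this.congr' (fun j => iL_of_isUnit_left _ (hu.map (algebraMap (BiPoly k) (Loc k))))
  · obtain ⟨h1, h2⟩ := h ha hb
    obtain ⟨s1, s2⟩ := F.hasSum_x ha
    have hle := hv hb
    have hm : ∀ j, toLoc k (F.vt (F.v a) b j) =
        toLoc k x ^ (F.v b - F.v a).toNat * toLoc k (F.σ j b) := fun j => by
      rw [vt, map_mul, map_pow]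
    refine ⟨F.v a, fun j => F.σ j a, F.vt (F.v a) b, fun j => F.eq j a ha, fun j => ?_, fun j => ?_,
      ?_⟩
    · rw [F.vt_eq j hb hle, ← mul_assoc, ← zpow_add₀ algebraMap_x_ne_zero, add_neg_cancel, zpow_zero,
        one_mul]
    · rw [hm]; exact (iL_mul_x (s2 j) (h2 j) _).2
    · refine HasSum.congr' ((s1.mul_left ((F.v b - F.v a).toNat : ℤ)).add h1) (fun j => ?_) ?_
      · rw [hm, (iL_mul_x (s2 j) (h2 j) _).1]
      · rw [Int.toNat_of_nonneg (by omega)]; ring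

end ChartFamily

end charts

section surfaces

variable {k K : Type*} [Field k] [IsAlgClosed k] [Field K] [Algebra k K] [Algebra (BiPoly k) K]
  [IsScalarTower k (BiPoly k) K] [IsFractionRing (BiPoly k) K]
  [Algebra (Loc k) K] [IsFractionRing (Loc k) K] [IsScalarTower (BiPoly k) (Loc k) K]

local notation "ι" => algebraMap (BiPoly k) K

theorem iL_eq_zero_of_isRelPrime {a b : Loc k} (h : IsRelPrime a b) (h0 : a = 0 ∨ b = 0) :
    iL a b = 0 := by
  rcases h0 with rfl | rfl
  · exact iL_of_isUnit_right _ (h (dvd_zero _) dvd_rfl)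
  · exact iL_of_isUnit_left _ (h dvd_rfl (dvd_zero _))

theorem isGrad_of_bipoly {w θ : K} {a b : BiPoly k} (h0 : θ ≠ 0) (h1 : IsRelPrime a b)
    (h2 : Dx k K w = θ * ι a) (h3 : Dy k K w = θ * ι b) : IsGrad w θ (toLoc k a) (toLoc k b) :=
  ⟨h0, by rwa [algebraMap_toLoc], by rwa [algebraMap_toLoc], isRelPrime_toLoc h1⟩

theorem blowFam_hasSum_lam {t : (K → ℤ) → K} (ht : IsUnif k t) {w w₂ : K} (hJ : jac k w w₂ ≠ 0) :
    HasSum (fun j => lam k (tw t ((blowFam k K).φ j)) (((blowFam k K).φ j).symm w)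
      (((blowFam k K).φ j).symm w₂)) (lam k t w w₂) := by
  obtain ⟨θ, a, b, h0, h1, h2, h3⟩ := exists_isGrad_bipoly (grad_ne_zero_of_jac hJ)
  have hg := isGrad_of_bipoly h0 h1 h2 h3
  obtain ⟨n, α, β, hα, hβ, hr, h₄⟩ := (blowFam k K).exists_virtual_pair h1
    (N := iL (toLoc k a) (toLoc k b))
    (fun h => iL_eq_zero_of_isRelPrime hg.cop (h.imp (by simp +contextual) (by simp +contextual)))
    (fun ha hb => by
      have := blowFam_hasSum (K := K) ha hb h1
      rw [blowFam_ε, one_mul]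
      exact this)
  refine ((blowFam k K).hasSum_lam (Or.inl rfl) ?_ ?_ ?_ ?_ ht hJ h0 h2 h3 hα hβ hr
    (blowFam_hasSum_kap t ht hJ hJ) (blowFam_hasSum_kap t ht hJ h0) (blowFam_hasSum_kap t ht h0 h0)
    h₄).congr' (fun _ => rfl) ?_
  · intro c; rw [blowFam_some_x, blowFam_ε, zpow_one]
  · intro c; rw [blowFam_some_y, blowFam_ε, zpow_one]
  · rw [blowFam_none_x, blowFam_ε, zpow_one]
  · rw [blowFam_none_y, blowFam_ε, zpow_one]
  · rw [lam_eq t hg hJ, blowFam_ε]; ring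

theorem derivation_add_const (D : Derivation k K K) (f : BiPoly k) (c : k) :
    D (ι (f + algebraMap k _ c)) = D (ι f) := by
  rw [map_add, map_add, ← IsScalarTower.algebraMap_apply, Derivation.map_algebraMap, add_zero]

theorem Dx_tr (a b : k) (w : K) : Dx k K (planeAut (K := K) (tr a b) w) =
    planeAut (K := K) (tr a b) (Dx k K w) := by
  rw [chain_rule, planeAut_algebraMap, planeAut_algebraMap, tr_x, tr_y,
    derivation_add_const, derivation_add_const]
  simp

theorem Dy_tr (a b : k) (w : K) : Dy k K (planeAut (K := K) (tr a b) w) =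
    planeAut (K := K) (tr a b) (Dy k K w) := by
  rw [chain_rule, planeAut_algebraMap, planeAut_algebraMap, tr_x, tr_y,
    derivation_add_const, derivation_add_const]
  simp

theorem infFam_exists_hasSum {a b : BiPoly k} (h1 : IsRelPrime a b) : ∃ S : ℤ,
      HasSum (fun p : k × k => iL (toLoc k (tr p.1 p.2 a)) (toLoc k (tr p.1 p.2 b))) S ∧
      (a = 0 ∨ b = 0 → -S = 0) ∧ (a ≠ 0 → b ≠ 0 →
      HasSum (fun j => iL (toLoc k ((infFam k K).σ j a)) (toLoc k ((infFam k K).σ j b)))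
        (-S - (infFam k K).ε * (infFam k K).v a * (infFam k K).v b) ∧
      ∀ j, IsRelPrime (toLoc k ((infFam k K).σ j a)) (toLoc k ((infFam k K).σ j b))) := by
  have hrel : ∀ q : k × k, IsRelPrime (tr q.1 q.2 a) (tr q.1 q.2 b) := fun q => by
    exact isRelPrime_map (tr q.1 q.2) h1
  by_cases h : a = 0 ∨ b = 0
  · refine ⟨0, (hasSum_zero (α := ℤ) (β := k × k)).congr' fun q => ?_, by simp,
      fun ha hb => (h.elim ha hb).elim⟩
    exact iL_eq_zero_of_isRelPrime (isRelPrime_toLoc (hrel q))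
      (h.imp (fun h => by rw [h, map_zero, map_zero]) (fun h => by rw [h, map_zero, map_zero]))
  · push Not at h
    obtain ⟨⟨S, s1, s2⟩, s3, -⟩ := infFam_hasSum (K := K) h.1 h.2 h1
    refine ⟨S, s1, fun h' => (h'.elim h.1 h.2).elim, fun _ _ => ⟨s2.congr' (fun _ => rfl) ?_, s3⟩⟩
    rw [infFam_ε]; ring

theorem infFam_hasSum_lam {t : (K → ℤ) → K} (ht : IsUnif k t) {w w₂ : K} (hJ : jac k w w₂ ≠ 0) :
    ∃ S, HasSum (fun q : k × k => lam k (tw t (planeAut (K := K) (tr q.1 q.2)).symm)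
        (planeAut (K := K) (tr q.1 q.2) w) (planeAut (K := K) (tr q.1 q.2) w₂)) S ∧
      HasSum (fun j => lam k (tw t ((infFam k K).φ j)) (((infFam k K).φ j).symm w)
        (((infFam k K).φ j).symm w₂)) (12 - S) := by
  obtain ⟨θ, a, b, h0, h1, h2, h3⟩ := exists_isGrad_bipoly (grad_ne_zero_of_jac hJ)
  have hrel : ∀ q : k × k, IsRelPrime (tr q.1 q.2 a) (tr q.1 q.2 b) := fun q => by
    exact isRelPrime_map (tr q.1 q.2) h1
  obtain ⟨S₄, hS₄, hz, hS₄'⟩ := infFam_exists_hasSum (K := K) h1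
  obtain ⟨n, α, β, hα, hβ, hr, h₄⟩ := (infFam k K).exists_virtual_pair h1 hz hS₄'
  obtain ⟨S₁, k₁, l₁⟩ := infFam_hasSum_kap t ht hJ hJ
  obtain ⟨S₂, k₂, l₂⟩ := infFam_hasSum_kap t ht hJ h0
  obtain ⟨S₃, k₃, l₃⟩ := infFam_hasSum_kap t ht h0 h0
  refine ⟨S₁ + S₂ - S₃ + S₄, ?_, ?_⟩
  · refine HasSum.congr' (((k₁.add k₂).sub k₃).add hS₄) (fun q => ?_)
    set Θ : K ≃ₐ[k] K := planeAut (K := K) (tr q.1 q.2) with hΘ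
    have hj : jac k (Θ w) (Θ w₂) = Θ (jac k w w₂) := by
      simp only [jac, hΘ, Dx_tr, Dy_tr, map_sub, map_mul]
    have hj0 : jac k (Θ w) (Θ w₂) ≠ 0 := by rw [hj]; exact (_root_.map_ne_zero _).2 hJ
    have hg : IsGrad (Θ w) (Θ θ) (toLoc k (tr q.1 q.2 a)) (toLoc k (tr q.1 q.2 b)) := by
      refine isGrad_of_bipoly ((_root_.map_ne_zero _).2 h0) (hrel q) ?_ ?_
      · rw [hΘ, Dx_tr, h2, map_mul, planeAut_algebraMap]
      · rw [hΘ, Dy_tr, h3, map_mul, planeAut_algebraMap]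
    rw [lam_eq _ hg hj0, hj]
  · refine ((infFam k K).hasSum_lam (Or.inr rfl) ?_ ?_ ?_ ?_ ht hJ h0 h2 h3 hα hβ hr l₁ l₂ l₃
      h₄).congr' (fun _ => rfl) ?_
    · intro c; rw [infFam_some_x, infFam_ε, zpow_neg_one]
    · intro c; rw [infFam_some_y, infFam_ε, zpow_neg_one]
    · rw [infFam_none_x, infFam_ε, zpow_neg_one]
    · rw [infFam_none_y, infFam_ε, zpow_neg_one]
    · rw [infFam_ε]; ring

end surfaces

theorem coeff_mem_span_of_aeval_eq_zero {B K : Type*} [CommRing B] [IsDomain B]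
    [UniqueFactorizationMonoid B] [Field K] [Algebra B K] [IsFractionRing B K] {a b : B} {z : K}
    (hz : algebraMap B K a * z = algebraMap B K b) (hab : IsRelPrime a b) (s : B[X])
    (hs : aeval z s = 0) (i : ℕ) : s.coeff i ∈ Ideal.span {a, b} := by
  obtain ⟨n, hn⟩ : ∃ n, s.natDegree ≤ n := ⟨_, le_rfl⟩
  induction n generalizing s i with
  | zero =>
    have h1 := eq_C_of_natDegree_le_zero hn
    rw [h1, aeval_C, map_eq_zero_iff _ (IsFractionRing.injective B K)] at hs
    rw [h1, hs]; simp
  | succ n ih =>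
    have hd : a ∣ IsFractionRing.den B z := by
      refine hab.dvd_of_dvd_mul_left (y := b) (z := (IsFractionRing.den B z : B))
        ⟨IsFractionRing.num B z, ?_⟩
      apply IsFractionRing.injective B K
      have h1 := IsFractionRing.mk'_num_den' B z
      have h2 : algebraMap B K (IsFractionRing.den B z) ≠ 0 := by simp
      rw [div_eq_iff h2] at h1
      rw [map_mul, map_mul, h1, ← hz]; ring
    have hc : a ∣ s.coeff (n + 1) := by
      rcases hn.lt_or_eq with h | h
      · rw [coeff_eq_zero_of_natDegree_lt h]; exact dvd_zero _
      · rw [← h]; exact hd.trans (den_dvd_of_is_root hs)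
    obtain ⟨e, he⟩ := hc
    set s' : B[X] := s - C (s.coeff (n + 1)) * X ^ (n + 1) + C (e * b) * X ^ n with hs'
    have h1 : aeval z s' = 0 := by
      simp only [hs', map_add, map_sub, hs, map_mul, aeval_C, map_pow, aeval_X, he, ← hz]
      ring
    have h2 : s'.natDegree ≤ n := by
      rw [natDegree_le_iff_coeff_eq_zero]
      intro m hm
      simp only [hs', coeff_add, coeff_sub, coeff_C_mul, coeff_X_pow]
      rw [if_neg (show m ≠ n by omega)]
      by_cases hm' : m = n + 1
      · simp [hm']
      · rw [coeff_eq_zero_of_natDegree_lt (show s.natDegree < m by omega), if_neg hm']; ring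
    have h3 := ih s' h1 i h2
    have ha : a ∈ Ideal.span {a, b} := Ideal.subset_span (by simp)
    have hb : b ∈ Ideal.span {a, b} := Ideal.subset_span (by simp)
    have h4 : s.coeff i = s'.coeff i + (C (s.coeff (n + 1)) * X ^ (n + 1) : B[X]).coeff i -
        (C (e * b) * X ^ n : B[X]).coeff i := by
      simp only [hs', coeff_add, coeff_sub]; ring
    rw [h4, coeff_C_mul, coeff_C_mul, he]
    exact sub_mem (add_mem h3 (by rw [mul_assoc]; exact Ideal.mul_mem_right _ _ ha))
      (by rw [mul_right_comm]; exact Ideal.mul_mem_left _ _ hb)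

section points

variable {k K : Type*} [Field k] [IsAlgClosed k] [Field K] [Algebra k K] [Algebra (BiPoly k) K]
  [IsScalarTower k (BiPoly k) K] [IsFractionRing (BiPoly k) K]
  [Algebra (Loc k) K] [IsFractionRing (Loc k) K] [IsScalarTower (BiPoly k) (Loc k) K]

local notation "ι" => algebraMap (BiPoly k) K
local notation "ℓ" => algebraMap (Loc k) K

variable (k) in
/-- Membership in the local ring at the origin. -/
def InA (z : K) : Prop := ∃ s : Loc k, ℓ s = z

variable (k) in
/-- Membership in the maximal ideal of the local ring at the origin. -/
def InM (z : K) : Prop := ∃ s : Loc k, ¬ IsUnit s ∧ ℓ s = z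

theorem InM.inA {z : K} (h : InM k z) : InA k z := ⟨_, h.choose_spec.2⟩

theorem InA.add {z w : K} (h : InA k z) (h' : InA k w) : InA k (z + w) := by
  obtain ⟨s, rfl⟩ := h; obtain ⟨s', rfl⟩ := h'; exact ⟨s + s', map_add _ _ _⟩

theorem InA.mul {z w : K} (h : InA k z) (h' : InA k w) : InA k (z * w) := by
  obtain ⟨s, rfl⟩ := h; obtain ⟨s', rfl⟩ := h'; exact ⟨s * s', map_mul _ _ _⟩

theorem inA_algebraMap (c : k) : InA k (algebraMap k K c) := ⟨_, ℓ_algebraMap c⟩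

theorem InM.add {z w : K} (h : InM k z) (h' : InM k w) : InM k (z + w) := by
  obtain ⟨s, hs, rfl⟩ := h; obtain ⟨s', hs', rfl⟩ := h'
  exact ⟨s + s', IsLocalRing.nonunits_add hs hs', map_add _ _ _⟩

theorem InM.neg {z : K} (h : InM k z) : InM k (-z) := by
  obtain ⟨s, hs, rfl⟩ := h
  exact ⟨-s, by simpa using hs, map_neg _ _⟩

theorem InM.sub {z w : K} (h : InM k z) (h' : InM k w) : InM k (z - w) := by
  rw [sub_eq_add_neg]; exact h.add h'.neg

theorem InM.mul_inA {z w : K} (h : InM k z) (h' : InA k w) : InM k (z * w) := by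
  obtain ⟨s, hs, rfl⟩ := h; obtain ⟨s', rfl⟩ := h'
  exact ⟨s * s', fun hu => hs (isUnit_of_mul_isUnit_left hu), map_mul _ _ _⟩

theorem not_inM_of_isUnit {u : Loc k} (hu : IsUnit u) : ¬ InM k (ℓ u) := by
  rintro ⟨s, hs, h⟩
  exact hs (IsFractionRing.injective (Loc k) K h ▸ hu)

theorem not_inM_algebraMap {c : k} (hc : c ≠ 0) : ¬ InM k (algebraMap k K c) := by
  rw [← ℓ_algebraMap]; exact not_inM_of_isUnit (isUnit_algebraMap_loc hc)

theorem not_inM_one : ¬ InM k (1 : K) := by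
  rw [← map_one ℓ]; exact not_inM_of_isUnit isUnit_one

theorem InA.residue {z : K} (h : InA k z) : ∃ c : k, InM k (z - algebraMap k K c) := by
  obtain ⟨s, rfl⟩ := h
  obtain ⟨c, hc⟩ := loc_residue s
  exact ⟨c, _, hc, by rw [map_sub, ℓ_algebraMap]⟩

theorem inM_inv_of_not_inA {z : K} (h : InA k z ∨ InA k z⁻¹) (h' : ¬ InA k z) : InM k z⁻¹ := by
  obtain ⟨s, hs⟩ := h.resolve_left h'
  refine ⟨s, fun hu => h' ?_, hs⟩
  obtain ⟨u, rfl⟩ := hu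
  refine ⟨↑u⁻¹, ?_⟩
  have h1 : ℓ u * ℓ ↑u⁻¹ = 1 := by rw [← map_mul, Units.mul_inv, map_one]
  rw [← inv_inj, ← hs, ← eq_inv_of_mul_eq_one_left h1]

/-- An automorphism mapping the local ring at the origin locally into itself. -/
def LocalAt (θ : K ≃ₐ[k] K) : Prop := InM k (θ (ι x)) ∧ InM k (θ (ι y))

theorem isScalarTower_loc : IsScalarTower k (Loc k) K :=
  IsScalarTower.of_algebraMap_eq fun c => (ℓ_algebraMap c).symm

theorem exists_bsub {θ : K ≃ₐ[k] K} {X Y : Loc k} (hX : ℓ X = θ (ι x)) (hY : ℓ Y = θ (ι y))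
    (f : BiPoly k) : θ (ι f) = ℓ (bsub X Y f) := by
  have := isScalarTower_loc (k := k) (K := K)
  have h : (θ : K →ₐ[k] K).comp (IsScalarTower.toAlgHom k (BiPoly k) K) =
      (IsScalarTower.toAlgHom k (Loc k) K).comp (bsub X Y) := bhom_ext (by simp [hX]) (by simp [hY])
  exact DFunLike.congr_fun h f

theorem LocalAt.exists_hom {θ : K ≃ₐ[k] K} (h : LocalAt θ) : ∃ e : Loc k →+* Loc k,
    (∀ z, θ (ℓ z) = ℓ (e z)) ∧ ∀ z, ¬ IsUnit z → ¬ IsUnit (e z) := by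
  obtain ⟨⟨X, hX, eX⟩, Y, hY, eY⟩ := h
  set g : BiPoly k →ₐ[k] Loc k := bsub X Y with hg
  have hg0 : ∀ f, ev0 f = 0 → ¬ IsUnit (g f) := by
    intro f hf
    obtain ⟨a, b, rfl⟩ := exists_eq_of_ev0_eq_zero hf
    rw [map_add, map_mul, map_mul, hg, bsub_x, bsub_y]
    exact IsLocalRing.nonunits_add (fun h => hX (isUnit_of_mul_isUnit_right h))
      (fun h => hY (isUnit_of_mul_isUnit_right h))
  have hu : ∀ f : (origin k).primeCompl, IsUnit ((g : BiPoly k →+* Loc k) f) := by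
    rintro ⟨f, hf⟩
    have hf : ev0 f ≠ 0 := hf
    by_contra hn
    have h1 := hg0 (algebraMap k _ (ev0 f) - f) (by simp)
    have h2 := IsLocalRing.nonunits_add h1 hn
    rw [map_sub, sub_add_eq_add_sub] at h2
    change ¬ IsUnit (g _ + g f - g f) at h2
    rw [add_sub_cancel_right, AlgHom.commutes] at h2
    exact h2 (isUnit_algebraMap_loc hf)
  refine ⟨IsLocalization.lift hu, ?_, ?_⟩
  · intro z
    obtain ⟨p, q, hq, hz⟩ := loc_exists z
    have h1 := congrArg θ (congrArg ℓ hz)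
    have h2 := congrArg ℓ (congrArg (IsLocalization.lift hu) hz)
    rw [map_mul, algebraMap_toLoc, algebraMap_toLoc, map_mul, exists_bsub eX eY,
      exists_bsub eX eY] at h1
    rw [map_mul, IsLocalization.lift_eq, IsLocalization.lift_eq, map_mul] at h2
    have h3 : ℓ (g q) ≠ 0 := ℓ_ne_zero (hu ⟨q, hq⟩).ne_zero
    exact mul_right_cancel₀ h3 (h1.trans h2.symm)
  · intro z hz
    obtain ⟨a, b, rfl⟩ := mem_maximalIdeal_loc hz
    rw [map_add, map_mul, map_mul, IsLocalization.lift_eq, IsLocalization.lift_eq]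
    refine IsLocalRing.nonunits_add (fun h => hX ?_) (fun h => hY ?_)
    · simpa [hg] using isUnit_of_mul_isUnit_right h
    · simpa [hg] using isUnit_of_mul_isUnit_right h

theorem LocalAt.inA {θ : K ≃ₐ[k] K} (h : LocalAt θ) {z : K} (hz : InA k z) : InA k (θ z) := by
  obtain ⟨e, he, -⟩ := h.exists_hom
  obtain ⟨s, rfl⟩ := hz
  exact ⟨_, (he s).symm⟩

theorem LocalAt.inM {θ : K ≃ₐ[k] K} (h : LocalAt θ) {z : K} (hz : InM k z) : InM k (θ z) := by
  obtain ⟨e, he, he'⟩ := h.exists_hom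
  obtain ⟨s, hs, rfl⟩ := hz
  exact ⟨_, he' s hs, (he s).symm⟩

theorem LocalAt.mul {θ η : K ≃ₐ[k] K} (h : LocalAt θ) (h' : LocalAt η) : LocalAt (θ * η) :=
  ⟨h.inM h'.1, h.inM h'.2⟩

theorem inM_x : InM k (ι x) := ⟨toLoc k x, prime_toLoc_x.not_isUnit, algebraMap_toLoc _⟩

theorem inM_y : InM k (ι y) :=
  ⟨toLoc k y, (prime_toLoc prime_y ev0_y).not_isUnit, algebraMap_toLoc _⟩

theorem localAt_one : LocalAt (1 : K ≃ₐ[k] K) := ⟨inM_x, inM_y⟩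

theorem LocalAt.exists_algEquiv {θ : K ≃ₐ[k] K} (h : LocalAt θ) (h' : LocalAt θ⁻¹) :
    ∃ e : Loc k ≃ₐ[k] Loc k, ∀ z, θ (ℓ z) = ℓ (e z) := by
  obtain ⟨e, he, -⟩ := h.exists_hom
  obtain ⟨e', he', -⟩ := h'.exists_hom
  have hinj := IsFractionRing.injective (Loc k) K
  have h1 : ∀ z, e' (e z) = z := fun z => ?_
  · have h2 : ∀ z, e (e' z) = z := fun z => ?_
    · exact ⟨AlgEquiv.ofRingEquiv (f := RingEquiv.mk ⟨e, e', h1, h2⟩ (map_mul e) (map_add e))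
        fun c => hinj <| (he _).symm.trans (by rw [ℓ_algebraMap, AlgEquiv.commutes]), fun z => he z⟩
    · apply hinj
      rw [← he, ← he']
      exact θ.apply_symm_apply _
  · apply hinj
    rw [← he', ← he]
    exact θ.symm_apply_apply _

theorem blowFam_φ_some_x (c : k) : (blowFam k K).φ (some c) (ι x) = ι x := by
  conv_lhs => rw [← blowFam_some_x (K := K) c]
  exact AlgEquiv.apply_symm_apply _ _

theorem blowFam_φ_some_y (c : k) :
    (blowFam k K).φ (some c) (ι y) = ι y / ι x - algebraMap k K c := by
  have h := congrArg ((blowFam k K).φ (some c)) (blowFam_some_y (K := K) c)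
  rw [AlgEquiv.apply_symm_apply, map_mul, blowFam_φ_some_x, map_add, map_add,
    ← IsScalarTower.algebraMap_apply, AlgEquiv.commutes] at h
  rw [eq_sub_iff_add_eq, eq_div_iff algebraMap_x_ne_zero, mul_comm, ← h]

theorem blowFam_φ_none_x : (blowFam k K).φ none (ι x) = ι y := by
  rw [← AlgEquiv.eq_symm_apply, blowFam_none_y]

theorem blowFam_φ_none_y : (blowFam k K).φ none (ι y) = ι x / ι y := by
  have h := congrArg ((blowFam k K).φ none) (blowFam_none_x (k := k) (K := K))
  rw [AlgEquiv.apply_symm_apply, map_mul, blowFam_φ_none_x] at h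
  rw [eq_div_iff ((algebraMap_bipoly_eq_zero (k := k)).not.2 y_ne_zero), mul_comm, ← h]

theorem infFam_φ_some_x (c : k) : (infFam k K).φ (some c) (ι x) = (ι x)⁻¹ := by
  have h := congrArg ((infFam k K).φ (some c)) (infFam_some_x (K := K) c)
  rw [AlgEquiv.apply_symm_apply, map_inv₀] at h
  rw [eq_comm, inv_eq_iff_eq_inv, ← h]

theorem infFam_φ_some_y (c : k) :
    (infFam k K).φ (some c) (ι y) = ι y / ι x - algebraMap k K c := by
  have h := congrArg ((infFam k K).φ (some c)) (infFam_some_y (K := K) c)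
  rw [AlgEquiv.apply_symm_apply, map_mul, map_inv₀, infFam_φ_some_x, inv_inv, map_add, map_add,
    ← IsScalarTower.algebraMap_apply, AlgEquiv.commutes] at h
  rw [eq_sub_iff_add_eq, eq_div_iff algebraMap_x_ne_zero, mul_comm, ← h]

theorem infFam_φ_none_x : (infFam k K).φ none (ι x) = (ι y)⁻¹ := by
  have h := congrArg ((infFam k K).φ none) (infFam_none_y (k := k) (K := K))
  rw [AlgEquiv.apply_symm_apply, map_inv₀] at h
  rw [eq_comm, inv_eq_iff_eq_inv, ← h]

theorem infFam_φ_none_y : (infFam k K).φ none (ι y) = ι x / ι y := by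
  have h := congrArg ((infFam k K).φ none) (infFam_none_x (k := k) (K := K))
  rw [AlgEquiv.apply_symm_apply, map_mul, map_inv₀, infFam_φ_none_x, inv_inv] at h
  rw [eq_div_iff ((algebraMap_bipoly_eq_zero (k := k)).not.2 y_ne_zero), mul_comm, ← h]

theorem coeff_bsub_C_X (X : Loc k) (f : BiPoly k) (m : ℕ) : ∃ q : Loc k,
    (bsub (C X) Polynomial.X f : (Loc k)[X]).coeff m =
      algebraMap k (Loc k) ((f.coeff 0).coeff m) + X * q := by
  have h1 : (bsub (C X) Polynomial.X f : (Loc k)[X]) =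
      (f.coeff 0).map (algebraMap k (Loc k)) + C X * bsub (C X) Polynomial.X (divX f) := by
    conv_lhs => rw [← divX_mul_X_add f, map_add, map_mul]
    change _ * bsub _ _ x + _ = _
    have h2 : ((bsub (C X) Polynomial.X).comp (CAlgHom (R := k) (A := k[X])) :
        k[X] →ₐ[k] (Loc k)[X]) = mapAlgHom (Algebra.ofId k (Loc k)) := by
      apply Polynomial.algHom_ext
      simp only [AlgHom.comp_apply, CAlgHom_apply]
      change bsub _ _ y = _
      simp
    have h3 := DFunLike.congr_fun h2 (f.coeff 0)
    simp only [AlgHom.comp_apply, CAlgHom_apply] at h3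
    rw [h3, bsub_x, add_comm, mul_comm]
    rfl
  refine ⟨(bsub (C X) Polynomial.X (divX f)).coeff m, ?_⟩
  rw [h1, coeff_add, coeff_map, coeff_C_mul]

/-- Elements of the larger local ring are regular on the exceptional curve of the smaller one. -/
theorem order_le_of_mul_eq {θ : K ≃ₐ[k] K} {X Y d w₁ w₂ r : Loc k} (hX : ℓ X = θ (ι x))
    (hY : ℓ Y = θ (ι y)) (h1 : X = d * w₁) (h2 : Y = d * w₂) (hr : IsRelPrime w₁ w₂)
    (hw₁ : ¬ IsUnit w₁) (hw₂ : ¬ IsUnit w₂) {a b : BiPoly k} (ha : a ≠ 0) (hb : b ≠ 0)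
    (h : ℓ r * θ (ι b) = θ (ι a)) : (blowFam k K).v b ≤ (blowFam k K).v a ∧
      (¬ IsUnit r → (blowFam k K).v b < (blowFam k K).v a) := by
  have := isScalarTower_loc (k := k) (K := K)
  by_contra hcon
  set F := blowFam k K with hF
  have hle : F.v a ≤ F.v b := by
    by_contra! hlt
    exact hcon ⟨hlt.le, fun _ => hlt⟩
  have hm : ¬ IsUnit (r * X ^ (F.v b - F.v a).toNat) := by
    have hXu : ¬ IsUnit X := by
      rw [h1]; exact fun hu => hw₁ (isUnit_of_mul_isUnit_right hu)
    rcases hle.lt_or_eq with hlt | heq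
    · intro hu
      have := isUnit_of_mul_isUnit_right hu
      rw [isUnit_pow_iff (by omega)] at this
      exact hXu this
    · intro hu
      exact hcon ⟨heq.ge, fun hn => (hn (isUnit_of_mul_isUnit_left hu)).elim⟩
  have hx0 : ι x ≠ 0 := algebraMap_x_ne_zero
  have hθx : θ (ι x) ≠ 0 := (_root_.map_ne_zero _).2 hx0
  set z : K := θ (ι y) / θ (ι x) with hz
  set ψ : K ≃ₐ[k] K := θ * F.φ (some 0) with hψ
  have e1 : F.φ (some 0) (ι x) = ι x :=
    blowFam_φ_some_x 0
  have e2 : F.φ (some 0) (ι y) = ι y / ι x := by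
    rw [hF, blowFam_φ_some_y, map_zero, sub_zero]
  have hψf : ∀ f, f ≠ 0 → θ (ι f) = ℓ X ^ F.v f * ψ (ι (F.σ (some 0) f)) := by
    intro f hf
    have := congrArg ψ (F.eq (some 0) f hf)
    rw [map_mul, map_zpow₀] at this
    simp only [hψ, AlgEquiv.mul_apply, AlgEquiv.apply_symm_apply, e1] at this
    rw [this, hX]; rfl
  have hev : ∀ f, ψ (ι f) = aeval z (bsub (C X) Polynomial.X f : (Loc k)[X]) := by
    intro f
    have : (ψ : K →ₐ[k] K).comp (IsScalarTower.toAlgHom k (BiPoly k) K) =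
        ((aeval z : (Loc k)[X] →ₐ[Loc k] K).restrictScalars k).comp (bsub (C X) Polynomial.X) := by
      refine bhom_ext ?_ ?_
      · simp [hψ, e1, hX]
      · simp [hψ, e2, hz]
    exact DFunLike.congr_fun this f
  have hX0 : ℓ X ≠ 0 := by rwa [hX]
  set s : (Loc k)[X] := C (r * X ^ (F.v b - F.v a).toNat) * bsub (C X) Polynomial.X (F.σ (some 0) b) -
    bsub (C X) Polynomial.X (F.σ (some 0) a) with hs
  have hs0 : aeval z s = 0 := by
    rw [hψf a ha, hψf b hb] at h
    rw [hs, map_sub, map_mul, ← hev, ← hev, aeval_C, map_mul, map_pow, ← zpow_natCast,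
      Int.toNat_of_nonneg (by omega), zpow_sub₀ hX0]
    field_simp
    linear_combination h
  have hzw : ℓ w₁ * z = ℓ w₂ := by
    have hd : ℓ d ≠ 0 := by
      intro h0; rw [h1, map_mul, h0, zero_mul] at hX0; exact hX0 rfl
    rw [hz, ← hX, ← hY, h1, h2, map_mul, map_mul]
    rw [h1, map_mul] at hX0
    have := right_ne_zero_of_mul hX0
    field_simp
  have hmem := coeff_mem_span_of_aeval_eq_zero hzw hr s hs0
  have hmax : Ideal.span {w₁, w₂} ≤ IsLocalRing.maximalIdeal (Loc k) := by
    rw [Ideal.span_le]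
    rintro q (rfl | rfl)
    exacts [(IsLocalRing.mem_maximalIdeal _).2 hw₁, (IsLocalRing.mem_maximalIdeal _).2 hw₂]
  apply F.not_dvd (some 0) a ha
  rw [x_dvd_iff]
  ext m
  rw [coeff_zero]
  by_contra hne
  obtain ⟨q, hq⟩ := coeff_bsub_C_X X (F.σ (some 0) a) m
  have h3 := hmax (hmem m)
  rw [IsLocalRing.mem_maximalIdeal, hs, coeff_sub, coeff_C_mul, hq] at h3
  have hXu : ¬ IsUnit X := by
    rw [h1]; exact fun hu => hw₁ (isUnit_of_mul_isUnit_right hu)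
  have h4 : X * q - r * X ^ (F.v b - F.v a).toNat * (bsub (C X) Polynomial.X (F.σ (some 0) b) :
      (Loc k)[X]).coeff m ∈ IsLocalRing.maximalIdeal (Loc k) :=
    sub_mem (Ideal.mul_mem_right _ _ ((IsLocalRing.mem_maximalIdeal _).2 hXu))
      (Ideal.mul_mem_right _ _ ((IsLocalRing.mem_maximalIdeal _).2 hm))
  have h5 := neg_mem (add_mem ((IsLocalRing.mem_maximalIdeal _).2 h3) h4)
  rw [IsLocalRing.mem_maximalIdeal] at h5
  refine h5 ?_
  convert isUnit_algebraMap_loc hne using 1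
  ring

end points

section points

variable {k K : Type*} [Field k] [IsAlgClosed k] [Field K] [Algebra k K] [Algebra (BiPoly k) K]
  [IsScalarTower k (BiPoly k) K] [IsFractionRing (BiPoly k) K]
  [Algebra (Loc k) K] [IsFractionRing (Loc k) K] [IsScalarTower (BiPoly k) (Loc k) K]

local notation "ι" => algebraMap (BiPoly k) K
local notation "ℓ" => algebraMap (Loc k) K

theorem blowFam_v_x : (blowFam k K).v x = 1 := by
  refine ((blowFam k K).vσ_unique (some 0) x_ne_zero (g := 1) ?_ ?_).1
  · exact fun h => prime_x.not_isUnit (isUnit_of_dvd_one h)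
  · rw [blowFam_some_x, zpow_one, map_one, mul_one]

theorem exists_num_den (z : K) : ∃ a b : BiPoly k, b ≠ 0 ∧ IsRelPrime a b ∧ z * ι b = ι a := by
  refine ⟨IsFractionRing.num (BiPoly k) z, IsFractionRing.den (BiPoly k) z, nonZeroDivisors.coe_ne_zero _,
    IsFractionRing.num_den_reduced _ z, ?_⟩
  have := IsFractionRing.mk'_num_den' (BiPoly k) z
  rw [div_eq_iff ((algebraMap_bipoly_eq_zero (k := k)).not.2 (nonZeroDivisors.coe_ne_zero _))] at this
  exact this.symm

/-- A local automorphism that does not factor through the blow-up is an isomorphism. -/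
theorem LocalAt.inv_of_isRelPrime {η : K ≃ₐ[k] K} {X Y : Loc k} (hX : ℓ X = η (ι x))
    (hY : ℓ Y = η (ι y)) (h : LocalAt η) (hr : IsRelPrime X Y) : LocalAt η⁻¹ := by
  obtain ⟨e, he, he'⟩ := h.exists_hom
  have hinj := IsFractionRing.injective (Loc k) K
  have heinj : Function.Injective e := by
    intro s s' hs
    apply hinj
    apply η.injective
    rw [he, he, hs]
  have hex : e (toLoc k x) = X := by
    apply hinj; rw [← he, algebraMap_toLoc, hX]
  have hey : e (toLoc k y) = Y := by
    apply hinj; rw [← he, algebraMap_toLoc, hY]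
  have key : ∀ r : Loc k, ∃ s, η⁻¹ (ℓ r) = ℓ s := by
    intro r
    obtain ⟨a, b, hb, hab, hz⟩ := exists_num_den (k := k) (η⁻¹ (ℓ r))
    have hb0 : ev0 b ≠ 0 := by
      intro hb0
      have h1 : r * e (toLoc k b) = e (toLoc k a) := by
        apply hinj
        rw [map_mul, ← he, ← he, algebraMap_toLoc, algebraMap_toLoc, ← hz, map_mul]
        congr 1
        exact (η.apply_symm_apply _).symm
      have h2 : e (toLoc k b) ≠ 0 := by
        rw [Ne, map_eq_zero_iff e heinj, map_eq_zero_iff _ toLoc_injective]; exact hb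
      obtain ⟨π, hπ, hd⟩ := WfDvdMonoid.exists_irreducible_factor
        (he' _ (fun h => isUnit_toLoc.1 h hb0)) h2
      have hd' : π ∣ e (toLoc k a) := h1 ▸ hd.mul_left r
      have hdd : ∀ t : Loc k, ¬ IsUnit t → π ∣ e t := by
        intro t ht
        obtain ⟨n, hn⟩ := exists_pow_mem_span (inum_loc_ne_top (isRelPrime_toLoc hab)) ht
        obtain ⟨p, q, hpq⟩ := Ideal.mem_span_pair.1 hn
        have := congrArg e hpq
        rw [map_add, map_mul, map_mul, map_pow] at this
        exact hπ.prime.dvd_of_dvd_pow (this ▸ dvd_add (hd'.mul_left _) (hd.mul_left _))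
      refine hπ.not_isUnit (hr (hex ▸ hdd _ prime_toLoc_x.not_isUnit)
        (hey ▸ hdd _ (prime_toLoc prime_y ev0_y).not_isUnit))
    obtain ⟨u, hu⟩ := isUnit_toLoc.2 hb0
    refine ⟨toLoc k a * ↑u⁻¹, ?_⟩
    rw [map_mul, algebraMap_toLoc, ← hz, ← algebraMap_toLoc (K := K) b, ← hu, mul_assoc, ← map_mul,
      Units.mul_inv, map_one, mul_one]
  have key' : ∀ r : Loc k, ¬ IsUnit r → InM k (η⁻¹ (ℓ r)) := by
    intro r hr
    obtain ⟨s, hs⟩ := key r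
    refine ⟨s, fun hu => hr ?_, hs.symm⟩
    have : r = e s := by
      apply hinj
      rw [← he, ← hs]
      exact (η.apply_symm_apply _).symm
    rw [this]; exact hu.map e
  refine ⟨?_, ?_⟩
  · rw [← algebraMap_toLoc]; exact key' _ prime_toLoc_x.not_isUnit
  · rw [← algebraMap_toLoc]; exact key' _ (prime_toLoc prime_y ev0_y).not_isUnit

theorem LocalAt.exists_child {η : K ≃ₐ[k] K} (h : LocalAt η) (h' : ¬ LocalAt η⁻¹) :
    ∃ j, LocalAt (η * (blowFam k K).φ j) := by
  obtain ⟨⟨X, hXu, hX⟩, ⟨Y, hYu, hY⟩⟩ := id h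
  have hx0 : η (ι x) ≠ 0 := (_root_.map_ne_zero _).2 algebraMap_x_ne_zero
  have hy0 : η (ι y) ≠ 0 :=
    (_root_.map_ne_zero _).2 ((algebraMap_bipoly_eq_zero (k := k)).not.2 y_ne_zero)
  have hX0 : X ≠ 0 := by rintro rfl; rw [map_zero] at hX; exact hx0 hX.symm
  obtain ⟨w₁, w₂, d, hr, h1, h2⟩ := UniqueFactorizationMonoid.exists_reduced_factors X hX0 Y
  have hd0 : ℓ d ≠ 0 := ℓ_ne_zero (left_ne_zero_of_mul (h1.trans_ne hX0))
  have hw10 : ℓ w₁ ≠ 0 := ℓ_ne_zero (right_ne_zero_of_mul (h1.trans_ne hX0))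
  by_cases hw₁ : IsUnit w₁
  · obtain ⟨u, hu⟩ := hw₁
    have hA : η (ι y) / η (ι x) = ℓ (w₂ * ↑u⁻¹) := by
      rw [div_eq_iff hx0, ← hX, ← hY, ← h1, ← h2, ← map_mul, ← hu]
      congr 1
      linear_combination (-d * w₂) * u.inv_mul
    obtain ⟨c, hc⟩ := InA.residue (⟨_, hA.symm⟩ : InA k (η (ι y) / η (ι x)))
    refine ⟨some c, ?_, ?_⟩
    · rw [AlgEquiv.mul_apply, blowFam_φ_some_x]; exact h.1
    · rw [AlgEquiv.mul_apply, blowFam_φ_some_y, map_sub, map_div₀, AlgEquiv.commutes]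
      exact hc
  by_cases hw₂ : IsUnit w₂
  · obtain ⟨u, hu⟩ := hw₂
    have hA : η (ι x) / η (ι y) = ℓ (w₁ * ↑u⁻¹) := by
      rw [div_eq_iff hy0, ← hX, ← hY, ← h1, ← h2, ← map_mul, ← hu]
      congr 1
      linear_combination (-d * w₁) * u.inv_mul
    refine ⟨none, ?_, ?_⟩
    · rw [AlgEquiv.mul_apply, blowFam_φ_none_x]; exact h.2
    · rw [AlgEquiv.mul_apply, blowFam_φ_none_y, map_div₀]
      exact ⟨_, fun hu => hw₁ (isUnit_of_mul_isUnit_left hu), hA.symm⟩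
  exfalso
  apply h'
  have hd : IsUnit d := by
    by_contra hd
    obtain ⟨a, b, hb, -, hz⟩ := exists_num_den (k := k) (η⁻¹ (ℓ d))
    obtain ⟨a', b', hb', -, hz'⟩ := exists_num_den (k := k) (η⁻¹ (ℓ w₁))
    have hne : ∀ {s : Loc k} {a b : BiPoly k}, ℓ s ≠ 0 → b ≠ 0 → η⁻¹ (ℓ s) * ι b = ι a → a ≠ 0 := by
      rintro s a b hs hb hab rfl
      rw [map_zero, mul_eq_zero, map_eq_zero, algebraMap_bipoly_eq_zero] at hab
      exact hab.elim hs hb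
    have hη : ∀ {s : Loc k} {a b : BiPoly k}, η⁻¹ (ℓ s) * ι b = ι a → ℓ s * η (ι b) = η (ι a) := by
      intro s a b hab
      rw [← hab, map_mul]
      congr 1
      exact (η.apply_symm_apply _).symm
    have ha := hne hd0 hb hz
    have ha' := hne hw10 hb' hz'
    have e1 := (order_le_of_mul_eq hX hY h1.symm h2.symm hr hw₁ hw₂ ha hb (hη hz)).2 hd
    have e2 := (order_le_of_mul_eq hX hY h1.symm h2.symm hr hw₁ hw₂ ha' hb' (hη hz')).2 hw₁
    have e3 : x * (b * b') = a * a' := by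
      apply algebraMap_bipoly_injective (K := K)
      rw [map_mul, map_mul, map_mul, ← hz, ← hz']
      have : ι x = η⁻¹ (ℓ d) * η⁻¹ (ℓ w₁) := by
        rw [← map_mul, ← map_mul, h1, hX]
        exact (η.symm_apply_apply _).symm
      rw [this]; ring
    have e4 := congrArg (blowFam k K).v e3
    rw [ChartFamily.v_mul _ x_ne_zero (mul_ne_zero hb hb'), ChartFamily.v_mul _ hb hb',
      ChartFamily.v_mul _ ha ha', blowFam_v_x] at e4
    omega
  refine h.inv_of_isRelPrime hX hY ?_
  rw [← h1, ← h2]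
  obtain ⟨u, rfl⟩ := hd
  exact (isRelPrime_mul_unit_left u.isUnit).2 hr

end points

section indeterminacy

variable {k K : Type*} [Field k] [IsAlgClosed k] [Field K] [Algebra k K] [Algebra (BiPoly k) K]
  [IsScalarTower k (BiPoly k) K] [IsFractionRing (BiPoly k) K]
  [Algebra (Loc k) K] [IsFractionRing (Loc k) K] [IsScalarTower (BiPoly k) (Loc k) K]

local notation "ι" => algebraMap (BiPoly k) K
local notation "ℓ" => algebraMap (Loc k) K

variable (k) in
/-- The order of indeterminacy at the origin of a rational function. -/
noncomputable def indet (z : K) : ℤ :=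
  iL (toLoc k (IsFractionRing.num (BiPoly k) z)) (toLoc k (IsFractionRing.den (BiPoly k) z))

variable (k) in
/-- The rational function has a well-defined value, possibly infinite, at the origin. -/
def IsDet (z : K) : Prop := InA k z ∨ InA k z⁻¹

theorem den_spec (z : K) : (IsFractionRing.den (BiPoly k) z : BiPoly k) ≠ 0 ∧
    z * ι (IsFractionRing.den (BiPoly k) z : BiPoly k) = ι (IsFractionRing.num (BiPoly k) z) := by
  have h0 : (IsFractionRing.den (BiPoly k) z : BiPoly k) ≠ 0 := nonZeroDivisors.coe_ne_zero _
  have := IsFractionRing.mk'_num_den' (BiPoly k) z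
  rw [div_eq_iff ((algebraMap_bipoly_eq_zero (k := k)).not.2 h0)] at this
  exact ⟨h0, this.symm⟩

theorem isRelPrime_num_den (z : K) : IsRelPrime (IsFractionRing.num (BiPoly k) z)
    (IsFractionRing.den (BiPoly k) z : BiPoly k) := IsFractionRing.num_den_reduced _ z

theorem indet_eq {z : K} {α β : Loc k} (h : z * ℓ β = ℓ α) (hr : IsRelPrime α β) :
    indet k z = iL α β := by
  obtain ⟨hd, hz⟩ := den_spec (k := k) z
  have hr' := isRelPrime_toLoc (isRelPrime_num_den (k := k) z)
  have e : toLoc k (IsFractionRing.num (BiPoly k) z) * β =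
      α * toLoc k (IsFractionRing.den (BiPoly k) z) := by
    apply IsFractionRing.injective (Loc k) K
    rw [map_mul, map_mul, algebraMap_toLoc, algebraMap_toLoc, ← h, ← hz]; ring
  refine iL_of_associated (associated_of_dvd_dvd ?_ ?_) (associated_of_dvd_dvd ?_ ?_)
  · exact hr'.dvd_of_dvd_mul_right ⟨_, e.symm⟩
  · exact hr.dvd_of_dvd_mul_right ⟨_, e⟩
  · exact hr'.symm.dvd_of_dvd_mul_left ⟨α, by rw [e, mul_comm]⟩
  · exact hr.symm.dvd_of_dvd_mul_left ⟨_, by rw [← e, mul_comm]⟩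

theorem indet_nonneg (z : K) : 0 ≤ indet k z := by
  rw [indet, iL]; exact Int.natCast_nonneg _

theorem indet_eq_zero_iff {z : K} : indet k z = 0 ↔ IsDet k z := by
  have key : ∀ {z : K} {α β : Loc k}, z * ℓ β = ℓ α → IsUnit β → InA k z := by
    rintro z α _ h ⟨β, rfl⟩
    refine ⟨α * ↑β⁻¹, ?_⟩
    rw [map_mul, ← h, mul_assoc, ← map_mul, Units.mul_inv, map_one, mul_one]
  constructor
  · intro h
    obtain ⟨hd, hz⟩ := den_spec (k := k) z
    rw [← algebraMap_toLoc, ← algebraMap_toLoc] at hz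
    have h1 := coe_iL (inum_loc_ne_top (isRelPrime_toLoc (isRelPrime_num_den (k := k) z)))
    change iL _ _ = 0 at h
    rw [h, Int.cast_zero, ENNReal.toReal_eq_zero_iff] at h1
    have h2 := h1.resolve_right (inum_loc_ne_top (isRelPrime_toLoc (isRelPrime_num_den (k := k) z)))
    rw [inum_eq_zero_iff_isUnit] at h2
    rcases h2 with h2 | h2
    · refine Or.inr (key (α := toLoc k (IsFractionRing.den (BiPoly k) z)) ?_ h2)
      have hz0 : z ≠ 0 := by
        rintro rfl
        rw [zero_mul] at hz
        exact ℓ_ne_zero h2.ne_zero hz.symm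
      rw [← hz, inv_mul_cancel_left₀ hz0]
    · exact Or.inl (key hz h2)
  · rintro (⟨s, hs⟩ | ⟨s, hs⟩)
    · rw [indet_eq (α := s) (β := 1) (by rw [map_one, mul_one, hs]) isRelPrime_one_right,
        iL_of_isUnit_right _ isUnit_one]
    · by_cases hz : z = 0
      · rw [indet_eq (α := 0) (β := 1) (by rw [hz]; simp) isRelPrime_one_right,
          iL_of_isUnit_right _ isUnit_one]
      · rw [indet_eq (α := 1) (β := s) (by rw [hs, map_one, mul_inv_cancel₀ hz]) isRelPrime_one_left,
          iL_of_isUnit_left _ isUnit_one]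

theorem ChartFamily.indet_child {J : Type*} (F : ChartFamily k K J) {z : K} {j : J} {n : ℤ}
    {α β : BiPoly k} (h : (F.φ j).symm (ι (IsFractionRing.num (BiPoly k) z)) = ι x ^ n * ι α)
    (h' : (F.φ j).symm (ι (IsFractionRing.den (BiPoly k) z : BiPoly k)) = ι x ^ n * ι β)
    (hr : IsRelPrime (toLoc k α) (toLoc k β)) :
    indet k ((F.φ j).symm z) = iL (toLoc k α) (toLoc k β) := by
  refine indet_eq ?_ hr
  have hx : (ι x : K) ^ n ≠ 0 := zpow_ne_zero _ algebraMap_x_ne_zero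
  apply mul_left_cancel₀ hx
  rw [algebraMap_toLoc, algebraMap_toLoc, ← h, ← (den_spec (k := k) z).2, map_mul, h']
  ring

theorem exists_hasSum_indet_blowFam (z : K) : ∃ n : ℤ, (indet k z ≠ 0 → n ≠ 0) ∧
    HasSum (fun j => indet k (((blowFam k K).φ j).symm z)) (indet k z - n ^ 2) := by
  have h1 := isRelPrime_num_den (k := k) z
  obtain ⟨n, α, β, hα, hβ, hr, h₄⟩ := (blowFam k K).exists_virtual_pair h1
    (N := indet k z)
    (fun h => iL_eq_zero_of_isRelPrime (isRelPrime_toLoc h1)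
      (h.imp (fun h => by rw [h, map_zero]) (fun h => by rw [h, map_zero])))
    (fun ha hb => by
      have := blowFam_hasSum (K := K) ha hb h1
      rw [blowFam_ε, one_mul]
      exact this)
  refine ⟨n, ?_, h₄.congr' (fun j => (blowFam k K).indet_child (hα j) (hβ j) (hr j)) ?_⟩
  · rintro hz rfl
    have hpoly : ∀ f : BiPoly k, ∃ g : BiPoly k, ((blowFam k K).φ (some 0)).symm (ι f) = ι g := by
      intro f
      by_cases hf : f = 0
      · exact ⟨0, by rw [hf]; simp⟩
      refine ⟨x ^ ((blowFam k K).v f).toNat * (blowFam k K).σ (some 0) f, ?_⟩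
      have h2 := (blowFam k K).nonneg f hf
      rw [blowFam_ε, one_mul] at h2
      rw [(blowFam k K).eq _ _ hf, map_mul, map_pow, ← zpow_natCast, Int.toNat_of_nonneg h2]
    have hdvd : ∀ {f g : BiPoly k}, ¬ IsUnit (toLoc k f) →
        ((blowFam k K).φ (some 0)).symm (ι f) = ι x ^ (0 : ℤ) * ι g → toLoc k x ∣ toLoc k g := by
      intro f g hf hg
      rw [isUnit_toLoc, not_not] at hf
      obtain ⟨p, q, rfl⟩ := exists_eq_of_ev0_eq_zero hf
      obtain ⟨p', hp⟩ := hpoly p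
      obtain ⟨q', hq⟩ := hpoly q
      refine map_dvd (toLoc k) ⟨p' + q' * (y + algebraMap k _ 0), ?_⟩
      apply algebraMap_bipoly_injective (K := K)
      rw [zpow_zero, one_mul] at hg
      rw [← hg, map_add, map_mul, map_mul, map_add, map_mul, map_mul, hp, hq, blowFam_some_x,
        blowFam_some_y]
      simp only [map_mul, map_add]
      ring
    have hu : ¬ (IsUnit (toLoc k (IsFractionRing.num (BiPoly k) z)) ∨
        IsUnit (toLoc k (IsFractionRing.den (BiPoly k) z : BiPoly k))) := by
      rintro (hu | hu)
      · exact hz (iL_of_isUnit_left _ hu)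
      · exact hz (iL_of_isUnit_right _ hu)
    push Not at hu
    exact prime_toLoc_x.not_isUnit (hr (some 0) (hdvd hu.1 (hα _)) (hdvd hu.2 (hβ _)))
  · rw [blowFam_ε, one_mul]

theorem exists_hasSum_indet_infFam (z : K) : ∃ S T : ℤ,
    HasSum (fun q : k × k => indet k (planeAut (K := K) (tr q.1 q.2) z)) S ∧
    HasSum (fun j => indet k (((infFam k K).φ j).symm z)) T := by
  have h1 := isRelPrime_num_den (k := k) z
  obtain ⟨S, hS, hz, hS'⟩ := infFam_exists_hasSum (K := K) h1
  obtain ⟨n, α, β, hα, hβ, hr, h₄⟩ := (infFam k K).exists_virtual_pair h1 hz hS'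
  refine ⟨S, _, hS.congr' (fun q => ?_),
    h₄.congr' (fun j => (infFam k K).indet_child (hα j) (hβ j) (hr j)) rfl⟩
  refine indet_eq ?_ (isRelPrime_toLoc (isRelPrime_map (tr q.1 q.2) h1))
  rw [algebraMap_toLoc, algebraMap_toLoc, ← planeAut_algebraMap, ← planeAut_algebraMap, ← map_mul,
    (den_spec (k := k) z).2]

end indeterminacy

/-- A preordered set with a forest structure in which all but finitely many vertices are good. -/
structure PointTree (Γ R J : Type*) where
  le : Γ → Γ → Prop
  root : R → Γ
  child : Γ → J → Γ
  good : Γ → Prop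
  refl : ∀ φ, le φ φ
  trans : ∀ {φ ψ χ}, le φ ψ → le ψ χ → le φ χ
  le_child : ∀ φ j, le φ (child φ j)
  child_unique : ∀ {φ ψ i j}, le (child φ i) ψ → le (child φ j) ψ → i = j
  exists_child : ∀ {φ ψ}, le φ ψ → ¬ le ψ φ → ∃ j, le (child φ j) ψ
  root_unique : ∀ {ψ r s}, le (root r) ψ → le (root s) ψ → r = s
  exists_root : ∀ {ψ}, good ψ → ∃ r, le (root r) ψ
  good_mono : ∀ {φ ψ}, le φ ψ → good φ → good ψ

namespace PointTree

variable {Γ R J : Type*} (P : PointTree Γ R J)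

/-- The vertex with given root and path, the last step of the path coming first. -/
def pt (r : R) : List J → Γ
  | [] => P.root r
  | j :: l => P.child (pt r l) j

/-- The bad vertices. -/
def bad : Set (R × List J) := {a | ¬ P.good (P.pt a.1 a.2)}

/-- The first good vertices. -/
def leaves : Set (R × List J) :=
  {a | P.good (P.pt a.1 a.2) ∧ ∀ j l, a.2 = j :: l → ¬ P.good (P.pt a.1 l)}

theorem notMem_bad {r : R} {l : List J} (h : P.good (P.pt r l)) : (r, l) ∉ P.bad := fun h' => h' h

theorem pt_le_of_suffix (r : R) {l m : List J} (h : l <:+ m) : P.le (P.pt r l) (P.pt r m) := by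
  obtain ⟨t, rfl⟩ := h
  induction t with
  | nil => exact P.refl _
  | cons j t ih => exact P.trans ih (P.le_child _ _)

theorem suffix_or_suffix {r : R} {ψ : Γ} {l m : List J} (hl : P.le (P.pt r l) ψ)
    (hm : P.le (P.pt r m) ψ) : l <:+ m ∨ m <:+ l := by
  induction l with
  | nil => exact Or.inl (List.nil_suffix)
  | cons j l ih =>
    rcases ih (P.trans (P.le_child _ _) hl) with h | h
    · obtain ⟨t, rfl⟩ := h
      rcases List.eq_nil_or_concat t with rfl | ⟨t', i, rfl⟩
      · exact Or.inr (List.suffix_cons j l)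
      · left
        have e : t' ++ [i] ++ l = t' ++ i :: l := by simp
        rw [List.concat_eq_append] at hm ⊢
        have h1 : P.le (P.pt r (i :: l)) ψ :=
          P.trans (P.pt_le_of_suffix r (List.suffix_append t' _)) (e ▸ hm)
        rw [P.child_unique hl h1, e]
        exact List.suffix_append _ _
    · exact Or.inr (h.trans (List.suffix_cons j l))

theorem leaf_unique {ψ : Γ} {a b : R × List J} (ha : a ∈ P.leaves) (hb : b ∈ P.leaves)
    (ha' : P.le (P.pt a.1 a.2) ψ) (hb' : P.le (P.pt b.1 b.2) ψ) : a = b := by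
  obtain ⟨r, l⟩ := a
  obtain ⟨s, m⟩ := b
  obtain rfl : r = s := P.root_unique
    (P.trans (P.pt_le_of_suffix r List.nil_suffix) ha')
    (P.trans (P.pt_le_of_suffix s List.nil_suffix) hb')
  have key : ∀ {l m : List J}, (r, l) ∈ P.leaves → (r, m) ∈ P.leaves → l <:+ m → l = m := by
    intro l m hl hm h
    cases m with
    | nil => exact List.suffix_nil.1 h
    | cons j m =>
      rcases List.suffix_cons_iff.1 h with h | h
      · exact h
      · exact (hm.2 j m rfl (P.good_mono (P.pt_le_of_suffix r h) hl.1)).elim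
  rcases P.suffix_or_suffix ha' hb' with h | h
  · rw [key ha hb h]
  · rw [key hb ha h]

theorem exists_leaf (hfin : P.bad.Finite) {ψ : Γ} (hψ : P.good ψ) :
    ∃ a ∈ P.leaves, P.le (P.pt a.1 a.2) ψ := by
  obtain ⟨r, hr⟩ := P.exists_root hψ
  obtain ⟨M, hM⟩ := (hfin.image fun a => a.2.length).bddAbove
  have key : ∀ (n : ℕ) (l : List J), M + 1 ≤ l.length + n → P.le (P.pt r l) ψ →
      (∀ j m, l = j :: m → ¬ P.good (P.pt r m)) → ∃ a ∈ P.leaves, P.le (P.pt a.1 a.2) ψ := by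
    intro n
    induction n with
    | zero =>
      intro l hl hle h
      refine ⟨(r, l), ⟨?_, h⟩, hle⟩
      by_contra hb
      have := hM ⟨(r, l), hb, rfl⟩
      simp only at this
      omega
    | succ n ih =>
      intro l hl hle h
      by_cases hg : P.good (P.pt r l)
      · exact ⟨(r, l), ⟨hg, h⟩, hle⟩
      · obtain ⟨j, hj⟩ := P.exists_child hle fun h' => hg (P.good_mono h' hψ)
        refine ih (j :: l) (by simp; omega) hj ?_
        rintro _ _ ⟨⟩
        exact hg
  exact key (M + 1) [] (by simp) hr (by simp)

theorem hasSum_leaves (hfin : P.bad.Finite) {f : Γ → ℤ} {N : ℤ}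
    (hroot : HasSum (fun r => f (P.root r)) N)
    (hchild : ∀ φ, HasSum (fun j => f (P.child φ j)) (f φ)) :
    HasSum (fun a : P.leaves => f (P.pt a.1.1 a.1.2)) N := by
  classical
  set F : R × List J → ℤ := fun a => f (P.pt a.1 a.2) with hF
  have h1 : HasSum (fun a : R × List J => if a.2 = [] then F a else 0) N := by
    refine (Function.Injective.hasSum_iff (g := fun r : R => (r, ([] : List J)))
      (fun r s h => congrArg Prod.fst h) ?_).1 (hroot.congr' (fun r => by simp [hF, pt]) rfl)
    rintro ⟨r, l⟩ h
    rw [if_neg]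
    rintro (rfl : l = [])
    exact h ⟨r, rfl⟩
  have h2 : ∀ b : R × List J, HasSum (fun a : R × List J =>
      if a.1 = b.1 ∧ ∃ j, a.2 = j :: b.2 then F a else 0) (F b) := by
    intro b
    refine (Function.Injective.hasSum_iff (g := fun j : J => (b.1, j :: b.2))
      (fun r s h => (List.cons.inj (congrArg Prod.snd h)).1) ?_).1
      ((hchild (P.pt b.1 b.2)).congr' (fun r => by simp [hF, pt]) rfl)
    rintro ⟨r, l⟩ h
    rw [if_neg]
    rintro ⟨rfl : r = b.1, j, rfl : l = j :: b.2⟩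
    exact h ⟨j, rfl⟩
  have h3 := hasSum_sum (s := hfin.toFinset) fun b _ => h2 b
  have h4 : HasSum (fun a => if a ∈ P.bad then F a else 0) (∑ b ∈ hfin.toFinset, F b) := by
    have := hasSum_sum_of_ne_finset_zero (f := fun a => if a ∈ P.bad then F a else 0)
      (s := hfin.toFinset) (fun b hb => if_neg (by simpa using hb))
      (L := SummationFilter.unconditional _)
    refine this.congr' (fun _ => rfl) (Finset.sum_congr rfl fun b hb => ?_)
    rw [if_pos (by simpa using hb)]
  have h5 := (h1.add h3).sub h4
  rw [add_sub_cancel_right] at h5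
  refine (Function.Injective.hasSum_iff (g := fun a : P.leaves => a.1) Subtype.val_injective
    (f := fun a => (if a ∈ P.leaves then F a else 0)) ?_).2 (h5.congr' (fun a => ?_) rfl)
      |>.congr' (fun a => (if_pos a.2).symm) rfl
  · intro a ha
    exact if_neg fun h => ha ⟨⟨a, h⟩, rfl⟩
  · obtain ⟨r, l⟩ := a
    cases l with
    | nil =>
      have : ∑ b ∈ hfin.toFinset, (if r = b.1 ∧ ∃ j, ([] : List J) = j :: b.2 then F (r, [])
          else 0) = 0 := Finset.sum_eq_zero fun b _ => if_neg (by simp)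
      simp only [this, if_true, add_zero]
      by_cases hg : P.good (P.pt r [])
      · rw [if_pos ⟨hg, by simp⟩, if_neg (P.notMem_bad hg), sub_zero]
      · rw [if_neg fun h => hg h.1, if_pos (show (r, []) ∈ P.bad from hg), sub_self]
    | cons j l =>
      have : ∑ b ∈ hfin.toFinset, (if r = b.1 ∧ ∃ i, j :: l = i :: b.2 then F (r, j :: l)
          else 0) = if (r, l) ∈ P.bad then F (r, j :: l) else 0 := by
        have : ∀ b : R × List J, (r = b.1 ∧ ∃ i, j :: l = i :: b.2) ↔ b = (r, l) := by
          rintro ⟨s, m⟩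
          simp only [List.cons.injEq, Prod.mk.injEq]
          constructor
          · rintro ⟨rfl, i, -, rfl⟩; simp
          · rintro ⟨rfl, rfl⟩; simp
        simp only [this, Finset.sum_ite_eq', Set.Finite.mem_toFinset]
      simp only [this, reduceCtorEq, if_false, zero_add]
      by_cases hl : P.good (P.pt r l)
      · have hg := P.good_mono (P.le_child _ j) hl
        rw [if_neg fun h => h.2 j l rfl hl, if_neg (P.notMem_bad hl),
          if_neg (P.notMem_bad (l := j :: l) hg), sub_zero]
      · rw [if_pos (show (r, l) ∈ P.bad from hl)]
        by_cases hg : P.good (P.pt r (j :: l))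
        · have hj : (r, j :: l) ∈ P.leaves := ⟨hg, by rintro _ _ ⟨⟩; exact hl⟩
          rw [if_pos hj, if_neg (P.notMem_bad (l := j :: l) hg), sub_zero]
        · rw [if_neg fun h => hg h.1, if_pos (show (r, j :: l) ∈ P.bad from hg), sub_self]

end PointTree

theorem dvd_of_hasSum_of_dvd_card_orbit {G α : Type*} [Group G] [MulAction G α] {f : α → ℤ} {N : ℤ}
    {n : ℕ} (hf : HasSum f N) (hinv : ∀ (g : G) a, f (g • a) = f a)
    (hn : ∀ a : α, n ∣ Nat.card (MulAction.orbit G a)) : (n : ℤ) ∣ N := by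
  classical
  have hfin : f.support.Finite := by
    have := hf.summable.tendsto_cofinite_zero
    rw [nhds_discrete, Filter.tendsto_pure] at this
    exact this
  have h1 : N = ∑ a ∈ hfin.toFinset, f a :=
    hf.unique (hasSum_sum_of_ne_finset_zero (fun b hb => by simpa using hb))
  rw [h1, Finset.sum_partition (MulAction.orbitRel G α)]
  refine Finset.dvd_sum fun q hq => ?_
  obtain ⟨a, ha, rfl⟩ := Finset.mem_image.1 hq
  have h2 : ((hfin.toFinset.filter fun b => (Quotient.mk (MulAction.orbitRel G α) b) =
      Quotient.mk (MulAction.orbitRel G α) a : Finset α) : Set α) = MulAction.orbit G a := by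
    ext b
    simp only [Finset.coe_filter, Set.mem_ofPred_eq, Quotient.eq, MulAction.orbitRel_apply,
      and_iff_right_iff_imp]
    rintro ⟨g, rfl⟩
    simp only [Set.Finite.mem_toFinset, Function.mem_support] at ha ⊢
    change f (g • a) ≠ 0
    rwa [hinv]
  have h3 : ∀ b ∈ hfin.toFinset.filter fun b => (Quotient.mk (MulAction.orbitRel G α) b) =
      Quotient.mk (MulAction.orbitRel G α) a, f b = f a := by
    intro b hb
    have : b ∈ MulAction.orbit G a := h2 ▸ hb
    obtain ⟨g, rfl⟩ := this
    exact hinv g a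
  have h4 := hn a
  rw [← h2, Nat.card_coe_set_eq, Set.ncard_coe_finset] at h4
  rw [Finset.sum_congr rfl h3, Finset.sum_const, nsmul_eq_mul]
  exact (Int.natCast_dvd_natCast.2 h4).mul_right _

namespace PointTree

variable {Γ R J : Type*} (P : PointTree Γ R J)

theorem dvd_of_action {G : Type*} [Group G] [MulAction G Γ]
    (hle : ∀ (g : G) {φ ψ}, P.le φ ψ → P.le (g • φ) (g • ψ))
    (hgood : ∀ (g : G) {φ}, P.good φ → P.good (g • φ))
    (hfin : P.bad.Finite) {f : Γ → ℤ} {N : ℤ}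
    (hroot : HasSum (fun r => f (P.root r)) N)
    (hchild : ∀ φ, HasSum (fun j => f (P.child φ j)) (f φ))
    (hequiv : ∀ φ ψ, P.le φ ψ → P.le ψ φ → f φ = f ψ)
    (hinv : ∀ (g : G) φ, f (g • φ) = f φ) {n : ℕ}
    (hstab : ∀ (φ : Γ) (S : Subgroup G), (∀ g ∈ S, P.le (g • φ) φ ∧ P.le φ (g • φ)) →
      n * Nat.card S ∣ Nat.card G) [Finite G] : (n : ℤ) ∣ N := by
  let p : P.leaves → Γ := fun a => P.pt a.1.1 a.1.2
  have hex : ∀ {ψ}, P.good ψ → ∃ a, P.le (p a) ψ := fun h => by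
    obtain ⟨a, ha, h'⟩ := P.exists_leaf hfin h
    exact ⟨⟨a, ha⟩, h'⟩
  have hun : ∀ {ψ a b}, P.le (p a) ψ → P.le (p b) ψ → a = b := fun {ψ a b} h h' =>
    Subtype.ext (P.leaf_unique a.2 b.2 h h')
  choose act hact using fun (g : G) (a : P.leaves) => hex (hgood g a.2.1)
  have hact' : ∀ g a, P.le (g • p a) (p (act g a)) := by
    intro g a
    obtain ⟨b, hb⟩ := hex (hgood g⁻¹ (act g a).2.1)
    have h1 := hle g⁻¹ (hact g a)
    rw [inv_smul_smul] at h1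
    have : b = a := hun (P.trans hb h1) (P.refl _)
    have h2 := hle g hb
    rwa [smul_inv_smul, this] at h2
  let _ : MulAction G P.leaves :=
    { smul := act
      one_smul := fun a => hun (ψ := p a) (by have := hact 1 a; rwa [one_smul] at this) (P.refl _)
      mul_smul := fun g h a => hun (ψ := (g * h) • p a) (hact _ a) (by
        rw [mul_smul]
        exact P.trans (hact g (act h a)) (hle g (hact h a))) }
  refine dvd_of_hasSum_of_dvd_card_orbit (G := G) (P.hasSum_leaves hfin hroot hchild) ?_ ?_
  · intro g a
    change f (p (act g a)) = f (p a)
    rw [hequiv _ _ (hact g a) (hact' g a), hinv]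
  · intro a
    have h1 := hstab (p a) (MulAction.stabilizer G a) (fun g hg => by
      have h2 : act g a = a := hg
      have h3 := hact g a
      have h4 := hact' g a
      rw [h2] at h3 h4
      exact ⟨h4, h3⟩)
    have h3 : Nat.card (MulAction.orbit G a) * Nat.card (MulAction.stabilizer G a) = Nat.card G := by
      rw [← Nat.card_prod, Nat.card_congr (MulAction.orbitProdStabilizerEquivGroup G a)]
    rw [← h3] at h1
    exact Nat.dvd_of_mul_dvd_mul_right Nat.card_pos h1

end PointTree

section tree

variable {k K : Type*} [Field k] [IsAlgClosed k] [Field K] [Algebra k K] [Algebra (BiPoly k) K]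
  [IsScalarTower k (BiPoly k) K] [IsFractionRing (BiPoly k) K]
  [Algebra (Loc k) K] [IsFractionRing (Loc k) K] [IsScalarTower (BiPoly k) (Loc k) K]

local notation "ι" => algebraMap (BiPoly k) K
local notation "ℓ" => algebraMap (Loc k) K

variable (k) in
/-- The value of a function at the origin is a given point of the projective line. -/
def HasValue (z : K) : Option k → Prop
  | some c => InM k (z - algebraMap k K c)
  | none => InM k z⁻¹

theorem InM.eq_of_sub {z : K} {c d : k} (hc : InM k (z - algebraMap k K c))
    (hd : InM k (z - algebraMap k K d)) : c = d := by
  by_contra h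
  refine not_inM_algebraMap (K := K) (sub_ne_zero.2 h) ?_
  convert hd.sub hc using 1
  rw [map_sub]
  ring

theorem InM.inA_of_sub {z : K} {c : k} (h : InM k (z - algebraMap k K c)) : InA k z := by
  have := h.inA.add (inA_algebraMap c)
  rwa [sub_add_cancel] at this

theorem InM.not_inA_of_inv {z : K} (hz : z ≠ 0) (h : InM k z⁻¹) : ¬ InA k z := fun h' => by
  have := h.mul_inA h'
  rw [inv_mul_cancel₀ hz] at this
  exact not_inM_one this

theorem HasValue.unique {z : K} (hz : z ≠ 0) {i j : Option k} (hi : HasValue k z i)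
    (hj : HasValue k z j) : i = j := by
  cases i with
  | none =>
    cases j with
    | none => rfl
    | some d => exact (hi.not_inA_of_inv hz (InM.inA_of_sub hj)).elim
  | some c =>
    cases j with
    | none => exact (hj.not_inA_of_inv hz (InM.inA_of_sub hi)).elim
    | some d => rw [InM.eq_of_sub hi hj]

theorem IsDet.exists_hasValue {z : K} (h : IsDet k z) : ∃ j, HasValue k z j := by
  by_cases hz : InA k z
  · obtain ⟨c, hc⟩ := hz.residue
    exact ⟨some c, hc⟩
  · exact ⟨none, inM_inv_of_not_inA h hz⟩

theorem LocalAt.isDet {θ : K ≃ₐ[k] K} (h : LocalAt θ) {z : K} (hz : IsDet k z) :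
    IsDet k (θ z) := by
  rcases hz with hz | hz
  · exact Or.inl (h.inA hz)
  · refine Or.inr ?_
    rw [← map_inv₀]
    exact h.inA hz

theorem inA_algebraMap_bipoly (f : BiPoly k) : InA k (ι f) := ⟨toLoc k f, algebraMap_toLoc _⟩

theorem localAt_blowFam (j : Option k) : LocalAt ((blowFam k K).φ j)⁻¹ := by
  cases j with
  | none =>
    refine ⟨?_, ?_⟩
    · change InM k (((blowFam k K).φ none).symm (ι x))
      rw [blowFam_none_x]
      exact inM_x.mul_inA (inA_algebraMap_bipoly _)
    · change InM k (((blowFam k K).φ none).symm (ι y))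
      rw [blowFam_none_y]
      exact inM_x
  | some c =>
    refine ⟨?_, ?_⟩
    · change InM k (((blowFam k K).φ (some c)).symm (ι x))
      rw [blowFam_some_x]
      exact inM_x
    · change InM k (((blowFam k K).φ (some c)).symm (ι y))
      rw [blowFam_some_y]
      exact inM_x.mul_inA (inA_algebraMap_bipoly _)

theorem hasValue_of_localAt_blowFam {θ : K ≃ₐ[k] K} {j : Option k}
    (h : LocalAt (θ * (blowFam k K).φ j)) : HasValue k (θ (ι y / ι x)) j := by
  cases j with
  | none =>
    have := h.2
    rw [AlgEquiv.mul_apply, blowFam_φ_none_y] at this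
    change InM k (_)⁻¹
    rwa [← map_inv₀, inv_div]
  | some c =>
    have := h.2
    rwa [AlgEquiv.mul_apply, blowFam_φ_some_y, map_sub, AlgEquiv.commutes] at this

theorem localAt_infFam_iff {θ : K ≃ₐ[k] K} {j : Option k} :
    LocalAt (θ * (infFam k K).φ j) ↔ HasValue k (θ (ι y / ι x)) j ∧
      InM k (θ (ι (if j = none then y else x)))⁻¹ := by
  cases j with
  | none =>
    simp only [LocalAt, HasValue, AlgEquiv.mul_apply, infFam_φ_none_y, infFam_φ_none_x,
      ← map_inv₀, inv_div, if_true, and_comm]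
  | some c =>
    simp only [LocalAt, HasValue, AlgEquiv.mul_apply, infFam_φ_some_y, infFam_φ_some_x,
      map_inv₀, map_sub, AlgEquiv.commutes, reduceCtorEq, if_false, and_comm]

theorem localAt_planeAut_iff {θ : K ≃ₐ[k] K} {a b : k} :
    LocalAt (θ * (planeAut (tr a b)).symm) ↔ InM k (θ (ι x) - algebraMap k K a) ∧
      InM k (θ (ι y) - algebraMap k K b) := by
  have hx : (planeAut (tr a b) : K ≃ₐ[k] K).symm (ι x) = ι x - algebraMap k K a := by
    rw [AlgEquiv.symm_apply_eq, map_sub, planeAut_algebraMap, tr_x, map_add, AlgEquiv.commutes,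
      ← IsScalarTower.algebraMap_apply, add_sub_cancel_right]
  have hy : (planeAut (tr a b) : K ≃ₐ[k] K).symm (ι y) = ι y - algebraMap k K b := by
    rw [AlgEquiv.symm_apply_eq, map_sub, planeAut_algebraMap, tr_y, map_add, AlgEquiv.commutes,
      ← IsScalarTower.algebraMap_apply, add_sub_cancel_right]
  simp only [LocalAt, AlgEquiv.mul_apply, hx, hy, map_sub, AlgEquiv.commutes]

variable (k K) in
/-- The charts at the points of the projective plane. -/
noncomputable def planeRoot : (k × k) ⊕ Option k → (K ≃ₐ[k] K)
  | Sum.inl q => (planeAut (tr q.1 q.2)).symm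
  | Sum.inr j => (infFam k K).φ j

theorem ι_y_ne_zero : ι y ≠ 0 := (algebraMap_bipoly_eq_zero (k := k)).not.2 y_ne_zero

theorem div_ne_zero_image (θ : K ≃ₐ[k] K) : θ (ι y / ι x) ≠ 0 :=
  (_root_.map_ne_zero _).2 (div_ne_zero ι_y_ne_zero algebraMap_x_ne_zero)

theorem planeRoot_unique {θ : K ≃ₐ[k] K} {r s : (k × k) ⊕ Option k}
    (hr : LocalAt (θ * planeRoot k K r)) (hs : LocalAt (θ * planeRoot k K s)) : r = s := by
  have key : ∀ (q : k × k) (j : Option k), LocalAt (θ * planeRoot k K (Sum.inl q)) →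
      LocalAt (θ * planeRoot k K (Sum.inr j)) → False := by
    intro q j hq hj
    have hq := localAt_planeAut_iff.1 hq
    have hj := (localAt_infFam_iff.1 hj).2
    refine hj.not_inA_of_inv ((_root_.map_ne_zero _).2 ?_) ?_
    · split_ifs
      exacts [ι_y_ne_zero, algebraMap_x_ne_zero]
    · split_ifs
      exacts [InM.inA_of_sub hq.2, InM.inA_of_sub hq.1]
  rcases r with ⟨a, b⟩ | i <;> rcases s with ⟨c, d⟩ | j
  · have h1 := localAt_planeAut_iff.1 hr
    have h2 := localAt_planeAut_iff.1 hs
    exact congrArg Sum.inl (Prod.ext (InM.eq_of_sub h1.1 h2.1) (InM.eq_of_sub h1.2 h2.2))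
  · exact (key _ _ hr hs).elim
  · exact (key _ _ hs hr).elim
  · rw [(localAt_infFam_iff.1 hr).1.unique (div_ne_zero_image θ) (localAt_infFam_iff.1 hs).1]

theorem exists_planeRoot {θ : K ≃ₐ[k] K} (hx : IsDet k (θ (ι x))) (hy : IsDet k (θ (ι y)))
    (hz : IsDet k (θ (ι y / ι x))) : ∃ r, LocalAt (θ * planeRoot k K r) := by
  have hx0 : θ (ι x) ≠ 0 := (_root_.map_ne_zero _).2 algebraMap_x_ne_zero
  have hy0 : θ (ι y) ≠ 0 := (_root_.map_ne_zero _).2 ι_y_ne_zero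
  by_cases h : InA k (θ (ι x)) ∧ InA k (θ (ι y))
  · obtain ⟨a, ha⟩ := h.1.residue
    obtain ⟨b, hb⟩ := h.2.residue
    exact ⟨Sum.inl (a, b), localAt_planeAut_iff.2 ⟨ha, hb⟩⟩
  · obtain ⟨j, hj⟩ := hz.exists_hasValue
    refine ⟨Sum.inr j, localAt_infFam_iff.2 ⟨hj, ?_⟩⟩
    cases j with
    | none =>
      simp only [if_true]
      refine inM_inv_of_not_inA hy fun hA => h ⟨?_, hA⟩
      have := (InM.inA hj).mul hA
      rwa [map_div₀, inv_div, div_mul_cancel₀ _ hy0] at this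
    | some c =>
      simp only [reduceCtorEq, if_false]
      refine inM_inv_of_not_inA hx fun hA => h ⟨hA, ?_⟩
      have := (InM.inA_of_sub hj).mul hA
      rwa [map_div₀, div_mul_cancel₀ _ hx0] at this

/-- The infinitely near points of the projective plane; a point is good if all the translates of
the coordinate functions are determined there. -/
noncomputable def planeTree (G : Subgroup (K ≃ₐ[k] K)) :
    PointTree (K ≃ₐ[k] K) ((k × k) ⊕ Option k) (Option k) where
  le φ ψ := LocalAt (ψ⁻¹ * φ)
  root := planeRoot k K
  child φ j := φ * (blowFam k K).φ j
  good ψ := ∀ g ∈ G, IsDet k ((ψ⁻¹ * g) (ι x)) ∧ IsDet k ((ψ⁻¹ * g) (ι y)) ∧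
    IsDet k ((ψ⁻¹ * g) (ι y / ι x))
  refl φ := by rw [inv_mul_cancel]; exact localAt_one
  trans {φ ψ χ} h h' := by
    have := h'.mul h
    rwa [mul_assoc, mul_inv_cancel_left] at this
  le_child φ j := by
    rw [mul_inv_rev, mul_assoc, inv_mul_cancel, mul_one]
    exact localAt_blowFam j
  child_unique {φ ψ i j} hi hj := by
    rw [← mul_assoc] at hi hj
    exact (hasValue_of_localAt_blowFam hi).unique (div_ne_zero_image _)
      (hasValue_of_localAt_blowFam hj)
  exists_child {φ ψ} h h' := by
    simp only [← mul_assoc]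
    refine h.exists_child ?_
    rwa [mul_inv_rev, inv_inv]
  root_unique := planeRoot_unique
  exists_root {ψ} h := by
    have := h 1 G.one_mem
    rw [mul_one] at this
    exact exists_planeRoot this.1 this.2.1 this.2.2
  good_mono {φ ψ} h h' g hg := by
    have e : ψ⁻¹ * g = (ψ⁻¹ * φ) * (φ⁻¹ * g) := by group
    rw [e]
    exact ⟨h.isDet (h' g hg).1, h.isDet (h' g hg).2.1, h.isDet (h' g hg).2.2⟩

theorem planeTree_pt (G : Subgroup (K ≃ₐ[k] K)) (r) (l : List (Option k)) : (planeTree G).pt r l =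
    l.foldr (fun j φ => φ * (blowFam k K).φ j) (planeRoot k K r) := by
  induction l with
  | nil => rfl
  | cons j l ih => rw [PointTree.pt, ih]; rfl

theorem HasSum.finite_ne_zero {α : Type*} {f : α → ℤ} {N : ℤ} (h : HasSum f N) :
    {a | f a ≠ 0}.Finite := by
  have := h.summable.tendsto_cofinite_zero
  rw [nhds_discrete, Filter.tendsto_pure] at this
  exact this

theorem finite_not_isDet (z : K) (φ : K ≃ₐ[k] K) : {l : List (Option k) |
    ¬ IsDet k ((l.foldr (fun j ψ => ψ * (blowFam k K).φ j) φ)⁻¹ z)}.Finite := by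
  have hmono : ∀ (φ : K ≃ₐ[k] K), IsDet k (φ⁻¹ z) → ∀ l : List (Option k),
      IsDet k ((l.foldr (fun j ψ => ψ * (blowFam k K).φ j) φ)⁻¹ z) := by
    intro φ h l
    induction l with
    | nil => exact h
    | cons j l ih =>
      rw [List.foldr_cons, mul_inv_rev]
      exact (localAt_blowFam j).isDet ih
  have key : ∀ (n : ℕ) (φ : K ≃ₐ[k] K), (indet k (φ⁻¹ z)).toNat = n → {l : List (Option k) |
    ¬ IsDet k ((l.foldr (fun j ψ => ψ * (blowFam k K).φ j) φ)⁻¹ z)}.Finite := by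
    intro n
    induction n using Nat.strong_induction_on with
    | _ n ih =>
    intro φ hn
    have hnn := indet_nonneg (k := k) (φ⁻¹ z)
    by_cases h0 : indet k (φ⁻¹ z) = 0
    · have := hmono φ (indet_eq_zero_iff.1 h0)
      convert Set.finite_empty
      ext l
      simpa using this l
    · obtain ⟨m, hm, hs⟩ := exists_hasSum_indet_blowFam (k := k) (φ⁻¹ z)
      have hfin := hs.finite_ne_zero
      have hm2 : 0 < m ^ 2 := by have := hm h0; positivity
      have hlt : ∀ j, (indet k ((φ * (blowFam k K).φ j)⁻¹ z)).toNat < n := by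
        intro j
        have := le_hasSum hs j fun i _ => indet_nonneg _
        change indet k ((φ * (blowFam k K).φ j)⁻¹ z) ≤ _ at this
        omega
      refine ((Set.finite_singleton []).union (hfin.biUnion fun j _ =>
        (ih _ (hlt j) _ rfl).image (fun l => l ++ [j]))).subset ?_
      intro l hl
      rcases List.eq_nil_or_concat l with rfl | ⟨l, j, rfl⟩
      · exact Or.inl rfl
      · right
        simp only [List.concat_eq_append, Set.mem_ofPred_eq, List.foldr_append, List.foldr_cons,
          List.foldr_nil] at hl
        simp only [Set.mem_iUnion]
        refine ⟨j, fun h => hl ?_, l, hl, by simp⟩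
        have h' : IsDet k (((blowFam k K).φ j).symm (φ⁻¹ z)) := indet_eq_zero_iff.1 h
        exact hmono (φ * (blowFam k K).φ j) h' l
  exact key _ _ rfl

theorem finite_not_isDet_root (z : K) : {r | ¬ IsDet k ((planeRoot k K r)⁻¹ z)}.Finite := by
  obtain ⟨S, T, hS, hT⟩ := exists_hasSum_indet_infFam (k := k) z
  refine ((hS.finite_ne_zero.image Sum.inl).union (hT.finite_ne_zero.image Sum.inr)).subset ?_
  rintro (q | j) h
  · exact Or.inl ⟨q, fun h' => h (indet_eq_zero_iff.1 h'), rfl⟩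
  · exact Or.inr ⟨j, fun h' => h (indet_eq_zero_iff.1 h'), rfl⟩

theorem finite_not_isDet_pt (G : Subgroup (K ≃ₐ[k] K)) (z : K) :
    {a : ((k × k) ⊕ Option k) × List (Option k) |
      ¬ IsDet k (((planeTree G).pt a.1 a.2)⁻¹ z)}.Finite := by
  refine ((finite_not_isDet_root z).biUnion fun r _ =>
    (finite_not_isDet z (planeRoot k K r)).image (Prod.mk r)).subset ?_
  rintro ⟨r, l⟩ h
  simp only [Set.mem_ofPred_eq] at h
  simp only [Set.mem_iUnion]
  refine ⟨r, fun h' => h ?_, l, by rwa [planeTree_pt] at h, rfl⟩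
  have h1 := (planeTree G).pt_le_of_suffix r (List.nil_suffix (l := l))
  have h2 := LocalAt.isDet (θ := ((planeTree G).pt r l)⁻¹ * planeRoot k K r) h1 h'
  rwa [← AlgEquiv.mul_apply, mul_inv_cancel_right] at h2

theorem planeTree_finite_bad (G : Subgroup (K ≃ₐ[k] K)) [Finite G] :
    (planeTree G).bad.Finite := by
  refine (Set.finite_iUnion fun g : G =>
    ((finite_not_isDet_pt G ((g : K ≃ₐ[k] K) (ι x))).union
      (finite_not_isDet_pt G ((g : K ≃ₐ[k] K) (ι y)))).union
      (finite_not_isDet_pt G ((g : K ≃ₐ[k] K) (ι y / ι x)))).subset ?_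
  intro a ha
  by_contra hcon
  simp only [Set.mem_iUnion, Set.mem_union, not_exists, not_or, Set.mem_ofPred_eq, not_not] at hcon
  exact ha fun g hg => ⟨(hcon ⟨g, hg⟩).1.1, (hcon ⟨g, hg⟩).1.2, (hcon ⟨g, hg⟩).2⟩

end tree

section counting

variable {k K : Type*} [Field k] [IsAlgClosed k] [Field K] [Algebra k K] [Algebra (BiPoly k) K]
  [IsScalarTower k (BiPoly k) K] [IsFractionRing (BiPoly k) K]
  [Algebra (Loc k) K] [IsFractionRing (Loc k) K] [IsScalarTower (BiPoly k) (Loc k) K]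

local notation "ι" => algebraMap (BiPoly k) K
local notation "ℓ" => algebraMap (Loc k) K

theorem jac_ne_zero_image (θ : K ≃ₐ[k] K) {z w : K} (h : jac k z w ≠ 0) :
    jac k (θ z) (θ w) ≠ 0 := by
  intro h0
  have := jac_auto θ.symm (θ z) (θ w)
  rw [θ.symm_apply_apply, θ.symm_apply_apply, h0, map_zero, mul_zero] at this
  exact h this

/-- A finite group of plane Cremona transformations whose point stabilizers have index divisible
by `n`, with enough semi-invariants, has `n` dividing twelve. -/
theorem dvd_twelve_of_stabilizers (G : Subgroup (K ≃ₐ[k] K)) [Finite G] {n : ℕ}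
    {t : (K → ℤ) → K} (ht : IsUnif k t)
    (htG : ∀ g ∈ G, ∀ V, ∃ c : k, c ≠ 0 ∧ tw t g V = algebraMap k K c * t V)
    {u v : K} (hu : ∀ g ∈ G, ∃ c : k, c ≠ 0 ∧ g u = algebraMap k K c * u)
    (hv : ∀ g ∈ G, ∃ c : k, c ≠ 0 ∧ g v = algebraMap k K c * v) (hJ : jac k u v ≠ 0)
    (hstab : ∀ (φ : K ≃ₐ[k] K) (S : Subgroup G), (∀ g ∈ S, LocalAt (φ⁻¹ * (g : K ≃ₐ[k] K) * φ)) →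
      n * Nat.card S ∣ Nat.card G) : (n : ℤ) ∣ 12 := by
  let f : (K ≃ₐ[k] K) → ℤ := fun φ => lam k (tw t φ) (φ.symm u) (φ.symm v)
  refine (planeTree G).dvd_of_action (G := G) (f := f) ?_ ?_ (planeTree_finite_bad G) ?_ ?_ ?_ ?_ ?_
  · intro g φ ψ h
    change LocalAt (((g : K ≃ₐ[k] K) * ψ)⁻¹ * ((g : K ≃ₐ[k] K) * φ))
    rw [mul_inv_rev, mul_assoc, inv_mul_cancel_left]
    exact h
  · intro g φ h g' hg'
    have e : ((g : K ≃ₐ[k] K) * φ)⁻¹ * g' = φ⁻¹ * (((g⁻¹ : G) : K ≃ₐ[k] K) * g') := by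
      rw [mul_inv_rev, mul_assoc]; rfl
    change IsDet k ((((g : K ≃ₐ[k] K) * φ)⁻¹ * g') _) ∧ IsDet k ((((g : K ≃ₐ[k] K) * φ)⁻¹ * g') _) ∧
      IsDet k ((((g : K ≃ₐ[k] K) * φ)⁻¹ * g') _)
    rw [e]
    exact h _ (G.mul_mem (g⁻¹).2 hg')
  · obtain ⟨S, h1, h2⟩ := infFam_hasSum_lam ht hJ
    have := HasSum.sum (f := fun r => f (planeRoot k K r)) h1 h2
    exact this.congr' (fun _ => rfl)
  · intro φ
    exact (blowFam_hasSum_lam (ht.tw φ) (jac_ne_zero_image φ.symm hJ)).congr' (fun _ => rfl) rfl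
  · intro φ ψ h h'
    have h' : LocalAt (ψ⁻¹ * φ)⁻¹ := by rw [mul_inv_rev, inv_inv]; exact h'
    obtain ⟨e, he⟩ := LocalAt.exists_algEquiv (θ := ψ⁻¹ * φ) h h'
    have := lam_auto (ψ⁻¹ * φ) e he (tw t φ) (jac_ne_zero_image φ.symm hJ)
    rw [tw_tw] at this
    change lam k (tw t (φ * (ψ⁻¹ * φ)⁻¹)) ((ψ⁻¹ * (φ * φ⁻¹)) u) ((ψ⁻¹ * (φ * φ⁻¹)) v) = f φ at this
    rw [mul_inv_rev, mul_inv_cancel, mul_one, inv_inv, mul_inv_cancel_left] at this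
    exact this.symm
  · intro g φ
    have hg := (g⁻¹).2
    obtain ⟨c, hc, hcu⟩ := hu _ hg
    obtain ⟨d, hd, hdv⟩ := hv _ hg
    have e1 : ((g : K ≃ₐ[k] K) * φ).symm u = algebraMap k K c * φ.symm u := by
      rw [← AlgEquiv.commutes φ.symm, ← map_mul, ← hcu]; rfl
    have e2 : ((g : K ≃ₐ[k] K) * φ).symm v = algebraMap k K d * φ.symm v := by
      rw [← AlgEquiv.commutes φ.symm, ← map_mul, ← hdv]; rfl
    change lam k (tw t ((g : K ≃ₐ[k] K) * φ)) (((g : K ≃ₐ[k] K) * φ).symm u)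
      (((g : K ≃ₐ[k] K) * φ).symm v) = _
    rw [e1, e2]
    refine lam_const hc hd (fun V => ?_) (jac_ne_zero_image φ.symm hJ)
    obtain ⟨a, ha, h⟩ := htG g g.2 fun z => V (φ.symm z)
    refine ⟨a, ha, ?_⟩
    have h3 : tw t ((g : K ≃ₐ[k] K) * φ) V = φ.symm (tw t (g : K ≃ₐ[k] K) fun z => V (φ.symm z)) :=
      rfl
    rw [h3, h, map_mul, AlgEquiv.commutes]
    rfl
  · intro φ S hS
    refine hstab φ S fun g hg => ?_
    rw [mul_assoc]
    exact (hS g hg).1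

end counting

/-- Commuting operators of order three have a common eigenvector in a stable subspace, outside a
given subspace. -/
theorem exists_common_eigenvector {k M I : Type*} [Field k] [AddCommGroup M] [Module k M] [Finite I]
    (h3 : (3 : k) ≠ 0) {ω : k} (hω : ω ^ 2 + ω + 1 = 0) (ρ : I → M →ₗ[k] M)
    (hcomm : ∀ i j z, ρ i (ρ j z) = ρ j (ρ i z)) (hcube : ∀ i z, ρ i (ρ i (ρ i z)) = z)
    {P N : Submodule k M} (hP : ∀ i, ∀ z ∈ P, ρ i z ∈ P) {z : M} (hz : z ∈ P) (hz' : z ∉ N) :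
    ∃ w ∈ P, w ∉ N ∧ ∀ i, ∃ c : k, c ^ 3 = 1 ∧ ρ i w = c • w := by
  classical
  have hω3 : ω ^ 3 = 1 := by linear_combination (ω - 1) * hω
  have key : ∀ s : Set I, s.Finite → ∃ w ∈ P, w ∉ N ∧ ∀ i ∈ s, ∃ c : k, c ^ 3 = 1 ∧ ρ i w = c • w := by
    intro s hs
    induction s, hs using Set.Finite.induction_on with
    | empty => exact ⟨z, hz, hz', by simp⟩
    | @insert j s _ _ ih =>
      obtain ⟨w, hw, hw', h⟩ := ih
      let π : k → M := fun a => w + a • ρ j w + a ^ 2 • ρ j (ρ j w)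
      have hsum : π 1 + π ω + π (ω ^ 2) = (3 : k) • w := by
        simp only [π]
        have e1 : (ω ^ 2) ^ 2 = ω := by linear_combination ω * hω3
        rw [e1]
        have e2 : (w + (1 : k) • ρ j w + (1 : k) ^ 2 • ρ j (ρ j w)) +
            (w + ω • ρ j w + ω ^ 2 • ρ j (ρ j w)) + (w + ω ^ 2 • ρ j w + ω • ρ j (ρ j w)) =
            (3 : k) • w + (ω ^ 2 + ω + 1) • (ρ j w + ρ j (ρ j w)) := by module
        rw [e2, hω, zero_smul, add_zero]
      have hex : ∃ a : k, a ^ 3 = 1 ∧ π a ∉ N := by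
        by_contra! hcon
        have h1 := hcon 1 (one_pow 3)
        have h2 := hcon ω hω3
        have h4 := hcon (ω ^ 2) (by rw [← pow_mul, mul_comm, pow_mul, hω3, one_pow])
        have h5 := N.add_mem (N.add_mem h1 h2) h4
        rw [hsum] at h5
        exact hw' ((N.smul_mem_iff h3).1 h5)
      obtain ⟨a, ha, haN⟩ := hex
      refine ⟨π a, ?_, haN, ?_⟩
      · exact P.add_mem (P.add_mem hw (P.smul_mem _ (hP _ _ hw)))
          (P.smul_mem _ (hP _ _ (hP _ _ hw)))
      · intro i hi
        rcases Set.mem_insert_iff.1 hi with rfl | hi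
        · refine ⟨a ^ 2, by rw [← pow_mul, mul_comm, pow_mul, ha, one_pow], ?_⟩
          have e1 : a ^ 2 * a ^ 2 = a := by linear_combination a * ha
          have e2 : a ^ 2 * a = 1 := by linear_combination ha
          simp only [π, map_add, map_smul, hcube, smul_add, smul_smul, e1, e2, one_smul]
          abel
        · obtain ⟨c, hc, e⟩ := h i hi
          refine ⟨c, hc, ?_⟩
          simp only [π, map_add, map_smul, hcomm i j, e, smul_add, smul_smul, mul_comm c]
  obtain ⟨w, hw, hw', h⟩ := key Set.univ Set.finite_univ
  exact ⟨w, hw, hw', fun i => h i trivial⟩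

theorem exists_primitive_cube_root {k : Type*} [Field k] [IsAlgClosed k] : ∃ ω : k, ω ^ 2 + ω + 1 = 0 := by
  have hd : (X ^ 2 + X + 1 : k[X]).degree ≠ 0 := by
    have : (X ^ 2 + X + 1 : k[X]).degree = 2 := by compute_degree!
    rw [this]; decide
  obtain ⟨ω, h⟩ := IsAlgClosed.exists_root _ hd
  exact ⟨ω, by simpa [IsRoot] using h⟩

section choices

variable {k K : Type*} [Field k] [IsAlgClosed k] [Field K] [Algebra k K] [Algebra (BiPoly k) K]
  [IsScalarTower k (BiPoly k) K] [IsFractionRing (BiPoly k) K]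
  [Algebra (Loc k) K] [IsFractionRing (Loc k) K] [IsScalarTower (BiPoly k) (Loc k) K]

local notation "ι" => algebraMap (BiPoly k) K
local notation "ℓ" => algebraMap (Loc k) K

/-- Being a semi-invariant of a group of automorphisms. -/
def IsSemiInv (G : Subgroup (K ≃ₐ[k] K)) (z : K) : Prop :=
  ∀ g ∈ G, ∃ c : k, c ≠ 0 ∧ g z = algebraMap k K c * z

theorem exists_isSemiInv (h3 : (3 : k) ≠ 0) (G : Subgroup (K ≃ₐ[k] K)) [Finite G]
    (hcomm : ∀ g ∈ G, ∀ h ∈ G, g * h = h * g) (hcube : ∀ g ∈ G, g ^ 3 = 1)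
    {P N : Submodule k K} (hP : ∀ g ∈ G, ∀ z ∈ P, g z ∈ P) {z : K} (hz : z ∈ P) (hz' : z ∉ N) :
    ∃ w ∈ P, w ∉ N ∧ IsSemiInv G w := by
  obtain ⟨ω, hω⟩ := exists_primitive_cube_root (k := k)
  obtain ⟨w, hw, hw', h⟩ := exists_common_eigenvector (I := G) h3 hω
    (fun g => (g : K ≃ₐ[k] K).toLinearMap)
    (fun g h z => DFunLike.congr_fun (hcomm g g.2 h h.2) z)
    (fun g z => DFunLike.congr_fun (hcube g g.2) z) (fun g => hP g g.2) hz hz'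
  refine ⟨w, hw, hw', fun g hg => ?_⟩
  obtain ⟨c, hc, e⟩ := h ⟨g, hg⟩
  refine ⟨c, ?_, ?_⟩
  · rintro rfl; simp at hc
  · rw [← Algebra.smul_def]; exact e

theorem exists_isSemiInv_pair (h3 : (3 : k) ≠ 0) (G : Subgroup (K ≃ₐ[k] K)) [Finite G]
    (hcomm : ∀ g ∈ G, ∀ h ∈ G, g * h = h * g) (hcube : ∀ g ∈ G, g ^ 3 = 1) :
    ∃ u v : K, IsSemiInv G u ∧ IsSemiInv G v ∧ jac k u v ≠ 0 := by
  obtain ⟨u, -, hu, hu'⟩ := exists_isSemiInv h3 G hcomm hcube (P := ⊤)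
    (N := LinearMap.ker (Dx k K : K →ₗ[k] K) ⊓ LinearMap.ker (Dy k K : K →ₗ[k] K))
    (fun _ _ _ _ => trivial) (z := ι x) trivial (by simp)
  let D : K →ₗ[k] K := LinearMap.mulLeft k (Dx k K u) ∘ₗ (Dy k K : K →ₗ[k] K) -
    LinearMap.mulLeft k (Dy k K u) ∘ₗ (Dx k K : K →ₗ[k] K)
  have hD : ∀ v, D v = jac k u v := fun v => rfl
  have hex : ∃ z, z ∉ LinearMap.ker D := by
    simp only [Submodule.mem_inf, LinearMap.mem_ker, Derivation.coeFn_coe, not_and_or] at hu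
    simp only [LinearMap.mem_ker, hD, jac]
    rcases hu with h | h
    · exact ⟨ι y, by simpa using h⟩
    · exact ⟨ι x, by simpa using h⟩
  obtain ⟨z, hz⟩ := hex
  obtain ⟨v, -, hv, hv'⟩ := exists_isSemiInv h3 G hcomm hcube (P := ⊤) (N := LinearMap.ker D)
    (fun _ _ _ _ => trivial) (z := z) trivial hz
  exact ⟨u, v, hu', hv', fun h => hv h⟩

theorem plc_add {q : Loc k} (hq : Prime q) {z w : K} (hz : z ≠ 0) (hw : w ≠ 0) (hzw : z + w ≠ 0) :
    min (plc K q z) (plc K q w) ≤ plc K q (z + w) := by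
  obtain ⟨a, c, hc, rfl⟩ := IsFractionRing.div_surjective (A := Loc k) z
  obtain ⟨b, d, hd, rfl⟩ := IsFractionRing.div_surjective (A := Loc k) w
  have hc0 : c ≠ 0 := nonZeroDivisors.ne_zero hc
  have hd0 : d ≠ 0 := nonZeroDivisors.ne_zero hd
  have hc' := ℓ_ne_zero (K := K) hc0
  have hd' := ℓ_ne_zero (K := K) hd0
  have ha : a ≠ 0 := by rintro rfl; simp at hz
  have hb : b ≠ 0 := by rintro rfl; simp at hw
  have e1 : ℓ (c * d) * (ℓ a / ℓ c) = ℓ (a * d) := by rw [map_mul, map_mul]; field_simp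
  have e2 : ℓ (c * d) * (ℓ b / ℓ d) = ℓ (b * c) := by rw [map_mul, map_mul]; field_simp
  have e3 : ℓ (c * d) * (ℓ a / ℓ c + ℓ b / ℓ d) = ℓ (a * d + b * c) := by
    rw [mul_add, e1, e2, map_add]
  have hcd := ℓ_ne_zero (K := K) (mul_ne_zero hc0 hd0)
  have hs : a * d + b * c ≠ 0 := by
    intro h; rw [h, map_zero] at e3; exact mul_ne_zero hcd hzw e3
  have hV := plc_isAddv (K := K) hq
  have f1 := congrArg (plc K q) e1
  have f2 := congrArg (plc K q) e2
  have f3 := congrArg (plc K q) e3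
  have hf : ∀ {r : Loc k}, r ≠ 0 → FiniteMultiplicity q r := fun h =>
    FiniteMultiplicity.of_prime_left hq h
  rw [hV.mul _ _ hcd hz, plc_algebraMap hq (mul_ne_zero ha hd0)] at f1
  rw [hV.mul _ _ hcd hw, plc_algebraMap hq (mul_ne_zero hb hc0)] at f2
  rw [hV.mul _ _ hcd hzw, plc_algebraMap hq hs] at f3
  have h5 : min (multiplicity q (a * d)) (multiplicity q (b * c)) ≤
      multiplicity q (a * d + b * c) := by
    refine (hf hs).le_multiplicity_of_pow_dvd (dvd_add ?_ ?_)
    · exact (pow_dvd_pow _ (min_le_left _ _)).trans (pow_multiplicity_dvd _ _)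
    · exact (pow_dvd_pow _ (min_le_right _ _)).trans (pow_multiplicity_dvd _ _)
  omega

/-- The functions vanishing to given order along a divisor. -/
noncomputable def vanSub (V : K → ℤ) (hV : IsAddv V)
    (hadd : ∀ z w, z ≠ 0 → w ≠ 0 → z + w ≠ 0 → min (V z) (V w) ≤ V (z + w))
    (hk : ∀ c : k, c ≠ 0 → V (algebraMap k K c) = 0) (n : ℤ) : Submodule k K where
  carrier := {z | z = 0 ∨ n ≤ V z}
  zero_mem' := Or.inl rfl
  add_mem' {a b} ha hb := by
    by_cases ha0 : a = 0
    · rwa [ha0, zero_add]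
    by_cases hb0 : b = 0
    · rwa [hb0, add_zero]
    by_cases hs : a + b = 0
    · exact Or.inl hs
    have := hadd a b ha0 hb0 hs
    have h1 := ha.resolve_left ha0
    have h2 := hb.resolve_left hb0
    exact Or.inr ((le_min h1 h2).trans this)
  smul_mem' c z hz := by
    by_cases hc : c = 0
    · exact Or.inl (by rw [hc, zero_smul])
    rcases hz with rfl | hz
    · exact Or.inl (smul_zero _)
    by_cases hz0 : z = 0
    · exact Or.inl (by rw [hz0, smul_zero])
    · right
      rw [Algebra.smul_def, hV.mul _ _ (by simpa using hc) hz0, hk c hc, zero_add]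
      exact hz

theorem exists_isSemiInv_unif (h3 : (3 : k) ≠ 0) (G : Subgroup (K ≃ₐ[k] K)) [Finite G]
    (hcomm : ∀ g ∈ G, ∀ h ∈ G, g * h = h * g) (hcube : ∀ g ∈ G, g ^ 3 = 1) (φ : K ≃ₐ[k] K)
    {q : Loc k} (hq : Prime q) (hG : ∀ g ∈ G, ∀ z, plc K q (φ.symm (g z)) = plc K q (φ.symm z)) :
    ∃ z, plc K q (φ.symm z) = 1 ∧ IsSemiInv G z := by
  have hV : IsAddv fun z => plc K q (φ.symm z) := (plc_isAddv hq).comp φ.symm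
  have hadd : ∀ z w : K, z ≠ 0 → w ≠ 0 → z + w ≠ 0 → min (plc K q (φ.symm z))
      (plc K q (φ.symm w)) ≤ plc K q (φ.symm (z + w)) := by
    intro z w hz hw hzw
    rw [map_add]
    exact plc_add hq (by simpa using hz) (by simpa using hw) (by rwa [← map_add, _root_.map_ne_zero])
  have hk : ∀ c : k, c ≠ 0 → plc K q (φ.symm (algebraMap k K c)) = 0 := by
    intro c hc
    rw [AlgEquiv.commutes, ← ℓ_algebraMap, plc_of_not_dvd hq]
    exact fun h => hq.not_isUnit (isUnit_of_dvd_unit h (isUnit_algebraMap_loc hc))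
  have h1 : φ (ℓ q) ∈ vanSub _ hV hadd hk 1 := Or.inr (by simp [plc_self hq])
  have h2 : φ (ℓ q) ∉ vanSub _ hV hadd hk 2 := by
    rintro (h | h)
    · exact ℓ_ne_zero (K := K) hq.ne_zero ((map_eq_zero φ).1 h)
    · simp [plc_self hq] at h
  obtain ⟨w, hw, hw', h⟩ := exists_isSemiInv h3 G hcomm hcube (P := vanSub _ hV hadd hk 1)
    (N := vanSub _ hV hadd hk 2) (by
      rintro g hg z (rfl | hz)
      · exact Or.inl (map_zero g)
      · refine Or.inr ?_
        change 1 ≤ plc K q (φ.symm (g z))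
        rw [hG g hg]
        exact hz) h1 h2
  refine ⟨w, ?_, h⟩
  have h4 : w ≠ 0 := fun h => hw' (Or.inl h)
  have h5 : 1 ≤ plc K q (φ.symm w) := hw.resolve_left h4
  have h6 : ¬ 2 ≤ plc K q (φ.symm w) := fun h => hw' (Or.inr h)
  omega

end choices

section equivariantUniformizers

variable {k K : Type*} [Field k] [IsAlgClosed k] [Field K] [Algebra k K] [Algebra (BiPoly k) K]
  [IsScalarTower k (BiPoly k) K] [IsFractionRing (BiPoly k) K]
  [Algebra (Loc k) K] [IsFractionRing (Loc k) K] [IsScalarTower (BiPoly k) (Loc k) K]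

/-- The action of a group of automorphisms on functions, up to orbits. -/
def orbitSetoid (G : Subgroup (K ≃ₐ[k] K)) : Setoid (K → ℤ) where
  r W V := ∃ g ∈ G, V = fun z => W (g⁻¹ z)
  iseqv :=
    { refl := fun V => ⟨1, G.one_mem, rfl⟩
      symm := by
        rintro W _ ⟨g, hg, rfl⟩
        refine ⟨g⁻¹, G.inv_mem hg, ?_⟩
        funext z
        rw [inv_inv]
        exact congrArg W (DFunLike.congr_fun (inv_mul_cancel g) z).symm
      trans := by
        rintro W _ _ ⟨g, hg, rfl⟩ ⟨h, hh, rfl⟩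
        refine ⟨h * g, G.mul_mem hh hg, ?_⟩
        funext z
        rw [mul_inv_rev]; rfl }

/-- The stabilizer of a function in a group of automorphisms. -/
def funStab (G : Subgroup (K ≃ₐ[k] K)) (W : K → ℤ) : Subgroup (K ≃ₐ[k] K) where
  carrier := {g | g ∈ G ∧ ∀ z, W (g z) = W z}
  one_mem' := ⟨G.one_mem, fun _ => rfl⟩
  mul_mem' {g h} hg hh := ⟨G.mul_mem hg.1 hh.1, fun z => (hg.2 (h z)).trans (hh.2 z)⟩
  inv_mem' {g} hg := ⟨G.inv_mem hg.1, fun z => by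
    rw [← hg.2 (g⁻¹ z)]
    exact congrArg W (DFunLike.congr_fun (mul_inv_cancel g) z)⟩

theorem exists_equivariant_unif (h3 : (3 : k) ≠ 0) (G : Subgroup (K ≃ₐ[k] K)) [Finite G]
    (hcomm : ∀ g ∈ G, ∀ h ∈ G, g * h = h * g) (hcube : ∀ g ∈ G, g ^ 3 = 1) :
    ∃ t : (K → ℤ) → K, IsUnif k t ∧
      ∀ g ∈ G, ∀ V, ∃ c : k, c ≠ 0 ∧ tw t g V = algebraMap k K c * t V := by
  classical
  have hτ : ∀ W : K → ℤ, ∃ w : K, IsSemiInv (funStab G W) w ∧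
      ((∃ (φ : K ≃ₐ[k] K) (q : Loc k), Prime q ∧ W = fun z => plc K q (φ.symm z)) → W w = 1) := by
    intro W
    by_cases hW : ∃ (φ : K ≃ₐ[k] K) (q : Loc k), Prime q ∧ W = fun z => plc K q (φ.symm z)
    · obtain ⟨φ, q, hq, rfl⟩ := hW
      have : Finite (funStab G fun z => plc K q (φ.symm z)) :=
        Finite.of_injective (β := G) (fun g => ⟨g, g.2.1⟩) fun g h e =>
          Subtype.ext (congrArg (fun x : G => (x : K ≃ₐ[k] K)) e)
      obtain ⟨z, hz, hz'⟩ := exists_isSemiInv_unif h3 (funStab G fun z => plc K q (φ.symm z))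
        (fun g hg h hh => hcomm g hg.1 h hh.1) (fun g hg => hcube g hg.1) φ hq
        fun g hg z => hg.2 z
      exact ⟨z, hz', fun _ => hz⟩
    · exact ⟨0, fun g _ => ⟨1, one_ne_zero, by simp⟩, fun h => absurd h hW⟩
  choose τ hτ1 hτ2 using hτ
  let rep : (K → ℤ) → K → ℤ := fun V => (Quotient.mk (orbitSetoid G) V).out
  have hrep : ∀ V, ∃ g ∈ G, V = fun z => rep V (g⁻¹ z) := fun V =>
    Quotient.exact (s := orbitSetoid G) (Quotient.out_eq _)
  choose m hm hm' using hrep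
  have hrep' : ∀ g ∈ G, ∀ V : K → ℤ, rep (fun z => V (g⁻¹ z)) = rep V := fun g hg V =>
    congrArg Quotient.out (Quotient.sound (s := orbitSetoid G)
      ((orbitSetoid G).symm ⟨g, hg, rfl⟩))
  refine ⟨fun V => m V (τ (rep V)), ?_, ?_⟩
  · intro φ q hq
    set V : K → ℤ := fun z => plc K q (φ.symm z) with hV
    change V (m V (τ (rep V))) = 1
    have h1 : ∀ z, V (m V z) = rep V z := fun z =>
      (congrFun (hm' V) (m V z)).trans
        (congrArg (rep V) (DFunLike.congr_fun (inv_mul_cancel (m V)) z))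
    rw [h1]
    refine hτ2 _ ⟨(m V)⁻¹ * φ, q, hq, ?_⟩
    funext z
    rw [← h1]
    rfl
  · intro g hg V
    have hs : (m V)⁻¹ * g⁻¹ * m (fun z => V (g⁻¹ z)) ∈ funStab G (rep V) := by
      refine ⟨G.mul_mem (G.mul_mem (G.inv_mem (hm V)) (G.inv_mem hg)) (hm _), fun z => ?_⟩
      have e1 := congrFun (hm' V) (g⁻¹ (m (fun z => V (g⁻¹ z)) z))
      have e2 := congrFun (hm' (fun z => V (g⁻¹ z))) (m (fun z => V (g⁻¹ z)) z)
      rw [hrep' g hg V] at e2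
      refine e1.symm.trans (e2.trans ?_)
      exact congrArg (rep V) (DFunLike.congr_fun (inv_mul_cancel (m fun z => V (g⁻¹ z))) z)
    obtain ⟨c, hc, e⟩ := hτ1 _ _ hs
    refine ⟨c, hc, ?_⟩
    change g⁻¹ (m (fun z => V (g⁻¹ z)) (τ (rep fun z => V (g⁻¹ z)))) = _
    rw [hrep' g hg V]
    have e3 := congrArg (m V) e
    rw [map_mul, AlgEquiv.commutes] at e3
    rw [← e3]
    exact DFunLike.congr_fun (show g⁻¹ * m (fun z => V (g⁻¹ z)) =
      m V * ((m V)⁻¹ * g⁻¹ * m (fun z => V (g⁻¹ z))) by group) (τ (rep V))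

end equivariantUniformizers

section localStabilizers

variable {k : Type*} [Field k]

open IsLocalRing

/-- Two elements of the maximal ideal spanning it modulo its square generate it. -/
theorem maximalIdeal_loc_eq_span {u v : Loc k} (hu : u ∈ maximalIdeal (Loc k))
    (hu' : u ∉ maximalIdeal (Loc k) ^ 2) (hv : v ∈ maximalIdeal (Loc k))
    (hv' : v ∉ maximalIdeal (Loc k) ^ 2 ⊔ Ideal.span {u}) :
    ∀ z ∈ maximalIdeal (Loc k), ∃ a b, z = a * u + b * v := by
  have hx : toLoc k x ∈ maximalIdeal (Loc k) :=
    (mem_maximalIdeal _).2 (prime_toLoc prime_x (by simp)).not_isUnit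
  have hy : toLoc k y ∈ maximalIdeal (Loc k) :=
    (mem_maximalIdeal _).2 (prime_toLoc prime_y (by simp)).not_isUnit
  obtain ⟨a, b, e⟩ := mem_maximalIdeal_loc ((mem_maximalIdeal _).1 hu)
  obtain ⟨c, d, e'⟩ := mem_maximalIdeal_loc ((mem_maximalIdeal _).1 hv)
  have hD : IsUnit (a * d - b * c) := by
    by_contra hD
    have hD := (mem_maximalIdeal _).2 hD
    have hmul : ∀ {s t : Loc k}, s ∈ maximalIdeal (Loc k) → t ∈ maximalIdeal (Loc k) →
        s * t ∈ maximalIdeal (Loc k) ^ 2 := fun hs ht => by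
      rw [pow_two]; exact Ideal.mul_mem_mul hs ht
    have hab : IsUnit a ∨ IsUnit b := by
      by_contra! h
      refine hu' ?_
      rw [e]
      exact Ideal.add_mem _ (hmul ((mem_maximalIdeal _).2 h.1) hx)
        (hmul ((mem_maximalIdeal _).2 h.2) hy)
    rcases hab with ⟨a, rfl⟩ | ⟨b, rfl⟩
    · refine hv' (Submodule.mem_sup.2 ⟨↑a⁻¹ * ((↑a * d - b * c) * toLoc k y),
        Ideal.mul_mem_left _ _ (hmul hD hy), ↑a⁻¹ * c * u,
        Ideal.mul_mem_left _ _ (Ideal.mem_span_singleton_self u), ?_⟩)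
      rw [e, e']
      linear_combination (c * toLoc k x + d * toLoc k y) * a.inv_mul
    · refine hv' (Submodule.mem_sup.2 ⟨-(↑b⁻¹) * ((a * d - ↑b * c) * toLoc k x),
        Ideal.mul_mem_left _ _ (hmul hD hx), ↑b⁻¹ * d * u,
        Ideal.mul_mem_left _ _ (Ideal.mem_span_singleton_self u), ?_⟩)
      rw [e, e']
      linear_combination (c * toLoc k x + d * toLoc k y) * b.inv_mul
  obtain ⟨D, hD⟩ := hD
  intro z hz
  obtain ⟨p, q, rfl⟩ := mem_maximalIdeal_loc ((mem_maximalIdeal _).1 hz)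
  refine ⟨↑D⁻¹ * (p * d - q * c), ↑D⁻¹ * (q * a - p * b), ?_⟩
  rw [e, e']
  have h1 := D.inv_mul
  rw [hD] at h1
  linear_combination (-(p * toLoc k x + q * toLoc k y)) * h1

/-- An automorphism of the local ring fixing two parameters is trivial. -/
theorem loc_algEquiv_eq_one {f : Loc k ≃ₐ[k] Loc k} {u v : Loc k}
    (hu : u ∈ maximalIdeal (Loc k)) (hv : v ∈ maximalIdeal (Loc k))
    (huv : ∀ z ∈ maximalIdeal (Loc k), ∃ a b, z = a * u + b * v) (hfu : f u = u) (hfv : f v = v) :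
    f = 1 := by
  have key : ∀ (n : ℕ) z, f z - z ∈ maximalIdeal (Loc k) ^ n := by
    intro n
    induction n with
    | zero => simp
    | succ n ih =>
      intro z
      obtain ⟨c, hc⟩ := loc_residue z
      obtain ⟨a, b, e⟩ := huv _ ((mem_maximalIdeal _).2 hc)
      have e1 : z = a * u + b * v + algebraMap k (Loc k) c := by rw [← e]; ring
      have e2 : f z - z = (f a - a) * u + (f b - b) * v := by
        rw [e1, map_add, map_add, map_mul, map_mul, hfu, hfv, AlgEquiv.commutes]; ring
      rw [e2, pow_succ]
      exact Ideal.add_mem _ (Ideal.mul_mem_mul (ih a) hu) (Ideal.mul_mem_mul (ih b) hv)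
  ext z
  have h : f z - z ∈ (⨅ n, maximalIdeal (Loc k) ^ n : Ideal (Loc k)) :=
    Ideal.mem_iInf.2 fun n => key n z
  rw [Ideal.iInf_pow_eq_bot_of_isLocalRing _ (maximalIdeal.isMaximal (Loc k)).ne_top,
    Ideal.mem_bot] at h
  exact sub_eq_zero.1 h

theorem algEquiv_mem_maximalIdeal {R : Type*} [CommRing R] [IsLocalRing R] [Algebra k R]
    (f : R ≃ₐ[k] R) {z : R} (hz : z ∈ maximalIdeal R) : f z ∈ maximalIdeal R := by
  rw [mem_maximalIdeal] at hz ⊢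
  exact fun h => hz ((isUnit_map_iff f z).1 h)

theorem exists_mem_maximalIdeal_not_mem :
    ∃ z ∈ maximalIdeal (Loc k), z ∉ maximalIdeal (Loc k) ^ 2 := by
  by_contra! h
  have h1 : maximalIdeal (Loc k) ≤ maximalIdeal (Loc k) • maximalIdeal (Loc k) := by
    rw [smul_eq_mul, ← pow_two]; exact h
  have h2 := Submodule.eq_bot_of_le_smul_of_le_jacobson_bot _ _
    (IsNoetherian.noetherian (maximalIdeal (Loc k))) h1 (maximalIdeal_le_jacobson _)
  have h3 : toLoc k x ∈ maximalIdeal (Loc k) :=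
    (mem_maximalIdeal _).2 (prime_toLoc prime_x (by simp)).not_isUnit
  rw [h2, Ideal.mem_bot] at h3
  exact (prime_toLoc prime_x (by simp)).ne_zero h3

theorem exists_mem_maximalIdeal_not_mem_sup {u : Loc k} (hu : u ∈ maximalIdeal (Loc k)) :
    ∃ z ∈ maximalIdeal (Loc k), z ∉ maximalIdeal (Loc k) ^ 2 ⊔ Ideal.span {u} := by
  by_contra! h
  have h1 : maximalIdeal (Loc k) ≤
      Ideal.span {u} ⊔ maximalIdeal (Loc k) • maximalIdeal (Loc k) := by
    rw [smul_eq_mul, ← pow_two, sup_comm]; exact h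
  have h2 := Submodule.le_of_le_smul_of_le_jacobson_bot
    (IsNoetherian.noetherian (maximalIdeal (Loc k))) (maximalIdeal_le_jacobson _) h1
  have hx : toLoc k x ∈ maximalIdeal (Loc k) :=
    (mem_maximalIdeal _).2 (prime_toLoc prime_x (by simp)).not_isUnit
  have hy : toLoc k y ∈ maximalIdeal (Loc k) :=
    (mem_maximalIdeal _).2 (prime_toLoc prime_y (by simp)).not_isUnit
  exact (mem_maximalIdeal _).1 hu (isRelPrime_toLoc isRelPrime_x_y
    (Ideal.mem_span_singleton.1 (h2 hx)) (Ideal.mem_span_singleton.1 (h2 hy)))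

/-- An elementary abelian `3`-group acting faithfully on the local ring has order at most nine. -/
theorem card_le_nine_of_loc [IsAlgClosed k] (h3 : (3 : k) ≠ 0) {S : Type*} [Group S] [Finite S]
    (hcomm : ∀ g h : S, g * h = h * g) (hcube : ∀ g : S, g ^ 3 = 1)
    (e : S →* (Loc k ≃ₐ[k] Loc k)) (he : Function.Injective e) : Nat.card S ≤ 9 := by
  classical
  obtain ⟨ω, hω⟩ := exists_primitive_cube_root (k := k)
  have c1 : ∀ i j z, e i (e j z) = e j (e i z) := fun i j z => by
    rw [← AlgEquiv.mul_apply, ← AlgEquiv.mul_apply, ← map_mul, ← map_mul, hcomm]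
  have c2 : ∀ i z, e i (e i (e i z)) = z := fun i z => by
    rw [← AlgEquiv.mul_apply, ← AlgEquiv.mul_apply, ← map_mul, ← map_mul, ← pow_three',
      hcube, map_one, AlgEquiv.one_apply]
  have c3 : ∀ i, ∀ z ∈ (maximalIdeal (Loc k)).restrictScalars k,
      (e i).toLinearMap z ∈ (maximalIdeal (Loc k)).restrictScalars k := fun i z hz =>
    algEquiv_mem_maximalIdeal (e i) hz
  obtain ⟨z, hz, hz'⟩ := exists_mem_maximalIdeal_not_mem (k := k)
  obtain ⟨u, hu, hu', cu⟩ := exists_common_eigenvector h3 hω (fun i => (e i).toLinearMap) c1 c2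
    (P := (maximalIdeal (Loc k)).restrictScalars k)
    (N := (maximalIdeal (Loc k) ^ 2).restrictScalars k) c3
    ((Submodule.restrictScalars_mem k _ _).2 hz) (mt (Submodule.restrictScalars_mem k _ _).1 hz')
  obtain ⟨z, hz, hz'⟩ := exists_mem_maximalIdeal_not_mem_sup hu
  obtain ⟨v, hv, hv', cv⟩ := exists_common_eigenvector h3 hω (fun i => (e i).toLinearMap) c1 c2
    (P := (maximalIdeal (Loc k)).restrictScalars k)
    (N := (maximalIdeal (Loc k) ^ 2 ⊔ Ideal.span {u}).restrictScalars k) c3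
    ((Submodule.restrictScalars_mem k _ _).2 hz) (mt (Submodule.restrictScalars_mem k _ _).1 hz')
  have huv := maximalIdeal_loc_eq_span hu hu' hv hv'
  choose a ha ha' using cu
  choose b hb hb' using cv
  have hfix : ∀ {w : Loc k} {c d : k} {g h : S}, c ^ 3 = 1 → e g w = c • w → e h w = d • w → c = d →
      e (h⁻¹ * g) w = w := by
    rintro w c d g h hc e1 e2 rfl
    rw [map_mul, AlgEquiv.mul_apply, e1, ← e2, ← AlgEquiv.mul_apply, ← map_mul, inv_mul_cancel,
      map_one, AlgEquiv.one_apply]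
  let F : Finset k := (nthRoots 3 (1 : k)).toFinset
  have hF : F.card ≤ 3 := (Multiset.toFinset_card_le _).trans (card_nthRoots 3 1)
  have hmem : ∀ {c : k}, c ^ 3 = 1 → c ∈ F := fun h =>
    Multiset.mem_toFinset.2 ((mem_nthRoots (by norm_num)).2 h)
  have hinj : Function.Injective
      fun g : S => ((⟨a g, hmem (ha g)⟩, ⟨b g, hmem (hb g)⟩) : F × F) := by
    intro g h hgh
    have e1 : a g = a h := congrArg (fun p : F × F => (p.1 : k)) hgh
    have e2 : b g = b h := congrArg (fun p : F × F => (p.2 : k)) hgh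
    have := loc_algEquiv_eq_one hu hv huv (hfix (ha g) (ha' g) (ha' h) e1)
      (hfix (hb g) (hb' g) (hb' h) e2)
    rw [← map_one e] at this
    exact (inv_mul_eq_one.1 (he this)).symm
  have := Nat.card_le_card_of_injective _ hinj
  rw [Nat.card_prod, Nat.card_eq_fintype_card (α := F), Fintype.card_coe] at this
  nlinarith

end localStabilizers

section core

variable {k K : Type*} [Field k] [IsAlgClosed k] [Field K] [Algebra k K] [Algebra (BiPoly k) K]
  [IsScalarTower k (BiPoly k) K] [IsFractionRing (BiPoly k) K]
  [Algebra (Loc k) K] [IsFractionRing (Loc k) K] [IsScalarTower (BiPoly k) (Loc k) K]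

local notation "ℓ" => algebraMap (Loc k) K

theorem card_le_nine_of_localAt (h3 : (3 : k) ≠ 0) {S : Type*} [Group S] [Finite S]
    (hcomm : ∀ g h : S, g * h = h * g) (hcube : ∀ g : S, g ^ 3 = 1) (θ : S →* (K ≃ₐ[k] K))
    (hθ : Function.Injective θ) (hloc : ∀ g, LocalAt (θ g)) : Nat.card S ≤ 9 := by
  have h : ∀ g, ∃ e : Loc k ≃ₐ[k] Loc k, ∀ z, θ g (ℓ z) = ℓ (e z) := fun g =>
    (hloc g).exists_algEquiv (by rw [← map_inv]; exact hloc _)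
  choose e he using h
  have hinj := IsFractionRing.injective (Loc k) K
  let E : S →* (Loc k ≃ₐ[k] Loc k) := MonoidHom.mk' e fun g h => by
    ext z
    refine hinj ?_
    rw [← he, map_mul, AlgEquiv.mul_apply, he, he, AlgEquiv.mul_apply]
  refine card_le_nine_of_loc h3 hcomm hcube E fun g h hgh => hθ ?_
  have hgh : e g = e h := hgh
  ext z
  obtain ⟨a, c, hc, rfl⟩ := IsFractionRing.div_surjective (A := Loc k) z
  rw [map_div₀, map_div₀, he, he, he, he, hgh]

theorem elementary_rank_le_three_of_isFractionRing (h3 : (3 : k) ≠ 0) (r : ℕ)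
    (G : Subgroup (K ≃ₐ[k] K)) (hG : Nonempty (G ≃* Multiplicative (Fin r → ZMod 3))) : r ≤ 3 := by
  obtain ⟨E⟩ := hG
  have hfin : Finite G := Finite.of_equiv _ E.symm.toEquiv
  have hcard : Nat.card G = 3 ^ r := by
    rw [Nat.card_congr (E.toEquiv.trans Multiplicative.toAdd)]
    simp
  have hcomm : ∀ g h : G, g * h = h * g := fun g h => E.injective (by rw [map_mul, map_mul, mul_comm])
  have hcube : ∀ g : G, g ^ 3 = 1 := fun g => E.injective (by
    rw [map_pow, map_one]
    refine Multiplicative.toAdd.injective (funext fun i => ?_)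
    rw [toAdd_pow, toAdd_one, Pi.smul_apply, Pi.zero_apply]
    generalize Multiplicative.toAdd (E g) i = c
    revert c; decide)
  have hcomm' : ∀ g ∈ G, ∀ h ∈ G, g * h = h * g := fun g hg h hh =>
    congrArg Subtype.val (hcomm ⟨g, hg⟩ ⟨h, hh⟩)
  have hcube' : ∀ g ∈ G, g ^ 3 = 1 := fun g hg => congrArg Subtype.val (hcube ⟨g, hg⟩)
  by_contra! hr
  obtain ⟨t, ht, htG⟩ := exists_equivariant_unif h3 G hcomm' hcube'
  obtain ⟨u, v, hu, hv, hJ⟩ := exists_isSemiInv_pair h3 G hcomm' hcube'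
  have := dvd_twelve_of_stabilizers (n := 9) G ht htG hu hv hJ ?_
  · norm_num at this
  intro φ S hS
  have h9 : Nat.card S ≤ 9 := by
    refine card_le_nine_of_localAt (K := K) h3 (fun g h => Subtype.ext (hcomm g h))
      (fun g => Subtype.ext (hcube g))
      (((MulAut.conj φ⁻¹).toMonoidHom.comp G.subtype).comp S.subtype) ?_ ?_
    · exact (MulAut.conj φ⁻¹).injective.comp (Subtype.val_injective.comp Subtype.val_injective)
    · intro g
      simpa using hS g g.2
  have hdvd : Nat.card S ∣ 3 ^ r := hcard ▸ S.card_subgroup_dvd_card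
  obtain ⟨s, -, hs⟩ := (Nat.dvd_prime_pow Nat.prime_three).1 hdvd
  rw [hs] at h9 ⊢
  have hs2 : s ≤ 2 := (Nat.pow_le_pow_iff_right (by norm_num : 1 < 3)).1 (h9.trans (by norm_num))
  rw [hcard, show 9 = 3 ^ 2 by norm_num, ← pow_add]
  exact pow_dvd_pow _ (by omega)

end core

/-- Polynomials in two variables as iterated univariate polynomials. -/
noncomputable def bipolyEquiv (k : Type*) [Field k] : BiPoly k ≃ₐ[k] MvPolynomial (Fin 2) k :=
  ((MvPolynomial.finSuccEquiv k 1).trans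
    (Polynomial.mapAlgEquiv (MvPolynomial.uniqueAlgEquiv k (Fin 1)))).symm

/-- if `k` is algebraically closed with `char k ≠ 3`
and `G ≤ Cr_k = Aut_k(k(x,y))` is isomorphic to `(ℤ/3)^r`, then `r ≤ 3`. -/
theorem three_elementary_rank_le_three
    (k : Type*) [Field k] [IsAlgClosed k] (hchar : ringChar k ≠ 3)
    (r : ℕ) (G : Subgroup (Kxy k ≃ₐ[k] Kxy k))
    (hG : Nonempty (G ≃* Multiplicative (Fin r → ZMod 3))) :
    r ≤ 3 := by
  have h3 : (3 : k) ≠ 0 := by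
    intro h
    have h1 : ringChar k ∣ 3 := (ringChar.spec k 3).1 (by exact_mod_cast h)
    rcases (Nat.dvd_prime Nat.prime_three).1 h1 with h2 | h2
    · exact CharP.ringChar_ne_one h2
    · exact hchar h2
  let iK : Algebra (BiPoly k) (Kxy k) :=
    ((algebraMap (MvPolynomial (Fin 2) k) (Kxy k)).comp (bipolyEquiv k : BiPoly k →+* _)).toAlgebra
  have hmap : ∀ p : BiPoly k, algebraMap (BiPoly k) (Kxy k) p =
    algebraMap (MvPolynomial (Fin 2) k) (Kxy k) (bipolyEquiv k p) := fun _ => rfl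
  have hT : IsScalarTower k (BiPoly k) (Kxy k) := IsScalarTower.of_algebraMap_eq fun c => by
    rw [hmap, AlgEquiv.commutes, ← IsScalarTower.algebraMap_apply]
  have hF : IsFractionRing (BiPoly k) (Kxy k) := by
    have h := IsLocalization.isLocalization_of_base_ringEquiv
      (nonZeroDivisors (MvPolynomial (Fin 2) k)) (Kxy k) (bipolyEquiv k).symm.toRingEquiv
    rw [MulEquivClass.map_nonZeroDivisors (bipolyEquiv k).symm.toRingEquiv] at h
    exact h
  have hu : ∀ s : (origin k).primeCompl, IsUnit (algebraMap (BiPoly k) (Kxy k) s) := fun s => by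
    refine isUnit_iff_ne_zero.2 fun h => s.2 ?_
    rw [(map_eq_zero_iff _ (IsFractionRing.injective (BiPoly k) (Kxy k))).1 h]
    exact (origin k).zero_mem
  let iL : Algebra (Loc k) (Kxy k) := (IsLocalization.lift (S := Loc k) hu).toAlgebra
  have hTL : IsScalarTower (BiPoly k) (Loc k) (Kxy k) := IsScalarTower.of_algebraMap_eq fun p =>
    (IsLocalization.lift_eq (S := Loc k) hu p).symm
  have hFL : IsFractionRing (Loc k) (Kxy k) :=
    IsFractionRing.isFractionRing_of_isDomain_of_isLocalization (origin k).primeCompl _ _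
  exact elementary_rank_le_three_of_isFractionRing h3 r G hG
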